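/- Coupling drift comparison: Let (E_t) be the MAW on ℤ² and (R_t) SRW coupled so that at NV-steps (where the left neighbor of E's position was visited) they move identically, and at non-NV steps they use the described joint distribution (each marginal correct; the difference's first coordinate never decreases and increases by a positive amount in expectation, second coordinate is a martingale). Let D(k,l) = (E(l) - R(l)) - (E(k) - R(k)). If K denotes the number of non-NV steps of E in [k,l], then P(D(k,l)_1 + 1 < K/λ) ≤ C e^{-cλ} for all λ > 0 and P(|D(k,l)_2| > λ√K) ≤ C e^{-cλ²} for all λ > 0. Consequently, P(∃ k < l < n : |D(k,l)_2| ≥ C log n · √(D(k,l)_1 + 1)) ≤ 1/n for C large enough. -/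

import Mathlib

open MeasureTheory Filter
open scoped Classical

/-- The four unit steps on ℤ². -/
def dirs : Set (ℤ × ℤ) := {(1, 0), (-1, 0), (0, 1), (0, -1)}

/-- Time `l` is a *non-NV time* of the walk `E` at `ω`: the left neighbour of the current
position `E l ω` has never been visited before (so it is a "new vertex" excitation time
for the monotone adaptive walk). -/
def nonNV {Ω : Type*} (E : ℕ → Ω → ℤ × ℤ) (l : ℕ) (ω : Ω) : Prop :=
  ∀ s ≤ l, E s ω ≠ E l ω + (-1, 0)

/-- The joint one-step distribution of (MAW step `a`, SRW step `b`) at a non-NV time: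
both left with probability `1/7`; both up/right/down with probability `1/4` each;
SRW left and MAW up/right/down with probability `1/28` each. -/
noncomputable def jointStepProb (a b : ℤ × ℤ) : ℝ :=
  if a = (-1, 0) ∧ b = (-1, 0) then 1 / 7
  else if a = b then 1 / 4
  else if b = (-1, 0) then 1 / 28
  else 0

/-- The drift increment `D(k,l) = (E(l) - R(l)) - (E(k) - R(k))`. -/
def driftD {Ω : Type*} (E R : ℕ → Ω → ℤ × ℤ) (k l : ℕ) (ω : Ω) : ℤ × ℤ :=
  (E l ω - R l ω) - (E k ω - R k ω)

/-- The number `K` of non-NV times of `E` in `[k, l)`. -/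
noncomputable def numNonNV {Ω : Type*} (E : ℕ → Ω → ℤ × ℤ) (k l : ℕ) (ω : Ω) : ℕ :=
  {j | k ≤ j ∧ j < l ∧ nonNV E j ω}.ncard

/-- Joint trajectories of two walks on `ℤ²`; the first component is the adaptive walk. -/
abbrev JPath : Type := ℕ → (ℤ × ℤ) × (ℤ × ℤ)

/-- The left neighbour of the position of the first walk at time `t` is unvisited. -/
def FreshLeft (t : ℕ) (p : JPath) : Prop := ∀ s ≤ t, (p s).1 ≠ (p t).1 + (-1, 0)

/-- Mean of `g` over one joint step, where `c` says whether the left neighbour is unvisited. -/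
noncomputable def stepMean (c : Prop) (g : ℤ × ℤ → ℤ × ℤ → ℝ) : ℝ :=
  if c then 1 / 7 * g (-1, 0) (-1, 0)
      + 1 / 4 * (g (1, 0) (1, 0) + g (0, 1) (0, 1) + g (0, -1) (0, -1))
      + 1 / 28 * (g (1, 0) (-1, 0) + g (0, 1) (-1, 0) + g (0, -1) (-1, 0))
  else 1 / 4 * (g (-1, 0) (-1, 0) + g (1, 0) (1, 0) + g (0, 1) (0, 1) + g (0, -1) (0, -1))

/-- The joint steps of positive probability. -/
def AllowedStep (c : Prop) (a b : ℤ × ℤ) : Prop :=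
  (a = b ∧ a ∈ dirs) ∨ (c ∧ b = (-1, 0) ∧ a ∈ dirs ∧ a ≠ (-1, 0))

/-- The trajectory `p` up to time `t`, followed by the joint step `(a, b)`. -/
def addStep (p : JPath) (t : ℕ) (a b : ℤ × ℤ) : JPath :=
  Function.update p (t + 1) ((p t).1 + a, (p t).2 + b)

/-- Mean of `F` over the trajectories that follow `p` up to time `t` and then make `n` random
steps. -/
noncomputable def pathMean : ℕ → ℕ → JPath → (JPath → ℝ) → ℝ
  | 0, _, p, F => F p
  | n + 1, t, p, F =>
      stepMean (FreshLeft t p) fun a b => pathMean n (t + 1) (addStep p t a b) F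

/-- Probability of `Q` after following `p` up to time `t` and making `n` random steps. -/
noncomputable def pathProb (n t : ℕ) (p : JPath) (Q : JPath → Prop) : ℝ :=
  pathMean n t p fun q => if Q q then 1 else 0

/-- `q` continues the history of `p` up to time `t` by `n` steps of positive probability. -/
def IsCont (p : JPath) (t n : ℕ) (q : JPath) : Prop :=
  (∀ s ≤ t, q s = p s) ∧ ∀ s, t ≤ s → s < t + n →
    AllowedStep (FreshLeft s q) ((q (s + 1)).1 - (q s).1) ((q (s + 1)).2 - (q s).2)

/-- Number of times in `[t, t + n)` at which the left neighbour is unvisited. -/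
noncomputable def freshCount (q : JPath) (t n : ℕ) : ℕ :=
  ((Finset.range n).filter fun i => FreshLeft (t + i) q).card

lemma stepMean_mono {c : Prop} {g g' : ℤ × ℤ → ℤ × ℤ → ℝ}
    (h : ∀ a b, AllowedStep c a b → g a b ≤ g' a b) : stepMean c g ≤ stepMean c g' := by
  unfold stepMean
  have h1 := h (-1, 0) (-1, 0) (Or.inl ⟨rfl, by simp [dirs]⟩)
  have h2 := h (1, 0) (1, 0) (Or.inl ⟨rfl, by simp [dirs]⟩)
  have h3 := h (0, 1) (0, 1) (Or.inl ⟨rfl, by simp [dirs]⟩)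
  have h4 := h (0, -1) (0, -1) (Or.inl ⟨rfl, by simp [dirs]⟩)
  split_ifs with hc
  · have h5 := h (1, 0) (-1, 0) (Or.inr ⟨hc, rfl, by simp [dirs], by simp⟩)
    have h6 := h (0, 1) (-1, 0) (Or.inr ⟨hc, rfl, by simp [dirs], by simp⟩)
    have h7 := h (0, -1) (-1, 0) (Or.inr ⟨hc, rfl, by simp [dirs], by simp⟩)
    linarith
  · linarith

lemma stepMean_congr {c : Prop} {g g' : ℤ × ℤ → ℤ × ℤ → ℝ}
    (h : ∀ a b, AllowedStep c a b → g a b = g' a b) : stepMean c g = stepMean c g' :=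
  le_antisymm (stepMean_mono fun a b hab => (h a b hab).le)
    (stepMean_mono fun a b hab => (h a b hab).ge)

lemma stepMean_const (c : Prop) (x : ℝ) : stepMean c (fun _ _ => x) = x := by
  unfold stepMean; split_ifs <;> ring

lemma stepMean_add (c : Prop) (g g' : ℤ × ℤ → ℤ × ℤ → ℝ) :
    stepMean c (fun a b => g a b + g' a b) = stepMean c g + stepMean c g' := by
  unfold stepMean; split_ifs <;> ring

lemma stepMean_const_mul (c : Prop) (x : ℝ) (g : ℤ × ℤ → ℤ × ℤ → ℝ) :
    stepMean c (fun a b => x * g a b) = x * stepMean c g := by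
  unfold stepMean; split_ifs <;> ring

lemma addStep_apply_of_le {p : JPath} {t s : ℕ} (h : s ≤ t) (a b : ℤ × ℤ) :
    addStep p t a b s = p s := by
  unfold addStep; rw [Function.update_of_ne (by omega)]

@[simp] lemma addStep_apply_self (p : JPath) (t : ℕ) (a b : ℤ × ℤ) :
    addStep p t a b t = p t := addStep_apply_of_le le_rfl a b

@[simp] lemma addStep_apply_succ (p : JPath) (t : ℕ) (a b : ℤ × ℤ) :
    addStep p t a b (t + 1) = ((p t).1 + a, (p t).2 + b) := by simp [addStep]

lemma freshLeft_congr {p q : JPath} {t : ℕ} (h : ∀ s ≤ t, q s = p s) :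
    FreshLeft t q ↔ FreshLeft t p := by
  unfold FreshLeft
  rw [h t le_rfl]
  exact forall₂_congr fun s hs => by rw [h s hs]

lemma freshLeft_addStep {p : JPath} {t s : ℕ} (h : s ≤ t) (a b : ℤ × ℤ) :
    FreshLeft s (addStep p t a b) ↔ FreshLeft s p :=
  freshLeft_congr fun _ hr => addStep_apply_of_le (hr.trans h) a b

lemma isCont_refl (p : JPath) (t : ℕ) : IsCont p t 0 p :=
  ⟨fun _ _ => rfl, fun s h h' => by omega⟩

lemma IsCont.of_addStep {p q : JPath} {t n : ℕ} {a b : ℤ × ℤ}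
    (hab : AllowedStep (FreshLeft t p) a b) (h : IsCont (addStep p t a b) (t + 1) n q) :
    IsCont p t (n + 1) q := by
  have h0 : ∀ s ≤ t, q s = p s := fun s hs => by
    rw [h.1 s (by omega), addStep_apply_of_le hs]
  refine ⟨h0, fun s hs hs' => ?_⟩
  rcases eq_or_lt_of_le hs with rfl | hlt
  · rw [h.1 (t + 1) le_rfl, h0 t le_rfl, freshLeft_congr h0]
    simpa using hab
  · exact h.2 s hlt (by omega)

lemma IsCont.mono {p q : JPath} {t n m : ℕ} (h : IsCont p t n q) (hm : m ≤ n) : IsCont p t m q :=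
  ⟨h.1, fun s hs hs' => h.2 s hs (by omega)⟩

lemma IsCont.tail {p q : JPath} {t n m : ℕ} (h : IsCont p t (n + m) q) : IsCont q (t + n) m q :=
  ⟨fun _ _ => rfl, fun s hs hs' => h.2 s (by omega) (by omega)⟩

lemma IsCont.trans {p q r : JPath} {t n m : ℕ} (h : IsCont p t n q) (h' : IsCont q (t + n) m r) :
    IsCont p t (n + m) r := by
  refine ⟨fun s hs => by rw [h'.1 s (by omega), h.1 s hs], fun s hs hs' => ?_⟩
  rcases Nat.lt_or_ge s (t + n) with hlt | hge
  · rw [freshLeft_congr (fun u hu => h'.1 u (by omega)), h'.1 s (by omega),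
      h'.1 (s + 1) (by omega)]
    exact h.2 s hs hlt
  · exact h'.2 s hge (by omega)

lemma pathMean_mono {n t : ℕ} {p : JPath} {F G : JPath → ℝ}
    (h : ∀ q, IsCont p t n q → F q ≤ G q) : pathMean n t p F ≤ pathMean n t p G := by
  induction n generalizing t p with
  | zero => exact h p (isCont_refl p t)
  | succ n ih =>
    exact stepMean_mono fun a b hab => ih fun q hq => h q (hq.of_addStep hab)

lemma pathMean_congr {n t : ℕ} {p : JPath} {F G : JPath → ℝ}
    (h : ∀ q, IsCont p t n q → F q = G q) : pathMean n t p F = pathMean n t p G :=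
  le_antisymm (pathMean_mono fun q hq => (h q hq).le) (pathMean_mono fun q hq => (h q hq).ge)

lemma pathMean_const (n t : ℕ) (p : JPath) (x : ℝ) : pathMean n t p (fun _ => x) = x := by
  induction n generalizing t p with
  | zero => rfl
  | succ n ih => simp only [pathMean, ih, stepMean_const]

lemma pathMean_add (n t : ℕ) (p : JPath) (F G : JPath → ℝ) :
    pathMean n t p (fun q => F q + G q) = pathMean n t p F + pathMean n t p G := by
  induction n generalizing t p with
  | zero => rfl
  | succ n ih => simp only [pathMean, ih, stepMean_add]

lemma pathMean_const_mul (n t : ℕ) (p : JPath) (x : ℝ) (F : JPath → ℝ) :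
    pathMean n t p (fun q => x * F q) = x * pathMean n t p F := by
  induction n generalizing t p with
  | zero => rfl
  | succ n ih => simp only [pathMean, ih, stepMean_const_mul]

lemma pathMean_sum {ι : Type*} (n t : ℕ) (p : JPath) (S : Finset ι) (F : ι → JPath → ℝ) :
    pathMean n t p (fun q => ∑ i ∈ S, F i q) = ∑ i ∈ S, pathMean n t p (F i) := by
  induction S using Finset.induction_on with
  | empty => simpa using pathMean_const n t p 0
  | insert i S hi ih => simp only [Finset.sum_insert hi, pathMean_add, ih]

lemma pathMean_tower (n m t : ℕ) (p : JPath) (F : JPath → ℝ) :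
    pathMean (n + m) t p F = pathMean n t p fun q => pathMean m (t + n) q F := by
  induction n generalizing t p with
  | zero => simp [pathMean]
  | succ n ih =>
    rw [show n + 1 + m = (n + m) + 1 by ring]
    simp only [pathMean, ih]
    congr 1; funext a b; congr 1; funext q
    rw [show t + 1 + n = t + (n + 1) by ring]

lemma pathMean_succ_right (n t : ℕ) (p : JPath) (F : JPath → ℝ) :
    pathMean (n + 1) t p F = pathMean n t p fun q =>
      stepMean (FreshLeft (t + n) q) fun a b => F (addStep q (t + n) a b) := by
  rw [pathMean_tower]; rfl

/-- Means of a supermartingale do not increase. -/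
lemma pathMean_le_of_supermartingale {n t : ℕ} {p : JPath} {W : ℕ → JPath → ℝ}
    (h : ∀ i < n, ∀ q, IsCont p t i q →
      stepMean (FreshLeft (t + i) q) (fun a b => W (i + 1) (addStep q (t + i) a b)) ≤ W i q) :
    pathMean n t p (W n) ≤ W 0 p := by
  induction n with
  | zero => exact le_rfl
  | succ n ih =>
    rw [pathMean_succ_right]
    exact (pathMean_mono fun q hq => h n (by omega) q hq).trans
      (ih fun i hi => h i (by omega))

lemma pathProb_mono {n t : ℕ} {p : JPath} {Q Q' : JPath → Prop}
    (h : ∀ q, IsCont p t n q → Q q → Q' q) : pathProb n t p Q ≤ pathProb n t p Q' := by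
  refine pathMean_mono fun q hq => ?_
  by_cases h1 : Q q
  · simp [h1, h q hq h1]
  · simp only [h1, if_false]; split_ifs <;> norm_num

lemma pathProb_nonneg (n t : ℕ) (p : JPath) (Q : JPath → Prop) : 0 ≤ pathProb n t p Q := by
  rw [← pathMean_const n t p 0]
  exact pathMean_mono fun q _ => by split_ifs <;> norm_num

lemma pathProb_le_one (n t : ℕ) (p : JPath) (Q : JPath → Prop) : pathProb n t p Q ≤ 1 := by
  rw [← pathMean_const n t p 1]
  exact pathMean_mono fun q _ => by split_ifs <;> norm_num

lemma pathProb_or_le (n t : ℕ) (p : JPath) (Q Q' : JPath → Prop) :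
    pathProb n t p (fun q => Q q ∨ Q' q) ≤ pathProb n t p Q + pathProb n t p Q' := by
  unfold pathProb
  rw [← pathMean_add]
  refine pathMean_mono fun q _ => ?_
  by_cases h1 : Q q <;> by_cases h2 : Q' q <;> simp [h1, h2]

lemma pathProb_le_add {n t : ℕ} {p : JPath} {Q Q₁ Q₂ : JPath → Prop}
    (h : ∀ q, IsCont p t n q → Q q → Q₁ q ∨ Q₂ q) :
    pathProb n t p Q ≤ pathProb n t p Q₁ + pathProb n t p Q₂ :=
  (pathProb_mono h).trans (pathProb_or_le n t p Q₁ Q₂)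

lemma pathProb_le_sum {ι : Type*} {n t : ℕ} {p : JPath} {Q : JPath → Prop} (S : Finset ι)
    {B : ι → JPath → Prop} (h : ∀ q, IsCont p t n q → Q q → ∃ i ∈ S, B i q) :
    pathProb n t p Q ≤ ∑ i ∈ S, pathProb n t p (B i) := by
  unfold pathProb
  rw [← pathMean_sum]
  refine pathMean_mono fun q hq => ?_
  have hn : ∀ i ∈ S, (0 : ℝ) ≤ if B i q then 1 else 0 := fun i _ => by split_ifs <;> norm_num
  split_ifs with h1
  · obtain ⟨i, hi, hB⟩ := h q hq h1
    have := Finset.single_le_sum hn hi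
    simpa [hB] using this
  · exact Finset.sum_nonneg hn

lemma pathProb_not (n t : ℕ) (p : JPath) (Q : JPath → Prop) :
    pathProb n t p (fun q => ¬ Q q) = 1 - pathProb n t p Q := by
  have h : pathProb n t p (fun q => ¬ Q q) + pathProb n t p Q = 1 := by
    unfold pathProb
    rw [← pathMean_add]
    refine (pathMean_congr (G := fun _ => 1) fun q _ => ?_).trans (pathMean_const n t p 1)
    by_cases h : Q q <;> simp [h]
  linarith

lemma pathProb_false (n t : ℕ) (p : JPath) : pathProb n t p (fun _ => False) = 0 := by
  simpa [pathProb] using pathMean_const n t p 0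

lemma pathProb_eq_zero {n t : ℕ} {p : JPath} {Q : JPath → Prop}
    (h : ∀ q, IsCont p t n q → ¬ Q q) : pathProb n t p Q = 0 :=
  le_antisymm ((pathProb_mono h).trans (pathProb_false n t p).le) (pathProb_nonneg n t p Q)

/-- Events decided at time `t + n` keep their probability on a longer horizon. -/
lemma pathProb_add_of_determined {n m t : ℕ} {p : JPath} {A : JPath → Prop}
    (hA : ∀ q q' : JPath, (∀ s ≤ t + n, q' s = q s) → (A q' ↔ A q)) :
    pathProb (n + m) t p A = pathProb n t p A := by
  unfold pathProb
  rw [pathMean_tower]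
  refine pathMean_congr fun q _ => ?_
  rw [← pathMean_const m (t + n) q (if A q then 1 else 0)]
  exact pathMean_congr fun q' hq' => by simp [hA q q' hq'.1]

/-- Markov property at a fixed time. -/
lemma pathProb_le_mul {n m t : ℕ} {p : JPath} {Q A B : JPath → Prop} {β : ℝ}
    (hA : ∀ q q' : JPath, (∀ s ≤ t + n, q' s = q s) → (A q' → A q))
    (hQ : ∀ q, IsCont p t (n + m) q → Q q → A q ∧ B q)
    (hB : ∀ q, IsCont p t n q → A q → pathProb m (t + n) q B ≤ β) :
    pathProb (n + m) t p Q ≤ β * pathProb n t p A := by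
  unfold pathProb
  rw [pathMean_tower, ← pathMean_const_mul]
  refine pathMean_mono fun q hq => ?_
  by_cases h : A q
  · simp only [h, if_true, mul_one]
    refine le_trans ?_ (hB q hq h)
    exact pathProb_mono fun q' hq' hQ' => (hQ q' (hq.trans hq') hQ').2
  · simp only [h, if_false, mul_zero]
    refine (pathProb_eq_zero (Q := Q) fun q' hq' hQ' => h ?_).le
    exact hA q q' hq'.1 (hQ q' (hq.trans hq') hQ').1

/-- Markov property at a random time: `A i` says that the time is `t + i`. -/
lemma pathProb_le_mul_of_time {N t : ℕ} {p : JPath} {Q D : JPath → Prop}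
    {A B : ℕ → JPath → Prop} {β : ℝ} (hβ : 0 ≤ β)
    (hA : ∀ i ≤ N, ∀ q q' : JPath, (∀ s ≤ t + i, q' s = q s) → (A i q' ↔ A i q))
    (hdisj : ∀ q, ∀ i ≤ N, ∀ j ≤ N, A i q → A j q → i = j)
    (hQ : ∀ q, IsCont p t N q → Q q → ∃ i ≤ N, A i q ∧ B i q)
    (hD : ∀ q, IsCont p t N q → ∀ i ≤ N, A i q → D q)
    (hB : ∀ i ≤ N, ∀ q, IsCont p t i q → A i q → pathProb (N - i) (t + i) q (B i) ≤ β) :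
    pathProb N t p Q ≤ β * pathProb N t p D := by
  have h1 : pathProb N t p Q ≤
      ∑ i ∈ Finset.range (N + 1), pathProb N t p (fun q => A i q ∧ B i q) :=
    pathProb_le_sum _ fun q hq hQ' => by
      obtain ⟨i, hi, h⟩ := hQ q hq hQ'
      exact ⟨i, Finset.mem_range.2 (by omega), h⟩
  have h2 : ∀ i ∈ Finset.range (N + 1),
      pathProb N t p (fun q => A i q ∧ B i q) ≤ β * pathProb N t p (A i) := fun i hi => by
    have hi' : i ≤ N := by simpa [Nat.lt_succ_iff] using hi
    obtain ⟨k, rfl⟩ := Nat.exists_eq_add_of_le hi'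
    rw [pathProb_add_of_determined (hA i hi')]
    refine pathProb_le_mul (fun q q' h => (hA i hi' q q' h).1) (fun q _ h => h) fun q hq h => ?_
    simpa using hB i hi' q hq h
  refine h1.trans ((Finset.sum_le_sum h2).trans ?_)
  rw [← Finset.mul_sum]
  refine mul_le_mul_of_nonneg_left ?_ hβ
  unfold pathProb
  rw [← pathMean_sum]
  refine pathMean_mono fun q hq => ?_
  by_cases h : ∃ i ≤ N, A i q
  · obtain ⟨i, hi, hAi⟩ := h
    rw [Finset.sum_eq_single i]
    · simp [hAi, hD q hq i hi hAi]
    · intro j hj hji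
      have : ¬ A j q := fun hAj =>
        hji (hdisj q j (by simpa [Nat.lt_succ_iff] using hj) i hi hAj hAi)
      simp [this]
    · intro hi'; simp at hi'; omega
  · push Not at h
    rw [Finset.sum_eq_zero]
    · split_ifs <;> norm_num
    · intro i hi
      simp [h i (by simpa [Nat.lt_succ_iff] using hi)]

lemma pathProb_le_exp_of_pathMean {n t : ℕ} {p : JPath} {Q : JPath → Prop} {W : JPath → ℝ} {x y : ℝ}
    (hW : ∀ q, 0 ≤ W q) (hQ : ∀ q, IsCont p t n q → Q q → Real.exp x ≤ W q)
    (hy : pathMean n t p W ≤ y) : pathProb n t p Q ≤ y * Real.exp (-x) := by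
  have h1 : pathProb n t p Q ≤ pathMean n t p (fun q => Real.exp (-x) * W q) := by
    refine pathMean_mono fun q hq => ?_
    split_ifs with h
    · have := mul_le_mul_of_nonneg_left (hQ q hq h) (Real.exp_pos (-x)).le
      rwa [← Real.exp_add, neg_add_cancel, Real.exp_zero] at this
    · exact mul_nonneg (Real.exp_pos _).le (hW q)
  rw [pathMean_const_mul] at h1
  rw [mul_comm]
  exact h1.trans (mul_le_mul_of_nonneg_left hy (Real.exp_pos _).le)

lemma freshCount_addStep (q : JPath) (t n : ℕ) (a b : ℤ × ℤ) :
    freshCount (addStep q (t + n) a b) t (n + 1) =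
      freshCount q t n + if FreshLeft (t + n) q then 1 else 0 := by
  unfold freshCount
  rw [Finset.range_add_one, Finset.filter_insert]
  have h : (Finset.range n).filter (fun i => FreshLeft (t + i) (addStep q (t + n) a b)) =
      (Finset.range n).filter fun i => FreshLeft (t + i) q :=
    Finset.filter_congr fun i hi => freshLeft_addStep (by simp at hi; omega) a b
  rw [h, freshLeft_addStep le_rfl]
  split_ifs with hf
  · rw [Finset.card_insert_of_notMem (by simp)]
  · rfl

@[simp] lemma freshCount_zero (q : JPath) (t : ℕ) : freshCount q t 0 = 0 := by simp [freshCount]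

lemma stepMean_exp_le {c : Prop} {g : ℤ × ℤ → ℤ × ℤ → ℝ} {θ b d : ℝ} (hθ : 0 ≤ θ)
    (hθb : θ * b ≤ 1) (hb : ∀ x y, AllowedStep c x y → |g x y| ≤ b) (hd : stepMean c g ≤ d) :
    stepMean c (fun x y => Real.exp (θ * g x y)) ≤ Real.exp (θ * d + θ ^ 2 * b ^ 2) := by
  have h1 : stepMean c (fun x y => Real.exp (θ * g x y)) ≤
      stepMean c (fun x y => (1 + θ ^ 2 * b ^ 2) + θ * g x y) := by
    refine stepMean_mono fun x y hxy => ?_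
    have h2 := hb x y hxy
    have h3 : |θ * g x y| ≤ θ * b := by
      rw [abs_mul, abs_of_nonneg hθ]; exact mul_le_mul_of_nonneg_left h2 hθ
    have h4 := Real.abs_exp_sub_one_sub_id_le (h3.trans hθb)
    have h5 := (abs_le.1 h4).2
    have h6 : (θ * g x y) ^ 2 ≤ (θ * b) ^ 2 := by
      rw [← sq_abs]; exact pow_le_pow_left₀ (abs_nonneg _) h3 2
    nlinarith
  rw [stepMean_add, stepMean_const, stepMean_const_mul] at h1
  refine h1.trans (le_trans ?_ (Real.add_one_le_exp _))
  nlinarith [mul_le_mul_of_nonneg_left hd hθ]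

/-- Exponential tail bound for a functional with bounded increments and controlled drift. -/
lemma pathProb_le_exp {n t : ℕ} {p : JPath} {G : ℕ → JPath → ℝ} {good : ℕ → JPath → Prop}
    {θ b d a x : ℝ} (hθ : 0 ≤ θ) (hθb : θ * b ≤ 1)
    (hgood : ∀ i < n, ∀ q, IsCont p t i q → ∀ u v, AllowedStep (FreshLeft (t + i) q) u v →
      good (i + 1) (addStep q (t + i) u v) → good i q)
    (hb : ∀ i < n, ∀ q, IsCont p t i q → good i q → ∀ u v,
      AllowedStep (FreshLeft (t + i) q) u v → |G (i + 1) (addStep q (t + i) u v) - G i q| ≤ b)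
    (hd : ∀ i < n, ∀ q, IsCont p t i q → good i q →
      stepMean (FreshLeft (t + i) q) (fun u v => G (i + 1) (addStep q (t + i) u v) - G i q)
        ≤ (if FreshLeft (t + i) q then d else 0) - a) :
    pathProb n t p (fun q => good n q ∧ x ≤ G n q - G 0 p - d * freshCount q t n) ≤
      Real.exp (-(θ * (x + a * n)) + n * (θ ^ 2 * b ^ 2)) := by
  set W : ℕ → JPath → ℝ := fun i q => if good i q then
    Real.exp (θ * (G i q - G 0 p - d * freshCount q t i + a * i) - i * (θ ^ 2 * b ^ 2)) else 0
    with hW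
  have hW0 : ∀ i q, 0 ≤ W i q := fun i q => by
    simp only [hW]; split_ifs
    · exact (Real.exp_pos _).le
    · exact le_rfl
  have key : pathMean n t p (W n) ≤ 1 := by
    refine (pathMean_le_of_supermartingale (W := W) ?_).trans ?_
    · intro i hi q hq
      by_cases hg : good i q
      · set c := FreshLeft (t + i) q
        have h1 : stepMean c (fun u v => W (i + 1) (addStep q (t + i) u v)) ≤
            stepMean c (fun u v => W i q * Real.exp (-(θ * ((if c then d else 0) - a)) -
                θ ^ 2 * b ^ 2) *
              Real.exp (θ * (G (i + 1) (addStep q (t + i) u v) - G i q))) := by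
          refine stepMean_mono fun u v huv => ?_
          simp only [hW, hg, if_true]
          split_ifs with h2 h3 h3
          all_goals first
            | (positivity)
            | (rw [← Real.exp_add, ← Real.exp_add, freshCount_addStep]
               apply le_of_eq; congr 1; push_cast
               simp only [show FreshLeft (t + i) q ↔ c from Iff.rfl, h3, if_true, if_false]
               ring)
        refine h1.trans ?_
        rw [stepMean_const_mul, mul_assoc]
        have h2 := stepMean_exp_le hθ hθb (hb i hi q hq hg) (hd i hi q hq hg)
        have h3 : Real.exp (-(θ * ((if c then d else 0) - a)) - θ ^ 2 * b ^ 2) *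
            stepMean c (fun u v => Real.exp (θ * (G (i + 1) (addStep q (t + i) u v) - G i q)))
            ≤ 1 := by
          refine (mul_le_mul_of_nonneg_left h2 (Real.exp_pos _).le).trans ?_
          rw [← Real.exp_add]
          apply le_of_eq
          rw [← Real.exp_zero]; congr 1; ring
        exact mul_le_of_le_one_right (hW0 i q) h3
      · have h1 : stepMean (FreshLeft (t + i) q) (fun u v => W (i + 1) (addStep q (t + i) u v)) ≤
            stepMean (FreshLeft (t + i) q) (fun _ _ => 0) := by
          refine stepMean_mono fun u v huv => ?_
          have : ¬ good (i + 1) (addStep q (t + i) u v) := fun h => hg (hgood i hi q hq u v huv h)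
          simp [hW, this]
        rw [stepMean_const] at h1
        exact h1.trans (hW0 i q)
    · simp only [hW]; split_ifs <;> simp
  have h := pathProb_le_exp_of_pathMean (n := n) (t := t) (p := p)
    (Q := fun q => good n q ∧ x ≤ G n q - G 0 p - d * freshCount q t n) (W := W n)
    (x := θ * (x + a * n) - n * (θ ^ 2 * b ^ 2)) (hW0 n) ?_ key
  · rw [one_mul] at h
    refine h.trans (le_of_eq ?_)
    congr 1; ring
  · rintro q _ ⟨hg, hx⟩
    simp only [hW, hg, if_true]
    apply Real.exp_le_exp.2
    have := mul_le_mul_of_nonneg_left hx hθ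
    nlinarith

/-- Squared Euclidean norm of a lattice point. -/
noncomputable def nsq (v : ℤ × ℤ) : ℝ := (v.1 : ℝ) ^ 2 + (v.2 : ℝ) ^ 2

/-- A subharmonic substitute for the potential kernel of simple random walk. -/
noncomputable def logPot (v : ℤ × ℤ) : ℝ := Real.log (1 + nsq v)

/-- A function that is superharmonic away from the origin and behaves like `2 log |v|`. -/
noncomputable def logSup (v : ℤ × ℤ) : ℝ := if v = 0 then -8 else Real.log (nsq v - 3 / 4)

/-- The difference of two potentials with poles at `0` and `(-2, 0)`. -/
noncomputable def dipole (v : ℤ × ℤ) : ℝ := logSup v - logPot (v + (2, 0))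

lemma nsq_nonneg (v : ℤ × ℤ) : 0 ≤ nsq v := by unfold nsq; positivity

lemma one_le_nsq {v : ℤ × ℤ} (h : v ≠ 0) : 1 ≤ nsq v := by
  obtain ⟨x, y⟩ := v
  have h1 : 1 ≤ x ^ 2 + y ^ 2 := by
    by_contra! hlt
    have hx : x = 0 := by nlinarith [sq_nonneg x, sq_nonneg y]
    have hy : y = 0 := by nlinarith [sq_nonneg x, sq_nonneg y]
    exact h (by simp [hx, hy])
  unfold nsq; exact_mod_cast h1

lemma nsq_eq_one_or {v : ℤ × ℤ} (h : v ≠ 0) : nsq v = 1 ∨ 2 ≤ nsq v := by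
  have h1 := one_le_nsq h
  have h2 : nsq v = ((v.1 ^ 2 + v.2 ^ 2 : ℤ) : ℝ) := by simp [nsq]
  rw [h2] at h1 ⊢
  norm_cast at h1 ⊢
  omega

lemma dirs_cases {e : ℤ × ℤ} (h : e ∈ dirs) :
    e = (1, 0) ∨ e = (-1, 0) ∨ e = (0, 1) ∨ e = (0, -1) := by simpa [dirs] using h

lemma four_log_le {a b c d e : ℝ} (ha : 0 < a) (hb : 0 < b) (hc : 0 < c) (hd : 0 < d)
    (he : 0 < e) (h : e ^ 4 ≤ a * b * c * d) :
    4 * Real.log e ≤ Real.log a + Real.log b + Real.log c + Real.log d := by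
  rw [← Real.log_mul ha.ne' hb.ne', ← Real.log_mul (by positivity) hc.ne',
    ← Real.log_mul (by positivity) hd.ne']
  have := Real.log_le_log (by positivity) h
  rwa [Real.log_pow] at this

lemma le_four_log {a b c d e : ℝ} (ha : 0 < a) (hb : 0 < b) (hc : 0 < c) (hd : 0 < d)
    (h : a * b * c * d ≤ e ^ 4) :
    Real.log a + Real.log b + Real.log c + Real.log d ≤ 4 * Real.log e := by
  rw [← Real.log_mul ha.ne' hb.ne', ← Real.log_mul (by positivity) hc.ne',
    ← Real.log_mul (by positivity) hd.ne']
  have := Real.log_le_log (by positivity) h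
  rwa [Real.log_pow] at this

lemma logPot_subharmonic (v : ℤ × ℤ) :
    4 * logPot v ≤ logPot (v + (-1, 0)) + logPot (v + (1, 0)) + logPot (v + (0, 1)) +
      logPot (v + (0, -1)) := by
  obtain ⟨x, y⟩ := v
  unfold logPot
  refine four_log_le ?_ ?_ ?_ ?_ ?_ ?_
  all_goals try (have := nsq_nonneg ((x, y) : ℤ × ℤ); have := nsq_nonneg ((x, y) + (-1, 0) : ℤ × ℤ)
                 have := nsq_nonneg ((x, y) + (1, 0) : ℤ × ℤ)
                 have := nsq_nonneg ((x, y) + (0, 1) : ℤ × ℤ)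
                 have := nsq_nonneg ((x, y) + (0, -1) : ℤ × ℤ); linarith)
  simp only [nsq, Prod.mk_add_mk]
  push_cast
  generalize (x : ℝ) = x
  generalize (y : ℝ) = y
  nlinarith [sq_nonneg (x * y), sq_nonneg x, sq_nonneg y, mul_nonneg (sq_nonneg x) (sq_nonneg y),
    sq_nonneg (x ^ 2), sq_nonneg (y ^ 2)]

lemma logPot_zero : logPot 0 = 0 := by simp [logPot, nsq]

lemma logPot_of_mem_dirs {e : ℤ × ℤ} (h : e ∈ dirs) : logPot e = Real.log 2 := by
  rcases dirs_cases h with rfl | rfl | rfl | rfl <;> norm_num [logPot, nsq]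

lemma abs_log_sub_le {a b m : ℝ} (hm : 0 < m) (ha : m ≤ a) (hb : m ≤ b) :
    |Real.log a - Real.log b| ≤ |a - b| / m := by
  have key : ∀ a b : ℝ, m ≤ a → m ≤ b → Real.log a - Real.log b ≤ |a - b| / m := by
    intro a b ha hb
    have ha' : 0 < a := hm.trans_le ha
    have hb' : 0 < b := hm.trans_le hb
    rw [← Real.log_div ha'.ne' hb'.ne']
    refine (Real.log_le_sub_one_of_pos (by positivity)).trans ?_
    rw [show a / b - 1 = (a - b) / b by field_simp]
    calc (a - b) / b ≤ |a - b| / b := by gcongr; exact le_abs_self _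
      _ ≤ |a - b| / m := by gcongr
  rw [abs_le]
  have h1 := key a b ha hb
  have h2 := key b a hb ha
  rw [abs_sub_comm] at h2
  constructor <;> linarith

lemma sq_logPot_sub_le (v : ℤ × ℤ) {e : ℤ × ℤ} (he : e ∈ dirs) :
    (logPot (v + e) - logPot v) ^ 2 ≤ 45 / (1 + nsq v) := by
  have hs := nsq_nonneg v
  have h1 : (1 + nsq v) / 3 ≤ 1 + nsq (v + e) := by
    obtain ⟨x, y⟩ := v
    rcases dirs_cases he with rfl | rfl | rfl | rfl <;>
    · simp only [nsq, Prod.mk_add_mk]; push_cast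
      nlinarith [sq_nonneg (2 * (x : ℝ) + 3), sq_nonneg (2 * (x : ℝ) - 3),
        sq_nonneg (2 * (y : ℝ) + 3), sq_nonneg (2 * (y : ℝ) - 3), sq_nonneg (x : ℝ),
        sq_nonneg (y : ℝ)]
  have h2 := abs_log_sub_le (by positivity) h1 (show (1 + nsq v) / 3 ≤ 1 + nsq v by linarith)
  have h3 : (1 + nsq (v + e) - (1 + nsq v)) ^ 2 ≤ 5 * (1 + nsq v) := by
    obtain ⟨x, y⟩ := v
    rcases dirs_cases he with rfl | rfl | rfl | rfl <;>
    · simp only [nsq, Prod.mk_add_mk]; push_cast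
      nlinarith [sq_nonneg ((x : ℝ) - 2), sq_nonneg ((x : ℝ) + 2), sq_nonneg ((y : ℝ) - 2),
        sq_nonneg ((y : ℝ) + 2), sq_nonneg (x : ℝ), sq_nonneg (y : ℝ)]
  calc (logPot (v + e) - logPot v) ^ 2 = |logPot (v + e) - logPot v| ^ 2 := (sq_abs _).symm
    _ ≤ (|1 + nsq (v + e) - (1 + nsq v)| / ((1 + nsq v) / 3)) ^ 2 :=
        pow_le_pow_left₀ (abs_nonneg _) h2 2
    _ = (1 + nsq (v + e) - (1 + nsq v)) ^ 2 / ((1 + nsq v) / 3) ^ 2 := by rw [div_pow, sq_abs]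
    _ ≤ 5 * (1 + nsq v) / ((1 + nsq v) / 3) ^ 2 := by gcongr
    _ = 45 / (1 + nsq v) := by field_simp; norm_num

lemma logSup_superharmonic {v : ℤ × ℤ} (hv : v ≠ 0) :
    logSup (v + (-1, 0)) + logSup (v + (1, 0)) + logSup (v + (0, 1)) + logSup (v + (0, -1))
      ≤ 4 * logSup v := by
  rcases nsq_eq_one_or hv with h | h
  · have hU : ∀ w : ℤ × ℤ, nsq w = 1 → logSup w = Real.log (1 / 4) := fun w hw => by
      have : w ≠ 0 := by rintro rfl; simp [nsq] at hw
      rw [logSup, if_neg this, hw]; norm_num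
    have hU2 : ∀ w : ℤ × ℤ, nsq w = 2 → logSup w = Real.log (5 / 4) := fun w hw => by
      have : w ≠ 0 := by rintro rfl; simp [nsq] at hw
      rw [logSup, if_neg this, hw]; norm_num
    have hU4 : ∀ w : ℤ × ℤ, nsq w = 4 → logSup w = Real.log (13 / 4) := fun w hw => by
      have : w ≠ 0 := by rintro rfl; simp [nsq] at hw
      rw [logSup, if_neg this, hw]; norm_num
    have hU0 : logSup 0 = -8 := by simp [logSup]
    have l1 : Real.log (1 / 4) = - (2 * Real.log 2) := by
      rw [one_div, Real.log_inv, show (4 : ℝ) = 2 ^ 2 by norm_num, Real.log_pow]; push_cast; ring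
    have l2 : Real.log (5 / 4) ≤ 1 / 4 := by
      have := Real.log_le_sub_one_of_pos (show (0 : ℝ) < 5 / 4 by norm_num); linarith
    have l3 : Real.log (13 / 4) ≤ 5 / 4 + 0 := by
      have h4 : Real.log (13 / 4) ≤ Real.log 4 := Real.log_le_log (by norm_num) (by norm_num)
      have h5 : Real.log 4 = 2 * Real.log 2 := by
        rw [show (4 : ℝ) = 2 ^ 2 by norm_num, Real.log_pow]; push_cast; ring
      have := Real.log_two_lt_d9
      have h6 := Real.log_le_sub_one_of_pos (show (0 : ℝ) < 13 / 16 by norm_num)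
      have h7 : Real.log (13 / 16) = Real.log (13 / 4) - Real.log 4 := by
        rw [← Real.log_div (by norm_num) (by norm_num)]; norm_num
      linarith
    have l4 := Real.log_two_lt_d9
    obtain ⟨x, y⟩ := v
    have hxy : x ^ 2 + y ^ 2 = 1 := by
      simp only [nsq] at h; exact_mod_cast h
    have hx : -1 ≤ x ∧ x ≤ 1 := by constructor <;> nlinarith [sq_nonneg y]
    have hy : -1 ≤ y ∧ y ≤ 1 := by constructor <;> nlinarith [sq_nonneg x]
    have h4 : (x = 1 ∧ y = 0) ∨ (x = -1 ∧ y = 0) ∨ (x = 0 ∧ y = 1) ∨ (x = 0 ∧ y = -1) := by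
      obtain ⟨h1, h2⟩ := hx
      obtain ⟨h3, h4⟩ := hy
      interval_cases x <;> interval_cases y <;> simp_all
    rcases h4 with ⟨rfl, rfl⟩ | ⟨rfl, rfl⟩ | ⟨rfl, rfl⟩ | ⟨rfl, rfl⟩
    · norm_num [Prod.mk_add_mk]
      rw [show ((0 : ℤ), (0 : ℤ)) = 0 from rfl, hU0, hU4 (2, 0) (by norm_num [nsq]),
        hU2 (1, 1) (by norm_num [nsq]), hU2 (1, -1) (by norm_num [nsq]),
        hU (1, 0) (by norm_num [nsq])]
      linarith
    · norm_num [Prod.mk_add_mk]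
      rw [show ((0 : ℤ), (0 : ℤ)) = 0 from rfl, hU0, hU4 (-2, 0) (by norm_num [nsq]),
        hU2 (-1, 1) (by norm_num [nsq]), hU2 (-1, -1) (by norm_num [nsq]),
        hU (-1, 0) (by norm_num [nsq])]
      linarith
    · norm_num [Prod.mk_add_mk]
      rw [show ((0 : ℤ), (0 : ℤ)) = 0 from rfl, hU0, hU4 (0, 2) (by norm_num [nsq]),
        hU2 (1, 1) (by norm_num [nsq]), hU2 (-1, 1) (by norm_num [nsq]),
        hU (0, 1) (by norm_num [nsq])]
      linarith
    · norm_num [Prod.mk_add_mk]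
      rw [show ((0 : ℤ), (0 : ℤ)) = 0 from rfl, hU0, hU4 (0, -2) (by norm_num [nsq]),
        hU2 (1, -1) (by norm_num [nsq]), hU2 (-1, -1) (by norm_num [nsq]),
        hU (0, -1) (by norm_num [nsq])]
      linarith
  · have hne : ∀ e ∈ dirs, v + e ≠ 0 := fun e he h0 => by
      have hv' : v = -e := eq_neg_of_add_eq_zero_left h0
      rw [hv'] at h
      rcases dirs_cases he with rfl | rfl | rfl | rfl <;> norm_num [nsq] at h
    have hp : ∀ e ∈ dirs, 0 < nsq (v + e) - 3 / 4 := fun e he => by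
      linarith [one_le_nsq (hne e he)]
    have d1 : ((-1, 0) : ℤ × ℤ) ∈ dirs := by simp [dirs]
    have d2 : ((1, 0) : ℤ × ℤ) ∈ dirs := by simp [dirs]
    have d3 : ((0, 1) : ℤ × ℤ) ∈ dirs := by simp [dirs]
    have d4 : ((0, -1) : ℤ × ℤ) ∈ dirs := by simp [dirs]
    unfold logSup
    rw [if_neg hv, if_neg (hne _ d1), if_neg (hne _ d2), if_neg (hne _ d3), if_neg (hne _ d4)]
    refine le_four_log (hp _ d1) (hp _ d2) (hp _ d3) (hp _ d4) ?_
    obtain ⟨x, y⟩ := v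
    simp only [nsq, Prod.mk_add_mk] at h ⊢
    push_cast
    generalize (x : ℝ) = x at *
    generalize (y : ℝ) = y at *
    obtain ⟨s, hs⟩ : ∃ s, s = x ^ 2 + y ^ 2 + 1 / 4 := ⟨_, rfl⟩
    have e1 : (x + -1) ^ 2 + (y + 0) ^ 2 - 3 / 4 = s - 2 * x := by rw [hs]; ring
    have e2 : (x + 1) ^ 2 + (y + 0) ^ 2 - 3 / 4 = s + 2 * x := by rw [hs]; ring
    have e3 : (x + 0) ^ 2 + (y + 1) ^ 2 - 3 / 4 = s + 2 * y := by rw [hs]; ring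
    have e4 : (x + 0) ^ 2 + (y + -1) ^ 2 - 3 / 4 = s - 2 * y := by rw [hs]; ring
    have e5 : x ^ 2 + y ^ 2 - 3 / 4 = s - 1 := by rw [hs]; ring
    rw [e1, e2, e3, e4, e5]
    have h1 : (s - 2 * x) * (s + 2 * x) * (s + 2 * y) * (s - 2 * y) =
        s ^ 4 - 4 * s ^ 2 * (s - 1 / 4) + 16 * (x ^ 2 * y ^ 2) := by rw [hs]; ring
    have h2 : 4 * (x ^ 2 * y ^ 2) ≤ (s - 1 / 4) ^ 2 := by
      rw [hs]; nlinarith [sq_nonneg (x ^ 2 - y ^ 2)]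
    rw [h1]
    nlinarith [mul_nonneg (show 0 ≤ s - 9 / 4 by linarith) (show 0 ≤ s by linarith)]

lemma dipole_superharmonic {v : ℤ × ℤ} (hv : v ≠ 0) :
    dipole (v + (-1, 0)) + dipole (v + (1, 0)) + dipole (v + (0, 1)) + dipole (v + (0, -1))
      ≤ 4 * dipole v := by
  have h1 := logSup_superharmonic hv
  have h2 := logPot_subharmonic (v + (2, 0))
  simp only [dipole, add_right_comm v _ ((2, 0) : ℤ × ℤ)]
  linarith

lemma one_le_dipole : 1 ≤ dipole (-2, 0) := by
  have h : dipole (-2, 0) = Real.log (13 / 4) := by norm_num [dipole, logSup, logPot, nsq]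
  rw [h, Real.le_log_iff_exp_le (by norm_num)]
  linarith [Real.exp_one_lt_d9]

lemma abs_dipole_zero_le : |dipole 0| ≤ 12 := by
  have h : dipole 0 = -8 - Real.log 5 := by norm_num [dipole, logSup, logPot, nsq]
  have h1 := Real.log_le_sub_one_of_pos (show (0 : ℝ) < 5 by norm_num)
  have h2 := Real.log_nonneg (show (1 : ℝ) ≤ 5 by norm_num)
  rw [h, abs_le]; constructor <;> linarith

lemma dipole_eq {v : ℤ × ℤ} (hv : v ≠ 0) :
    dipole v = Real.log (nsq v - 3 / 4) - Real.log (1 + nsq (v + (2, 0))) := by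
  simp [dipole, logSup, logPot, hv]

lemma nsq_shift_ge (v : ℤ × ℤ) : (1 + nsq v) / 9 ≤ 1 + nsq (v + (2, 0)) := by
  obtain ⟨x, y⟩ := v
  simp only [nsq, Prod.mk_add_mk]; push_cast
  nlinarith [sq_nonneg (4 * (x : ℝ) + 9), sq_nonneg (y : ℝ)]

lemma nsq_sub_ge {v : ℤ × ℤ} (hv : v ≠ 0) : (1 + nsq v) / 8 ≤ nsq v - 3 / 4 := by
  linarith [one_le_nsq hv]

lemma sq_dipole_le (v : ℤ × ℤ) : dipole v ^ 2 ≤ 10000 / (1 + nsq v) := by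
  by_cases hv : v = 0
  · subst hv
    have := sq_le_sq' (by linarith [abs_nonneg (dipole 0)]) abs_dipole_zero_le
      (a := |dipole 0|)
    rw [sq_abs] at this
    refine this.trans ?_
    norm_num [nsq]
  · have hs := nsq_nonneg v
    have h1 := abs_log_sub_le (m := (1 + nsq v) / 9) (by positivity)
      (by linarith [nsq_sub_ge hv] : (1 + nsq v) / 9 ≤ nsq v - 3 / 4) (nsq_shift_ge v)
    rw [← dipole_eq hv] at h1
    have h3 : (nsq v - 3 / 4 - (1 + nsq (v + (2, 0)))) ^ 2 ≤ 60 * (1 + nsq v) := by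
      obtain ⟨x, y⟩ := v
      simp only [nsq, Prod.mk_add_mk]; push_cast
      nlinarith [sq_nonneg ((x : ℝ) - 1), sq_nonneg (x : ℝ), sq_nonneg (y : ℝ)]
    calc dipole v ^ 2 = |dipole v| ^ 2 := (sq_abs _).symm
      _ ≤ (|nsq v - 3 / 4 - (1 + nsq (v + (2, 0)))| / ((1 + nsq v) / 9)) ^ 2 :=
          pow_le_pow_left₀ (abs_nonneg _) h1 2
      _ = (nsq v - 3 / 4 - (1 + nsq (v + (2, 0)))) ^ 2 / ((1 + nsq v) / 9) ^ 2 := by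
          rw [div_pow, sq_abs]
      _ ≤ 60 * (1 + nsq v) / ((1 + nsq v) / 9) ^ 2 := by gcongr
      _ = 4860 / (1 + nsq v) := by field_simp; norm_num
      _ ≤ 10000 / (1 + nsq v) := by gcongr; norm_num

lemma abs_dipole_sub_le {v e : ℤ × ℤ} (hv : v ≠ 0) (he : e ∈ dirs) :
    |dipole (v + e) - dipole v| ≤ 20000 / (1 + nsq v) := by
  have hs := nsq_nonneg v
  by_cases hve : v + e = 0
  · have hn : nsq v = 1 := by
      rw [eq_neg_of_add_eq_zero_left hve]
      rcases dirs_cases he with rfl | rfl | rfl | rfl <;> norm_num [nsq]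
    rw [hve, hn]
    have h1 := sq_dipole_le v
    rw [hn] at h1
    have h2 : |dipole v| ≤ 100 := abs_le_of_sq_le_sq (by linarith) (by norm_num)
    have h3 := abs_dipole_zero_le
    rw [abs_le] at *
    constructor <;> linarith
  · have hN := nsq_sub_ge hv
    have hN' := nsq_sub_ge hve
    have hD := nsq_shift_ge v
    have hD' := nsq_shift_ge (v + e)
    have h1 : (1 + nsq v) / 3 ≤ 1 + nsq (v + e) := by
      obtain ⟨x, y⟩ := v
      rcases dirs_cases he with rfl | rfl | rfl | rfl <;>
      · simp only [nsq, Prod.mk_add_mk]; push_cast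
        nlinarith [sq_nonneg (2 * (x : ℝ) + 3), sq_nonneg (2 * (x : ℝ) - 3),
          sq_nonneg (2 * (y : ℝ) + 3), sq_nonneg (2 * (y : ℝ) - 3), sq_nonneg (x : ℝ),
          sq_nonneg (y : ℝ)]
    rw [dipole_eq hv, dipole_eq hve]
    set N := nsq v - 3 / 4 with hNdef
    set N' := nsq (v + e) - 3 / 4 with hNdef'
    set D := 1 + nsq (v + (2, 0)) with hDdef
    set D' := 1 + nsq (v + e + (2, 0)) with hDdef'
    have p1 : 0 < N := by linarith
    have p2 : 0 < N' := by linarith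
    have p3 : 0 < D := by linarith
    have p4 : 0 < D' := by linarith
    have hcross : |N' * D - N * D'| ≤ 34 * (1 + nsq v) := by
      simp only [hNdef, hNdef', hDdef, hDdef']
      obtain ⟨x, y⟩ := v
      rw [abs_le]
      rcases dirs_cases he with rfl | rfl | rfl | rfl <;>
      · simp only [nsq, Prod.mk_add_mk]; push_cast
        constructor <;>
        linarith [sq_nonneg ((x : ℝ) - y), sq_nonneg ((x : ℝ) + y), sq_nonneg ((x : ℝ) - 1),
          sq_nonneg ((x : ℝ) + 1), sq_nonneg ((y : ℝ) - 1), sq_nonneg ((y : ℝ) + 1),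
          sq_nonneg (x : ℝ), sq_nonneg (y : ℝ)]
    have m1 : (1 + nsq v) ^ 2 / 216 ≤ N' * D := by
      have : ((1 + nsq v) / 24) * ((1 + nsq v) / 9) ≤ N' * D :=
        mul_le_mul (by linarith) hD (by positivity) p2.le
      linarith
    have m2 : (1 + nsq v) ^ 2 / 216 ≤ N * D' := by
      have : ((1 + nsq v) / 8) * ((1 + nsq v) / 27) ≤ N * D' :=
        mul_le_mul hN (by linarith) (by positivity) p1.le
      linarith
    have h2 := abs_log_sub_le (by positivity) m1 m2
    rw [Real.log_mul p2.ne' p3.ne', Real.log_mul p1.ne' p4.ne'] at h2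
    calc |Real.log N' - Real.log D' - (Real.log N - Real.log D)|
        = |Real.log N' + Real.log D - (Real.log N + Real.log D')| := by congr 1; ring
      _ ≤ |N' * D - N * D'| / ((1 + nsq v) ^ 2 / 216) := h2
      _ ≤ 34 * (1 + nsq v) / ((1 + nsq v) ^ 2 / 216) := by gcongr
      _ = 7344 / (1 + nsq v) := by field_simp; norm_num
      _ ≤ 20000 / (1 + nsq v) := by gcongr; norm_num

/-- The lattice points in the square of radius `M` around `z`. -/
noncomputable def boxAt (z : ℤ × ℤ) (M : ℕ) : Finset (ℤ × ℤ) :=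
  Finset.Icc (z.1 - M) (z.1 + M) ×ˢ Finset.Icc (z.2 - M) (z.2 + M)

lemma mem_boxAt {z w : ℤ × ℤ} {M : ℕ} : w ∈ boxAt z M ↔ |w.1 - z.1| ≤ M ∧ |w.2 - z.2| ≤ M := by
  simp only [boxAt, Finset.mem_product, Finset.mem_Icc, abs_le]
  constructor <;> rintro ⟨⟨_, _⟩, _, _⟩ <;> refine ⟨⟨?_, ?_⟩, ?_, ?_⟩ <;> linarith

lemma card_boxAt (z : ℤ × ℤ) (M : ℕ) : (boxAt z M).card = (2 * M + 1) ^ 2 := by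
  simp only [boxAt, Finset.card_product, Int.card_Icc]
  rw [sq]; congr 1 <;> omega

lemma sum_inv_Icc_le (M : ℕ) :
    ∑ x ∈ Finset.Icc (-(M : ℤ)) M, (1 + |(x : ℝ)|)⁻¹ ≤ 2 * (1 + Real.log (M + 1)) := by
  have h1 : ∑ x ∈ Finset.Icc (-(M : ℤ)) M, (1 + |(x : ℝ)|)⁻¹ ≤
      ∑ x ∈ (Finset.range (M + 1)).image (fun i : ℕ => (i : ℤ)) ∪
        (Finset.range (M + 1)).image (fun i : ℕ => -(i : ℤ)), (1 + |(x : ℝ)|)⁻¹ := by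
    refine Finset.sum_le_sum_of_subset_of_nonneg ?_ fun _ _ _ => by positivity
    intro x hx
    simp only [Finset.mem_Icc] at hx
    simp only [Finset.mem_union, Finset.mem_image, Finset.mem_range]
    rcases le_total 0 x with h | h
    · exact Or.inl ⟨x.toNat, by omega, by omega⟩
    · exact Or.inr ⟨(-x).toNat, by omega, by omega⟩
  have h2 := Finset.sum_union_inter (s₁ := (Finset.range (M + 1)).image (fun i : ℕ => (i : ℤ)))
    (s₂ := (Finset.range (M + 1)).image (fun i : ℕ => -(i : ℤ))) (f := fun x => (1 + |(x : ℝ)|)⁻¹)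
  have h3 : (0 : ℝ) ≤ ∑ x ∈ (Finset.range (M + 1)).image (fun i : ℕ => (i : ℤ)) ∩
        (Finset.range (M + 1)).image (fun i : ℕ => -(i : ℤ)), (1 + |(x : ℝ)|)⁻¹ :=
    Finset.sum_nonneg fun _ _ => by positivity
  rw [Finset.sum_image (fun a _ b _ h => by simpa using h),
    Finset.sum_image (fun a _ b _ h => by simpa using h)] at h2
  have h4 := harmonic_le_one_add_log (M + 1)
  have h5 : ((harmonic (M + 1) : ℚ) : ℝ) = ∑ i ∈ Finset.range (M + 1), (1 + (i : ℝ))⁻¹ := by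
    simp only [harmonic]; push_cast
    exact Finset.sum_congr rfl fun i _ => by rw [add_comm]
  rw [h5] at h4
  push_cast at h2 h4
  simp only [abs_neg, Nat.abs_cast] at h2
  linarith

/-- Upper bound for the sum of `(1 + |v|²)⁻¹` over a square of radius `M`. -/
noncomputable def boxSum (M : ℕ) : ℝ := 8 * (1 + Real.log (M + 1)) ^ 2

lemma sum_inv_nsq_le {S : Finset (ℤ × ℤ)} {w : ℤ × ℤ} {M : ℕ}
    (h : ∀ z ∈ S, |w.1 - z.1| ≤ M ∧ |w.2 - z.2| ≤ M) :
    ∑ z ∈ S, 1 / (1 + nsq (w - z)) ≤ boxSum M := by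
  have h1 : ∑ z ∈ S, 1 / (1 + nsq (w - z)) = ∑ v ∈ S.image (fun z => w - z), 1 / (1 + nsq v) := by
    rw [Finset.sum_image]
    intro a _ b _ hab
    simpa using hab
  rw [h1]
  have h2 : S.image (fun z => w - z) ⊆ Finset.Icc (-(M : ℤ)) M ×ˢ Finset.Icc (-(M : ℤ)) M := by
    intro v hv
    obtain ⟨z, hz, rfl⟩ := Finset.mem_image.1 hv
    have := h z hz
    simpa [abs_le] using this
  refine (Finset.sum_le_sum_of_subset_of_nonneg h2 fun v _ _ => ?_).trans ?_
  · have := nsq_nonneg v; positivity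
  have h3 : ∀ v ∈ Finset.Icc (-(M : ℤ)) M ×ˢ Finset.Icc (-(M : ℤ)) M,
      1 / (1 + nsq v) ≤ 2 * ((1 + |(v.1 : ℝ)|)⁻¹ * (1 + |(v.2 : ℝ)|)⁻¹) := by
    intro v _
    rw [← mul_inv, ← div_eq_mul_inv, div_le_div_iff₀ (by linarith [nsq_nonneg v]) (by positivity)]
    unfold nsq
    rw [← sq_abs (v.1 : ℝ), ← sq_abs (v.2 : ℝ)]
    generalize |(v.1 : ℝ)| = a
    generalize |(v.2 : ℝ)| = b
    nlinarith [sq_nonneg (a - b), sq_nonneg (a - 1), sq_nonneg (b - 1)]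
  refine (Finset.sum_le_sum h3).trans ?_
  rw [← Finset.mul_sum, Finset.sum_product]
  simp only [← Finset.mul_sum, ← Finset.sum_mul]
  have h4 := sum_inv_Icc_le M
  have h5 : (0 : ℝ) ≤ ∑ x ∈ Finset.Icc (-(M : ℤ)) M, (1 + |(x : ℝ)|)⁻¹ :=
    Finset.sum_nonneg fun _ _ => by positivity
  unfold boxSum
  nlinarith

/-- Cauchy–Schwarz for functions whose square is bounded by a multiple of `(1 + |v|²)⁻¹`. -/
lemma sum_abs_le_of_sq_le {S : Finset (ℤ × ℤ)} {w : ℤ × ℤ} {M : ℕ} {g : ℤ × ℤ → ℝ} {C : ℝ}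
    (hC : 0 ≤ C) (hg : ∀ z ∈ S, g z ^ 2 ≤ C / (1 + nsq (w - z)))
    (h : ∀ z ∈ S, |w.1 - z.1| ≤ M ∧ |w.2 - z.2| ≤ M) :
    ∑ z ∈ S, |g z| ≤ Real.sqrt (S.card * (C * boxSum M)) := by
  refine Real.le_sqrt_of_sq_le ?_
  refine (sq_sum_le_card_mul_sum_sq).trans ?_
  refine mul_le_mul_of_nonneg_left ?_ (by positivity)
  refine (Finset.sum_le_sum fun z hz => (sq_abs (g z)).le.trans (hg z hz)).trans ?_
  have := mul_le_mul_of_nonneg_left (sum_inv_nsq_le h) hC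
  rw [Finset.mul_sum] at this
  simpa only [mul_one_div] using this

lemma AllowedStep.mem_dirs {c : Prop} {a b : ℤ × ℤ} (h : AllowedStep c a b) : a ∈ dirs :=
  h.elim (fun h => h.2) (fun h => h.2.2.1)

lemma abs_le_one_of_mem_dirs {e : ℤ × ℤ} (h : e ∈ dirs) : |e.1| ≤ 1 ∧ |e.2| ≤ 1 := by
  rcases dirs_cases h with rfl | rfl | rfl | rfl <;> simp

lemma IsCont.abs_sub_le {p q : JPath} {t n i j : ℕ} (h : IsCont p t n q) (hij : i ≤ j)
    (hj : j ≤ n) : |(q (t + j)).1.1 - (q (t + i)).1.1| ≤ j - i ∧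
      |(q (t + j)).1.2 - (q (t + i)).1.2| ≤ j - i := by
  induction j, hij using Nat.le_induction with
  | base => simp
  | succ j hij ih =>
    have h1 := ih (by omega)
    have h2 := abs_le_one_of_mem_dirs (h.2 (t + j) (by omega) (by omega)).mem_dirs
    rw [show t + j + 1 = t + (j + 1) by ring] at h2
    simp only [Prod.fst_sub, Prod.snd_sub, abs_le] at *
    push_cast
    omega

lemma stepMean_false_eq (g : ℤ × ℤ → ℤ × ℤ → ℝ) : stepMean False g =
    1 / 4 * (g (-1, 0) (-1, 0) + g (1, 0) (1, 0) + g (0, 1) (0, 1) + g (0, -1) (0, -1)) := by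
  simp [stepMean]

lemma stepMean_le_of_abs_le {c : Prop} {g : ℤ × ℤ → ℤ × ℤ → ℝ} {b : ℝ}
    (h : ∀ x y, AllowedStep c x y → |g x y| ≤ b) : stepMean c g ≤ b :=
  (stepMean_mono fun x y hxy => (le_abs_self _).trans (h x y hxy)).trans (stepMean_const c b).le

/-- The sites visited by the first walk during `[t, t + i]`. -/
noncomputable def rangeFrom (q : JPath) (t i : ℕ) : Finset (ℤ × ℤ) :=
  (Finset.range (i + 1)).image fun j => (q (t + j)).1

lemma mem_rangeFrom {q : JPath} {t i : ℕ} {z : ℤ × ℤ} :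
    z ∈ rangeFrom q t i ↔ ∃ j ≤ i, (q (t + j)).1 = z := by
  simp [rangeFrom]

lemma rangeFrom_addStep (q : JPath) (t i : ℕ) (a b : ℤ × ℤ) :
    rangeFrom (addStep q (t + i) a b) t (i + 1) =
      insert ((q (t + i)).1 + a) (rangeFrom q t i) := by
  unfold rangeFrom
  rw [Finset.range_add_one, Finset.image_insert]
  congr 1
  · rw [← add_assoc, addStep_apply_succ]
  · exact Finset.image_congr fun j hj => by
      simp only [Finset.coe_range, Set.mem_Iio] at hj
      show (addStep q (t + i) a b (t + j)).1 = _
      rw [addStep_apply_of_le (by omega)]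

/-- A walk that makes few fresh steps is unlikely to visit few sites. -/
lemma pathProb_range_small (n t r k : ℕ) (p : JPath) {θ b : ℝ} (hθ : 0 ≤ θ) (hθb : θ * b ≤ 1)
    (hb : Real.sqrt (r * (45 * boxSum n)) ≤ b) :
    pathProb n t p (fun q => (rangeFrom q t n).card ≤ r ∧ freshCount q t n ≤ k) ≤
      Real.exp (-(θ * (-(r * Real.log (1 + 2 * n ^ 2)) - (b + Real.log 2) * k + Real.log 2 * n)) +
        n * (θ ^ 2 * b ^ 2)) := by
  have hb0 : 0 ≤ b := (Real.sqrt_nonneg _).trans hb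
  have hl2 : 0 < Real.log 2 := Real.log_pos (by norm_num)
  set G : ℕ → JPath → ℝ := fun i q => -∑ z ∈ rangeFrom q t i, logPot ((q (t + i)).1 - z) with hG
  have hdiff : ∀ i q a a', G (i + 1) (addStep q (t + i) a a') - G i q =
      -∑ z ∈ rangeFrom q t i,
        (logPot ((q (t + i)).1 - z + a) - logPot ((q (t + i)).1 - z)) := by
    intro i q a a'
    simp only [hG]
    rw [rangeFrom_addStep, ← add_assoc, addStep_apply_succ,
      Finset.sum_insert_of_eq_zero_if_notMem (by intro; simp [logPot_zero]),
      Finset.sum_sub_distrib]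
    simp only [sub_add_eq_add_sub]
    ring
  have hnear : ∀ i ≤ n, ∀ q, IsCont p t i q → ∀ z ∈ rangeFrom q t i,
      |(q (t + i)).1.1 - z.1| ≤ n ∧ |(q (t + i)).1.2 - z.2| ≤ n := by
    intro i hi q hq z hz
    obtain ⟨j, hj, rfl⟩ := mem_rangeFrom.1 hz
    have := hq.abs_sub_le hj le_rfl
    constructor <;> [refine this.1.trans ?_; refine this.2.trans ?_] <;> omega
  have hbd : ∀ i < n, ∀ q, IsCont p t i q → (rangeFrom q t i).card ≤ r → ∀ u v,
      AllowedStep (FreshLeft (t + i) q) u v →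
        |G (i + 1) (addStep q (t + i) u v) - G i q| ≤ b := by
    intro i hi q hq hg u v huv
    rw [hdiff, abs_neg]
    refine (Finset.abs_sum_le_sum_abs _ _).trans (le_trans ?_ hb)
    refine (sum_abs_le_of_sq_le (by norm_num : (0 : ℝ) ≤ 45)
      (fun z _ => sq_logPot_sub_le _ huv.mem_dirs) (hnear i hi.le q hq)).trans ?_
    apply Real.sqrt_le_sqrt
    gcongr
    unfold boxSum; positivity
  have h := pathProb_le_exp (n := n) (t := t) (p := p) (G := G)
    (good := fun i q => (rangeFrom q t i).card ≤ r) (θ := θ) (b := b) (d := b + Real.log 2)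
    (a := Real.log 2) (x := -(r * Real.log (1 + 2 * n ^ 2)) - (b + Real.log 2) * k) hθ hθb
    (fun i _ q _ u v _ h => by
      rw [rangeFrom_addStep] at h
      exact (Finset.card_le_card (Finset.subset_insert _ _)).trans h) hbd ?_
  · refine (pathProb_mono fun q hq hQ => ⟨hQ.1, ?_⟩).trans h
    have h0 : G 0 p = 0 := by simp [hG, rangeFrom, logPot_zero]
    have h1 : ∑ z ∈ rangeFrom q t n, logPot ((q (t + n)).1 - z) ≤
        r * Real.log (1 + 2 * n ^ 2) := by
      have h2 : ∀ z ∈ rangeFrom q t n, logPot ((q (t + n)).1 - z) ≤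
          Real.log (1 + 2 * n ^ 2) := by
        intro z hz
        obtain ⟨h3, h4⟩ := hnear n le_rfl q hq z hz
        have h5 : ((((q (t + n)).1 - z).1 : ℤ) : ℝ) ^ 2 ≤ n ^ 2 := by
          apply sq_le_sq'  <;> [rw [abs_le] at h3; rw [abs_le] at h3] <;>
          [exact_mod_cast h3.1; exact_mod_cast h3.2]
        have h6 : ((((q (t + n)).1 - z).2 : ℤ) : ℝ) ^ 2 ≤ n ^ 2 := by
          apply sq_le_sq'  <;> [rw [abs_le] at h4; rw [abs_le] at h4] <;>
          [exact_mod_cast h4.1; exact_mod_cast h4.2]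
        apply Real.log_le_log (by linarith [nsq_nonneg ((q (t + n)).1 - z)])
        unfold nsq; linarith
      refine (Finset.sum_le_card_nsmul _ _ _ h2).trans ?_
      rw [nsmul_eq_mul]
      have : 0 ≤ Real.log (1 + 2 * (n : ℝ) ^ 2) := Real.log_nonneg (by nlinarith [sq_nonneg (n : ℝ)])
      gcongr
      exact hQ.1
    have h7 : (freshCount q t n : ℝ) ≤ k := by exact_mod_cast hQ.2
    have h8 := mul_le_mul_of_nonneg_left h7 (show 0 ≤ b + Real.log 2 by linarith)
    rw [h0]
    simp only [hG]
    linarith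
  · intro i hi q hq hg
    by_cases hc : FreshLeft (t + i) q
    · have := stepMean_le_of_abs_le (hbd i hi q hq hg)
      simp only [hc, if_true] at this ⊢
      linarith
    · simp only [hdiff, hc, stepMean_false_eq, if_false]
      have h1 : ∑ z ∈ rangeFrom q t i, (if z = (q (t + i)).1 then 4 * Real.log 2 else 0) ≤
          ∑ z ∈ rangeFrom q t i,
            ((logPot ((q (t + i)).1 - z + (-1, 0)) - logPot ((q (t + i)).1 - z)) +
            (logPot ((q (t + i)).1 - z + (1, 0)) - logPot ((q (t + i)).1 - z)) +
            (logPot ((q (t + i)).1 - z + (0, 1)) - logPot ((q (t + i)).1 - z)) +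
            (logPot ((q (t + i)).1 - z + (0, -1)) - logPot ((q (t + i)).1 - z))) := by
        refine Finset.sum_le_sum fun z _ => ?_
        split_ifs with hz
        · subst hz
          simp only [sub_self, logPot_zero, zero_add]
          rw [logPot_of_mem_dirs (by simp [dirs]), logPot_of_mem_dirs (by simp [dirs]),
            logPot_of_mem_dirs (by simp [dirs]), logPot_of_mem_dirs (by simp [dirs])]
          linarith
        · linarith [logPot_subharmonic ((q (t + i)).1 - z)]
      rw [Finset.sum_ite_eq' , if_pos (mem_rangeFrom.2 ⟨i, le_rfl, rfl⟩)] at h1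
      simp only [Finset.sum_add_distrib] at h1
      linarith

/-- Neither `z` nor `z - (2, 0)` is visited during `[t, t + i]`. -/
def Untouched (q : JPath) (t i : ℕ) (z : ℤ × ℤ) : Prop :=
  ∀ j ≤ i, (q (t + j)).1 ≠ z ∧ (q (t + j)).1 ≠ z + (-2, 0)

/-- Within `[t, t + i]`, the site `z` is visited before `z - (2, 0)`. -/
def HitFirst (q : JPath) (t i : ℕ) (z : ℤ × ℤ) : Prop :=
  ∃ j ≤ i, (q (t + j)).1 = z ∧ ∀ j' ≤ j, (q (t + j')).1 ≠ z + (-2, 0)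

lemma untouched_succ {q : JPath} {t i : ℕ} {z : ℤ × ℤ} : Untouched q t (i + 1) z ↔
    Untouched q t i z ∧ (q (t + (i + 1))).1 ≠ z ∧ (q (t + (i + 1))).1 ≠ z + (-2, 0) := by
  constructor
  · exact fun h => ⟨fun j hj => h j (by omega), h (i + 1) le_rfl⟩
  · rintro ⟨h1, h2⟩ j hj
    rcases Nat.lt_or_ge i j with h | h
    · obtain rfl : j = i + 1 := by omega
      exact h2
    · exact h1 j h

/-- The increments of `dipole (· - z)` along the first walk while `z` is untouched. -/
noncomputable def dipoleSum (q : JPath) (t i : ℕ) (z : ℤ × ℤ) : ℝ :=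
  ∑ j ∈ Finset.range i, if Untouched q t j z then
    dipole ((q (t + (j + 1))).1 - z) - dipole ((q (t + j)).1 - z) else 0

lemma dipoleSum_of_untouched_zero {q : JPath} {t : ℕ} {z : ℤ × ℤ} (h : Untouched q t 0 z)
    (i : ℕ) :
    (Untouched q t i z →
      dipoleSum q t i z + dipole ((q t).1 - z) = dipole ((q (t + i)).1 - z)) ∧
    (¬ Untouched q t i z →
      (if HitFirst q t i z then -12 else 1) ≤ dipoleSum q t i z + dipole ((q t).1 - z)) := by
  induction i with
  | zero => exact ⟨fun _ => by simp [dipoleSum], fun h' => absurd h h'⟩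
  | succ i ih =>
    have hs : dipoleSum q t (i + 1) z = dipoleSum q t i z + if Untouched q t i z then
        dipole ((q (t + (i + 1))).1 - z) - dipole ((q (t + i)).1 - z) else 0 := by
      simp [dipoleSum, Finset.sum_range_succ]
    by_cases hi : Untouched q t i z
    · have h1 : dipoleSum q t (i + 1) z + dipole ((q t).1 - z) =
          dipole ((q (t + (i + 1))).1 - z) := by
        rw [hs, if_pos hi]; linarith [ih.1 hi]
      refine ⟨fun _ => h1, fun hn => ?_⟩
      rw [h1]
      have h2 : (q (t + (i + 1))).1 = z ∨ (q (t + (i + 1))).1 = z + (-2, 0) := by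
        by_contra! h3
        exact hn (untouched_succ.2 ⟨hi, h3⟩)
      rcases h2 with h2 | h2
      · have h3 : HitFirst q t (i + 1) z := by
          refine ⟨i + 1, le_rfl, h2, fun j hj => ?_⟩
          rcases Nat.lt_or_ge i j with h | h
          · obtain rfl : j = i + 1 := by omega
            rw [h2]; simp
          · exact (hi j h).2
        rw [if_pos h3, h2, sub_self]
        exact (abs_le.1 abs_dipole_zero_le).1
      · rw [h2, add_sub_cancel_left]
        have := one_le_dipole
        split_ifs <;> linarith
    · rw [hs, if_neg hi, add_zero]
      refine ⟨fun h' => absurd (untouched_succ.1 h').1 hi, fun _ => ?_⟩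
      refine le_trans ?_ (ih.2 hi)
      by_cases hf : HitFirst q t i z
      · obtain ⟨j, hj, hj'⟩ := hf
        rw [if_pos ⟨j, by omega, hj'⟩, if_pos ⟨j, hj, hj'⟩]
      · rw [if_neg hf]; split_ifs <;> norm_num

lemma dipoleSum_ge (q : JPath) (t i : ℕ) (z : ℤ × ℤ) :
    (if Untouched q t i z then 0 else 1) - (if HitFirst q t i z then 13 else 0)
        - (if z = (q t).1 + (2, 0) then 1 else 0)
        - |dipole ((q t).1 - z)| - |dipole ((q (t + i)).1 - z)| ≤ dipoleSum q t i z := by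
  have a1 := abs_nonneg (dipole ((q t).1 - z))
  have a2 := abs_nonneg (dipole ((q (t + i)).1 - z))
  have a3 := neg_abs_le (dipole ((q (t + i)).1 - z))
  have a4 := le_abs_self (dipole ((q t).1 - z))
  by_cases h : Untouched q t 0 z
  · obtain ⟨h1, h2⟩ := dipoleSum_of_untouched_zero h i
    by_cases hi : Untouched q t i z
    · have := h1 hi
      rw [if_pos hi]
      split_ifs <;> linarith
    · have := h2 hi
      rw [if_neg hi]
      split_ifs at this ⊢ <;> linarith
  · have hn : ∀ j, ¬ Untouched q t j z := fun j hj => h fun j' hj' => hj j' (by omega)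
    have h0 : dipoleSum q t i z = 0 := by simp [dipoleSum, hn]
    rw [h0, if_neg (hn i)]
    by_cases hz : (q t).1 = z
    · have : HitFirst q t i z := by
        refine ⟨0, by omega, by simpa using hz, fun j hj => ?_⟩
        obtain rfl : j = 0 := by omega
        simp [hz]
      rw [if_pos this]; split_ifs <;> linarith
    · have : z = (q t).1 + (2, 0) := by
        by_contra hz'
        refine h fun j hj => ?_
        obtain rfl : j = 0 := by omega
        refine ⟨hz, fun h' => hz' ?_⟩
        rw [add_zero] at h'
        rw [h', add_assoc]; simp
      rw [if_pos this]; split_ifs <;> linarith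

lemma freshCount_succ_ge (q : JPath) (t n : ℕ) :
    ((Finset.range (n + 1)).filter fun j => FreshLeft (t + j) q).card ≤ freshCount q t n + 1 := by
  unfold freshCount
  rw [Finset.range_add_one, Finset.filter_insert]
  split_ifs
  · exact Finset.card_insert_le _ _
  · omega

/-- A walk that stays in new columns and makes few fresh steps visits few sites right of
already visited ones. -/
lemma card_hitFirst_le {q : JPath} {t n : ℕ} {β : ℤ} (hβ : ∀ s < t, (q s).1.1 ≤ β)
    (Z : Finset (ℤ × ℤ)) (hZ : ∀ z ∈ Z, β + 3 ≤ z.1) :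
    (Z.filter fun z => HitFirst q t n z).card ≤ 2 * (freshCount q t n + 1) := by
  set J := (Finset.range (n + 1)).filter fun j => FreshLeft (t + j) q with hJ
  have hsub : (Z.filter fun z => HitFirst q t n z) ⊆
      J.image (fun j => (q (t + j)).1) ∪ J.image (fun j => (q (t + j)).1 + (1, 0)) := by
    intro z hz
    obtain ⟨hzZ, j, hj, hjz, hj'⟩ := Finset.mem_filter.1 hz
    have hcol := hZ z hzZ
    have hun : ∀ s ≤ t + j, (q s).1 ≠ z + (-2, 0) := by
      intro s hs
      rcases Nat.lt_or_ge s t with h | h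
      · intro h'
        have := hβ s h
        rw [h'] at this
        simp at this; omega
      · have := hj' (s - t) (by omega)
        rwa [Nat.add_sub_cancel' h] at this
    rw [Finset.mem_union]
    by_cases hv : ∃ s ≤ t + j, (q s).1 = z + (-1, 0)
    · obtain ⟨s, hs, hsz⟩ := hv
      have hst : t ≤ s := by
        by_contra! h
        have := hβ s h
        rw [hsz] at this
        simp at this; omega
      refine Or.inr (Finset.mem_image.2 ⟨s - t, ?_, ?_⟩)
      · rw [hJ, Finset.mem_filter, Nat.add_sub_cancel' hst]
        refine ⟨Finset.mem_range.2 (by omega), fun u hu => ?_⟩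
        rw [hsz, add_assoc]
        exact hun u (by omega)
      · rw [Nat.add_sub_cancel' hst, hsz, add_assoc]; simp
    · push Not at hv
      refine Or.inl (Finset.mem_image.2 ⟨j, ?_, hjz⟩)
      rw [hJ, Finset.mem_filter]
      exact ⟨Finset.mem_range.2 (by omega), fun u hu => by rw [hjz]; exact hv u hu⟩
  have h1 : J.card ≤ _ := freshCount_succ_ge q t n
  calc _ ≤ _ := Finset.card_le_card hsub
    _ ≤ J.card + J.card := (Finset.card_union_le _ _).trans
        (Nat.add_le_add Finset.card_image_le Finset.card_image_le)
    _ ≤ _ := by omega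

/-- A walk that stays in new columns and makes few fresh steps is unlikely to visit many
sites. -/
lemma pathProb_range_large (n t r k B : ℕ) {p : JPath} {β : ℤ} (hβ : ∀ s < t, (p s).1.1 ≤ β)
    {θ b F : ℝ} (hθ : 0 ≤ θ) (hθb : θ * b ≤ 1) (hb : 20000 * boxSum (2 * B + 2) ≤ b)
    (hF : Real.sqrt (((2 * B + 5 : ℕ) : ℝ) ^ 2 * (10000 * boxSum (2 * B + 2))) ≤ F) :
    pathProb n t p (fun q => (∀ j ≤ n, (q (t + j)).1 ∈ boxAt (p t).1 B) ∧
      (∀ j ≤ n, 0 < j → β < (q (t + j)).1.1) ∧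
      r ≤ (rangeFrom q t n).card ∧ freshCount q t n ≤ k) ≤
      Real.exp (-(θ * (r - 28 - 26 * k - 2 * F - b * k)) + n * (θ ^ 2 * b ^ 2)) := by
  have hb0 : 0 ≤ b := le_trans (by unfold boxSum; positivity) hb
  obtain ⟨Z, hZ⟩ : ∃ Z, Z = (boxAt (p t).1 (B + 2)).filter fun z => β + 3 ≤ z.1 := ⟨_, rfl⟩
  have hmem : ∀ z, z ∈ Z ↔ z ∈ boxAt (p t).1 (B + 2) ∧ β + 3 ≤ z.1 := fun z => by
    rw [hZ, Finset.mem_filter]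
  set G : ℕ → JPath → ℝ := fun i q => ∑ z ∈ Z, dipoleSum q t i z with hG
  have hdiff : ∀ i q a a', G (i + 1) (addStep q (t + i) a a') - G i q =
      ∑ z ∈ Z.filter (fun z => Untouched q t i z),
        (dipole ((q (t + i)).1 - z + a) - dipole ((q (t + i)).1 - z)) := by
    intro i q a a'
    simp only [hG]
    rw [← Finset.sum_sub_distrib, Finset.sum_filter]
    refine Finset.sum_congr rfl fun z _ => ?_
    have hU : ∀ j ≤ i, Untouched (addStep q (t + i) a a') t j z ↔ Untouched q t j z :=
      fun j hj => forall₂_congr fun j' hj' => by rw [addStep_apply_of_le (by omega)]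
    unfold dipoleSum
    rw [Finset.sum_range_succ, ← add_assoc t i 1, addStep_apply_succ, addStep_apply_self]
    simp only [hU i le_rfl, sub_add_eq_add_sub]
    rw [Finset.sum_congr rfl (fun j hj => ?_)]
    · ring
    · have hj' := Finset.mem_range.1 hj
      rw [addStep_apply_of_le (by omega), addStep_apply_of_le (by omega)]
      simp only [hU j (by omega)]
  have hnear : ∀ w ∈ boxAt (p t).1 B, ∀ z ∈ Z,
      |w.1 - z.1| ≤ (2 * B + 2 : ℕ) ∧ |w.2 - z.2| ≤ (2 * B + 2 : ℕ) := by
    intro w hw z hz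
    have h1 := mem_boxAt.1 hw
    have h2 := mem_boxAt.1 ((hmem z).1 hz).1
    simp only [abs_le] at *
    push_cast at *
    omega
  set good : ℕ → JPath → Prop := fun i q => ∀ j ≤ i, (q (t + j)).1 ∈ boxAt (p t).1 B with hgood
  have hne : ∀ i q, ∀ z ∈ Z.filter (fun z => Untouched q t i z), (q (t + i)).1 - z ≠ 0 :=
    fun i q z hz h => ((Finset.mem_filter.1 hz).2 i le_rfl).1 (sub_eq_zero.1 h)
  have hbd : ∀ i < n, ∀ q, IsCont p t i q → good i q → ∀ u v,
      AllowedStep (FreshLeft (t + i) q) u v →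
        |G (i + 1) (addStep q (t + i) u v) - G i q| ≤ b := by
    intro i hi q hq hg u v huv
    rw [hdiff]
    refine (Finset.abs_sum_le_sum_abs _ _).trans (le_trans ?_ hb)
    refine (Finset.sum_le_sum fun z hz => abs_dipole_sub_le (hne i q z hz) huv.mem_dirs).trans ?_
    have := mul_le_mul_of_nonneg_left (sum_inv_nsq_le (S := Z.filter (fun z => Untouched q t i z))
      (w := (q (t + i)).1) (M := 2 * B + 2) fun z hz =>
        hnear _ (hg i le_rfl) z (Finset.mem_filter.1 hz).1) (by norm_num : (0 : ℝ) ≤ 20000)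
    rw [Finset.mul_sum] at this
    simpa only [mul_one_div] using this
  have h := pathProb_le_exp (n := n) (t := t) (p := p) (G := G) (good := good) (θ := θ) (b := b)
    (d := b) (a := 0) (x := r - 28 - 26 * k - 2 * F - b * k) hθ hθb
    (fun i _ q _ u v _ h j hj => by
      have := h j (by omega)
      rwa [addStep_apply_of_le (by omega)] at this) hbd ?_
  · rw [zero_mul, add_zero] at h
    refine (pathProb_mono fun q hq hQ => ?_).trans h
    obtain ⟨hbox, hpos, hr, hk⟩ := hQ
    refine ⟨hbox, ?_⟩
    have h0 : G 0 p = 0 := by simp [hG, dipoleSum]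
    have hqt : q t = p t := hq.1 t le_rfl
    have hfr : (freshCount q t n : ℝ) ≤ k := by exact_mod_cast hk
    have hbk := mul_le_mul_of_nonneg_left hfr hb0
    have hFsum : ∀ w ∈ boxAt (p t).1 B, ∑ z ∈ Z, |dipole (w - z)| ≤ F := by
      intro w hw
      refine (sum_abs_le_of_sq_le (by norm_num : (0 : ℝ) ≤ 10000)
        (fun z _ => sq_dipole_le _) (hnear w hw)).trans (le_trans ?_ hF)
      apply Real.sqrt_le_sqrt
      refine mul_le_mul_of_nonneg_right ?_ (by unfold boxSum; positivity)
      have : Z.card ≤ (2 * B + 5) ^ 2 := by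
        rw [hZ]
        refine (Finset.card_filter_le _ _).trans ?_
        rw [card_boxAt]; apply le_of_eq; ring
      exact_mod_cast this
    have hF1 := hFsum _ (by have := hbox 0 (by omega); rwa [add_zero] at this)
    have hF2 := hFsum _ (hbox n le_rfl)
    have hhit := card_hitFirst_le (q := q) (t := t) (n := n) (β := β)
      (fun s hs => by rw [hq.1 s hs.le]; exact hβ s hs) Z fun z hz => ((hmem z).1 hz).2
    have hin : (rangeFrom q t n).card ≤ (Z.filter fun z => ¬ Untouched q t n z).card + 1 := by
      have hsub : ((rangeFrom q t n).erase (q t).1).image (fun w => w + (2, 0)) ⊆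
          Z.filter fun z => ¬ Untouched q t n z := by
        intro z hz
        obtain ⟨w, hw, rfl⟩ := Finset.mem_image.1 hz
        obtain ⟨hwt, hw⟩ := Finset.mem_erase.1 hw
        obtain ⟨j, hj, rfl⟩ := mem_rangeFrom.1 hw
        have hj0 : 0 < j := by
          rcases Nat.eq_zero_or_pos j with rfl | h
          · simp at hwt
          · exact h
        have h1 := hpos j hj hj0
        have h2 := mem_boxAt.1 (hbox j hj)
        rw [Finset.mem_filter, hmem, mem_boxAt]
        refine ⟨⟨?_, ?_⟩, fun hU => (hU j hj).2 (by rw [add_assoc]; simp)⟩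
        · simp only [Prod.fst_add, Prod.snd_add, abs_le] at h2 ⊢
          push_cast
          omega
        · simp only [Prod.fst_add]; omega
      have h1 := Finset.card_le_card hsub
      rw [Finset.card_image_of_injective _ (add_left_injective _)] at h1
      have h2 := Finset.pred_card_le_card_erase (s := rangeFrom q t n) (a := (q t).1)
      omega
    have hsum : ∑ z ∈ Z, ((if Untouched q t n z then (0 : ℝ) else 1)
        - (if HitFirst q t n z then 13 else 0) - (if z = (q t).1 + (2, 0) then 1 else 0)
        - |dipole ((q t).1 - z)| - |dipole ((q (t + n)).1 - z)|) ≤ G n q :=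
      Finset.sum_le_sum fun z _ => dipoleSum_ge q t n z
    simp only [Finset.sum_sub_distrib] at hsum
    have e1 : ∑ z ∈ Z, (if Untouched q t n z then (0 : ℝ) else 1) =
        ((Z.filter fun z => ¬ Untouched q t n z).card : ℝ) := by
      rw [Finset.card_filter]; push_cast
      exact Finset.sum_congr rfl fun z _ => by split_ifs <;> rfl
    have e2 : ∑ z ∈ Z, (if HitFirst q t n z then (13 : ℝ) else 0) =
        13 * ((Z.filter fun z => HitFirst q t n z).card : ℝ) := by
      rw [Finset.card_filter]; push_cast
      rw [Finset.mul_sum]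
      exact Finset.sum_congr rfl fun z _ => by split_ifs <;> norm_num
    have e3 : ∑ z ∈ Z, (if z = (q t).1 + (2, 0) then (1 : ℝ) else 0) ≤ 1 := by
      rw [Finset.sum_ite_eq']; split_ifs <;> norm_num
    rw [e1, e2] at hsum
    have c1 : (r : ℝ) ≤ ((Z.filter fun z => ¬ Untouched q t n z).card : ℝ) + 1 := by
      exact_mod_cast hr.trans hin
    have c2 : ((Z.filter fun z => HitFirst q t n z).card : ℝ) ≤ 2 * (freshCount q t n + 1) := by
      exact_mod_cast hhit
    rw [h0]
    linarith
  · intro i hi q hq hg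
    by_cases hc : FreshLeft (t + i) q
    · have := stepMean_le_of_abs_le (hbd i hi q hq hg)
      simp only [hc, if_true] at this ⊢
      linarith
    · simp only [hdiff, hc, stepMean_false_eq, if_false]
      rw [← Finset.sum_add_distrib, ← Finset.sum_add_distrib, ← Finset.sum_add_distrib]
      have : ∑ z ∈ Z.filter (fun z => Untouched q t i z),
          (dipole ((q (t + i)).1 - z + (-1, 0)) - dipole ((q (t + i)).1 - z) +
          (dipole ((q (t + i)).1 - z + (1, 0)) - dipole ((q (t + i)).1 - z)) +
          (dipole ((q (t + i)).1 - z + (0, 1)) - dipole ((q (t + i)).1 - z)) +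
          (dipole ((q (t + i)).1 - z + (0, -1)) - dipole ((q (t + i)).1 - z))) ≤ 0 :=
        Finset.sum_nonpos fun z hz => by linarith [dipole_superharmonic (hne i q z hz)]
      linarith

/-- Exponential bound for the displacement in the direction `σ`. -/
lemma pathProb_displacement (n t k : ℕ) (p : JPath) {σ : ℤ × ℤ} (hσ : σ ∈ dirs) {θ x : ℝ}
    (hθ : 0 ≤ θ) (hθ1 : θ ≤ 1) :
    pathProb n t p (fun q => x ≤ σ.1 * ((q (t + n)).1.1 - (p t).1.1 : ℝ) +
        σ.2 * ((q (t + n)).1.2 - (p t).1.2 : ℝ) ∧ freshCount q t n ≤ k) ≤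
      Real.exp (-(θ * (x - k)) + n * θ ^ 2) := by
  have h := pathProb_le_exp (n := n) (t := t) (p := p)
    (G := fun i q => σ.1 * ((q (t + i)).1.1 : ℝ) + σ.2 * ((q (t + i)).1.2 : ℝ))
    (good := fun _ _ => True) (θ := θ) (b := 1) (d := 1) (a := 0) (x := x - k) hθ (by linarith)
    (fun _ _ _ _ _ _ _ _ => trivial) ?_ ?_
  · rw [show x - k + 0 * (n : ℝ) = x - k by ring, one_pow, mul_one] at h
    refine (pathProb_mono fun q hq hQ => ⟨trivial, ?_⟩).trans h
    have : (freshCount q t n : ℝ) ≤ k := by exact_mod_cast hQ.2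
    have h2 := hQ.1
    simp only [add_zero]
    linarith
  · intro i _ q _ _ u v huv
    rw [← add_assoc, addStep_apply_succ]
    simp only [Prod.fst_add, Prod.snd_add]
    have := huv.mem_dirs
    rcases dirs_cases hσ with rfl | rfl | rfl | rfl <;>
    rcases dirs_cases this with rfl | rfl | rfl | rfl <;> push_cast <;> ring_nf <;> norm_num
  · intro i _ q _ _
    simp only [← add_assoc, addStep_apply_succ, Prod.fst_add, Prod.snd_add, stepMean]
    rcases dirs_cases hσ with rfl | rfl | rfl | rfl <;> split_ifs <;> push_cast <;> ring_nf <;>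
      norm_num

/-- Fresh steps push the first walk to the right. -/
lemma pathProb_fresh_slow (n t k : ℕ) (p : JPath) {θ x : ℝ} (hθ : 0 ≤ θ) (hθ1 : θ ≤ 1) :
    pathProb n t p (fun q => ((q (t + n)).1.1 : ℝ) ≤ (p t).1.1 + x ∧ k ≤ freshCount q t n) ≤
      Real.exp (-(θ * (k / 7 - x)) + n * θ ^ 2) := by
  have h := pathProb_le_exp (n := n) (t := t) (p := p)
    (G := fun i q => -((q (t + i)).1.1 : ℝ))
    (good := fun _ _ => True) (θ := θ) (b := 1) (d := -1 / 7) (a := 0) (x := k / 7 - x) hθ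
    (by linarith) (fun _ _ _ _ _ _ _ _ => trivial) ?_ ?_
  · rw [show (k : ℝ) / 7 - x + 0 * (n : ℝ) = k / 7 - x by ring, one_pow, mul_one] at h
    refine (pathProb_mono fun q hq hQ => ⟨trivial, ?_⟩).trans h
    have : (k : ℝ) ≤ (freshCount q t n : ℝ) := by exact_mod_cast hQ.2
    have h2 := hQ.1
    simp only [add_zero]
    linarith
  · intro i _ q _ _ u v huv
    rw [← add_assoc, addStep_apply_succ]
    simp only [Prod.fst_add]
    rcases dirs_cases huv.mem_dirs with rfl | rfl | rfl | rfl <;> push_cast <;> ring_nf <;>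
      norm_num
  · intro i _ q _ _
    simp only [← add_assoc, addStep_apply_succ, Prod.fst_add, stepMean]
    split_ifs <;> push_cast <;> ring_nf <;> norm_num

lemma eventually_log_sq_le : ∃ u₀ : ℝ, ∀ u ≥ u₀, 160000 * (1 + 100 * Real.log u) ^ 2 ≤ u := by
  have h1 := (Real.isLittleO_pow_log_id_atTop (n := 2)).bound
    (show (0 : ℝ) < 1 / (160000 * 101 ^ 2) by norm_num)
  have h2 := Real.tendsto_log_atTop.eventually (eventually_ge_atTop 1)
  obtain ⟨u₀, hu₀⟩ := eventually_atTop.1 (h1.and (h2.and (eventually_ge_atTop 1)))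
  refine ⟨u₀, fun u hu => ?_⟩
  obtain ⟨h3, h4, h5⟩ := hu₀ u hu
  rw [id, Real.norm_of_nonneg (by positivity), Real.norm_of_nonneg (by linarith)] at h3
  have h6 : (1 + 100 * Real.log u) ^ 2 ≤ (101 * Real.log u) ^ 2 :=
    pow_le_pow_left₀ (by linarith) (by linarith) 2
  rw [mul_pow] at h6
  linarith

lemma exists_pow_le_mul_exp (n : ℕ) : ∃ K : ℝ, 0 < K ∧ ∀ u : ℝ, 0 ≤ u → u ^ n ≤ K * Real.exp u :=
  ⟨n.factorial, by exact_mod_cast n.factorial_pos, fun u hu => by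
    have := Real.pow_div_factorial_le_exp u hu n
    rwa [div_le_iff₀ (by exact_mod_cast n.factorial_pos), mul_comm] at this⟩

/-- At scale `n = u ^ 40`, a walk in new columns is unlikely to stay slow. -/
lemma pathProb_slow_le_of_large {u : ℝ} (hu : 10000 ≤ u)
    (hlog : 160000 * (1 + 100 * Real.log u) ^ 2 ≤ u) {n t : ℕ} (hn : (n : ℝ) = u ^ 40)
    {p : JPath} {β : ℤ} (hβ : ∀ s < t, (p s).1.1 ≤ β) :
    pathProb n t p (fun q => (∀ j ≤ n, 0 < j → β < (q (t + j)).1.1) ∧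
      ((q (t + n)).1.1 : ℝ) ≤ (p t).1.1 + u ^ 20) ≤ 12 * u ^ 40 * Real.exp (-u) := by
  have hu0 : 0 < u := by linarith
  have hu1 : 1 ≤ u := by linarith
  have hp : ∀ a b : ℕ, a < b → 10000 * u ^ a ≤ u ^ b := fun a b hab =>
    calc 10000 * u ^ a ≤ u * u ^ a := by gcongr
      _ = u ^ (a + 1) := by ring
      _ ≤ u ^ b := pow_le_pow_right₀ hu1 hab
  have hp1 : ∀ a : ℕ, 1 ≤ u ^ a := fun a => one_le_pow₀ hu1
  have hlu : 0 ≤ Real.log u := Real.log_nonneg hu1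
  have hlogle : ∀ x : ℝ, 0 < x → x ≤ u ^ 100 → Real.log x ≤ 100 * Real.log u := by
    intro x hx h
    have := Real.log_le_log hx h
    rw [Real.log_pow] at this
    exact_mod_cast this
  have hbox : ∀ M : ℕ, (M : ℝ) + 1 ≤ u ^ 100 → 20000 * boxSum M ≤ u := by
    intro M hM
    have h1 := hlogle (M + 1) (by positivity) hM
    have h2 : 0 ≤ Real.log ((M : ℝ) + 1) := Real.log_nonneg (by linarith [Nat.cast_nonneg (α := ℝ) M])
    have h3 : (1 + Real.log ((M : ℝ) + 1)) ^ 2 ≤ (1 + 100 * Real.log u) ^ 2 :=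
      pow_le_pow_left₀ (by linarith) (by linarith) 2
    unfold boxSum
    linarith
  have hceil : ∀ a : ℕ, u ^ a ≤ (⌈u ^ a⌉₊ : ℝ) ∧ (⌈u ^ a⌉₊ : ℝ) ≤ 2 * u ^ a := fun a =>
    ⟨Nat.le_ceil _, by linarith [(Nat.ceil_lt_add_one (show 0 ≤ u ^ a by positivity)).le, hp1 a]⟩
  set k := ⌈u ^ 22⌉₊
  set r := ⌈u ^ 32⌉₊
  set B := ⌈u ^ 24⌉₊
  obtain ⟨hk1, hk2⟩ := hceil 22
  obtain ⟨hr1, hr2⟩ := hceil 32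
  obtain ⟨hB1, hB2⟩ := hceil 24
  have hbn : 0 ≤ boxSum n := by unfold boxSum; positivity
  have hbB : 0 ≤ boxSum (2 * B + 2) := by unfold boxSum; positivity
  have hboxn := hbox n (by rw [hn]; linarith [hp 40 100 (by norm_num), hp1 40])
  have hboxB := hbox (2 * B + 2) (by push_cast; linarith [hp 24 100 (by norm_num), hp1 24])
  -- few sites
  have t1 : pathProb n t p (fun q => (rangeFrom q t n).card ≤ r ∧ freshCount q t n ≤ k) ≤
      Real.exp (-u) := by
    have hb : Real.sqrt (r * (45 * boxSum n)) ≤ 14 * u ^ 17 := by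
      rw [Real.sqrt_le_left (by positivity)]
      calc (r : ℝ) * (45 * boxSum n) ≤ (2 * u ^ 32) * (45 * u) := by
            gcongr; linarith
        _ = 90 * u ^ 33 := by ring
        _ ≤ 196 * u ^ 34 := by linarith [hp 33 34 (by norm_num), hp1 33]
        _ = (14 * u ^ 17) ^ 2 := by ring
    refine (pathProb_range_small n t r k p (θ := 1 / (784 * u ^ 34)) (by positivity) ?_ hb).trans ?_
    · rw [div_mul_eq_mul_div, div_le_one (by positivity)]
      linarith [hp 17 34 (by norm_num), hp1 34]
    · apply Real.exp_le_exp.2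
      have l1 : Real.log (1 + 2 * (n : ℝ) ^ 2) ≤ u := by
        refine (hlogle _ (by positivity) ?_).trans ?_
        · rw [hn, ← pow_mul]; norm_num
          linarith [hp 80 100 (by norm_num), hp1 80]
        · nlinarith
      have l2 := Real.log_two_gt_d9
      have l3 := Real.log_two_lt_d9
      have l4 : (r : ℝ) * Real.log (1 + 2 * (n : ℝ) ^ 2) ≤ 2 * u ^ 33 := by
        calc _ ≤ (2 * u ^ 32) * u := by
              gcongr
              exact Real.log_nonneg (by nlinarith [sq_nonneg (n : ℝ)])
          _ = _ := by ring
      have l5 : (14 * u ^ 17 + Real.log 2) * k ≤ 28 * u ^ 39 + 2 * u ^ 22 := by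
        calc _ ≤ (14 * u ^ 17 + 1) * (2 * u ^ 22) := by gcongr; linarith
          _ = _ := by ring
      have l6 : u ^ 40 / 2 ≤ -(r * Real.log (1 + 2 * (n : ℝ) ^ 2)) -
          (14 * u ^ 17 + Real.log 2) * k + Real.log 2 * n := by
        have e : Real.log 2 * (n : ℝ) = Real.log 2 * u ^ 40 := by rw [hn]
        have : (0.69 : ℝ) * u ^ 40 ≤ Real.log 2 * u ^ 40 := by gcongr; linarith
        linarith [hp 33 40 (by norm_num), hp 39 40 (by norm_num), hp 22 40 (by norm_num), hp1 40]
      have l7 : 1 / (784 * u ^ 34) * (u ^ 40 / 2) ≤ 1 / (784 * u ^ 34) *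
          (-(r * Real.log (1 + 2 * (n : ℝ) ^ 2)) -
          (14 * u ^ 17 + Real.log 2) * k + Real.log 2 * n) := by gcongr
      have l8 : 1 / (784 * u ^ 34) * (u ^ 40 / 2) = u ^ 6 / 1568 := by field_simp; norm_num
      have l9 : (n : ℝ) * ((1 / (784 * u ^ 34)) ^ 2 * (14 * u ^ 17) ^ 2) = u ^ 6 / 3136 := by
        rw [hn]; field_simp; norm_num
      rw [l9]
      have := hp 1 6 (by norm_num)
      rw [pow_one] at this
      linarith
  -- many sites
  have t2 : pathProb n t p (fun q => (∀ j ≤ n, (q (t + j)).1 ∈ boxAt (p t).1 B) ∧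
      (∀ j ≤ n, 0 < j → β < (q (t + j)).1.1) ∧
      r ≤ (rangeFrom q t n).card ∧ freshCount q t n ≤ k) ≤ Real.exp (-u) := by
    have hF : Real.sqrt (((2 * B + 5 : ℕ) : ℝ) ^ 2 * (10000 * boxSum (2 * B + 2))) ≤
        900 * u ^ 25 := by
      rw [Real.sqrt_le_left (by positivity)]
      have : ((2 * B + 5 : ℕ) : ℝ) ≤ 9 * u ^ 24 := by push_cast; linarith [hp1 24]
      calc ((2 * B + 5 : ℕ) : ℝ) ^ 2 * (10000 * boxSum (2 * B + 2)) ≤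
            (9 * u ^ 24) ^ 2 * (10000 * u) := by gcongr; linarith
        _ = 810000 * u ^ 49 := by ring
        _ ≤ 810000 * u ^ 50 := by linarith [hp 49 50 (by norm_num), hp1 49]
        _ = (900 * u ^ 25) ^ 2 := by ring
    refine (pathProb_range_large n t r k B hβ (θ := 1 / u ^ 20) (by positivity) ?_ hboxB hF).trans ?_
    · rw [div_mul_eq_mul_div, div_le_one (by positivity), one_mul]
      have := hp 1 20 (by norm_num)
      rw [pow_one] at this
      linarith
    · apply Real.exp_le_exp.2
      have l5 : u * k ≤ 2 * u ^ 23 := by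
        calc _ ≤ u * (2 * u ^ 22) := by gcongr
          _ = _ := by ring
      have l6 : u ^ 32 / 2 ≤ r - 28 - 26 * k - 2 * (900 * u ^ 25) - u * k := by
        linarith [hp 25 32 (by norm_num), hp 23 32 (by norm_num), hp 22 32 (by norm_num),
          hp1 32, hp 0 32 (by norm_num)]
      have l7 : 1 / u ^ 20 * (u ^ 32 / 2) ≤
          1 / u ^ 20 * (r - 28 - 26 * k - 2 * (900 * u ^ 25) - u * k) := by gcongr
      have l8 : 1 / u ^ 20 * (u ^ 32 / 2) = u ^ 12 / 2 := by field_simp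
      have l9 : (n : ℝ) * ((1 / u ^ 20) ^ 2 * u ^ 2) = u ^ 2 := by rw [hn]; field_simp
      rw [l9]
      have := hp 1 12 (by norm_num)
      rw [pow_one] at this
      linarith [hp 2 12 (by norm_num)]
  -- leaving the box
  have t3 : pathProb n t p (fun q => (∃ j ≤ n, (q (t + j)).1 ∉ boxAt (p t).1 B) ∧
      freshCount q t n ≤ k) ≤ 8 * u ^ 40 * Real.exp (-u) := by
    set S : Finset (ℕ × (ℤ × ℤ)) := Finset.range (n + 1) ×ˢ {(1, 0), (-1, 0), (0, 1), (0, -1)}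
      with hS
    have h1 := pathProb_le_sum (n := n) (t := t) (p := p)
      (Q := fun q => (∃ j ≤ n, (q (t + j)).1 ∉ boxAt (p t).1 B) ∧ freshCount q t n ≤ k) S
      (B := fun i q => (B : ℝ) ≤ i.2.1 * ((q (t + i.1)).1.1 - (p t).1.1 : ℝ) +
        i.2.2 * ((q (t + i.1)).1.2 - (p t).1.2 : ℝ) ∧ freshCount q t i.1 ≤ k) ?_
    · refine h1.trans ?_
      have h2 : ∀ i ∈ S, pathProb n t p (fun q => (B : ℝ) ≤
          i.2.1 * ((q (t + i.1)).1.1 - (p t).1.1 : ℝ) +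
          i.2.2 * ((q (t + i.1)).1.2 - (p t).1.2 : ℝ) ∧ freshCount q t i.1 ≤ k) ≤
          Real.exp (-u) := by
        rintro ⟨i, σ⟩ hi
        simp only [hS, Finset.mem_product, Finset.mem_range] at hi
        have hσ : σ ∈ dirs := by simpa [dirs] using hi.2
        obtain ⟨j, hj⟩ := Nat.exists_eq_add_of_le (show i ≤ n by omega)
        have hdet : pathProb n t p (fun q => (B : ℝ) ≤
            σ.1 * ((q (t + i)).1.1 - (p t).1.1 : ℝ) +
            σ.2 * ((q (t + i)).1.2 - (p t).1.2 : ℝ) ∧ freshCount q t i ≤ k) =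
            pathProb i t p (fun q => (B : ℝ) ≤
            σ.1 * ((q (t + i)).1.1 - (p t).1.1 : ℝ) +
            σ.2 * ((q (t + i)).1.2 - (p t).1.2 : ℝ) ∧ freshCount q t i ≤ k) := by
          conv_lhs => rw [hj]
          refine pathProb_add_of_determined fun q q' h => ?_
          rw [h _ le_rfl]
          have : freshCount q' t i = freshCount q t i := by
            unfold freshCount
            congr 1
            exact Finset.filter_congr fun l hl => freshLeft_congr fun s hs =>
              h s (by have := Finset.mem_range.1 hl; omega)
          rw [this]
        rw [hdet]
        refine (pathProb_displacement i t k p hσ (θ := 1 / u ^ 20) (by positivity) ?_).trans ?_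
        · rw [div_le_one (by positivity)]; exact hp1 20
        · apply Real.exp_le_exp.2
          have l1 : (i : ℝ) ≤ u ^ 40 := by rw [← hn]; exact_mod_cast (show i ≤ n by omega)
          have l2 : (i : ℝ) * (1 / u ^ 20) ^ 2 ≤ 1 := by
            rw [div_pow, one_pow, ← pow_mul, mul_one_div, div_le_one (by positivity)]
            exact l1
          have l3 : 1 / u ^ 20 * (u ^ 24 / 2) ≤ 1 / u ^ 20 * (B - k) := by
            gcongr; linarith [hp 22 24 (by norm_num), hp1 24]
          have l4 : 1 / u ^ 20 * (u ^ 24 / 2) = u ^ 4 / 2 := by field_simp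
          have := hp 1 4 (by norm_num)
          rw [pow_one] at this
          linarith
      refine (Finset.sum_le_card_nsmul _ _ _ h2).trans ?_
      rw [nsmul_eq_mul]
      have h3 : (S.card : ℝ) = 4 * (n + 1) := by
        rw [hS, Finset.card_product, Finset.card_range]
        rw [show Finset.card ({(1, 0), (-1, 0), (0, 1), (0, -1)} : Finset (ℤ × ℤ)) = 4 by rfl]
        push_cast; ring
      rw [h3, hn]
      have : 4 * (u ^ 40 + 1) ≤ 8 * u ^ 40 := by linarith [hp1 40]
      exact mul_le_mul_of_nonneg_right this (Real.exp_pos _).le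
    · rintro q hq ⟨⟨j, hj, hjB⟩, hfk⟩
      have hfj : freshCount q t j ≤ k := by
        refine le_trans ?_ hfk
        exact Finset.card_le_card (Finset.filter_subset_filter _ (by
          intro x hx; simp at *; omega))
      have hex : ∃ σ ∈ ({(1, 0), (-1, 0), (0, 1), (0, -1)} : Finset (ℤ × ℤ)),
          (B : ℤ) ≤ σ.1 * ((q (t + j)).1.1 - (p t).1.1) + σ.2 * ((q (t + j)).1.2 - (p t).1.2) := by
        rw [mem_boxAt, not_and_or, abs_le, abs_le] at hjB
        by_contra! hcon
        have c1 := hcon (1, 0) (by simp)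
        have c2 := hcon (-1, 0) (by simp)
        have c3 := hcon (0, 1) (by simp)
        have c4 := hcon (0, -1) (by simp)
        simp only [one_mul, zero_mul, add_zero, zero_add, neg_mul] at c1 c2 c3 c4
        omega
      obtain ⟨σ, hσ, hle⟩ := hex
      exact ⟨(j, σ), by simp only [hS, Finset.mem_product, Finset.mem_range]; exact ⟨by omega, hσ⟩,
        by exact_mod_cast hle, hfj⟩
  -- many fresh steps
  have t4 : pathProb n t p (fun q => ((q (t + n)).1.1 : ℝ) ≤ (p t).1.1 + u ^ 20 ∧
      k ≤ freshCount q t n) ≤ Real.exp (-u) := by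
    refine (pathProb_fresh_slow n t k p (θ := 1 / u ^ 20) (by positivity) ?_).trans ?_
    · rw [div_le_one (by positivity)]; exact hp1 20
    · apply Real.exp_le_exp.2
      have l2 : (n : ℝ) * (1 / u ^ 20) ^ 2 = 1 := by rw [hn]; field_simp
      have l3 : 1 / u ^ 20 * (u ^ 22 / 7 - u ^ 20) ≤ 1 / u ^ 20 * (k / 7 - u ^ 20) := by
        gcongr
      have l4 : 1 / u ^ 20 * (u ^ 22 / 7 - u ^ 20) = u ^ 2 / 7 - 1 := by field_simp
      have := hp 1 2 (by norm_num)
      rw [pow_one] at this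
      linarith
  have h := pathProb_le_add (n := n) (t := t) (p := p)
    (Q := fun q => (∀ j ≤ n, 0 < j → β < (q (t + j)).1.1) ∧
      ((q (t + n)).1.1 : ℝ) ≤ (p t).1.1 + u ^ 20)
    (Q₁ := fun q => ((rangeFrom q t n).card ≤ r ∧ freshCount q t n ≤ k) ∨
      ((∀ j ≤ n, (q (t + j)).1 ∈ boxAt (p t).1 B) ∧ (∀ j ≤ n, 0 < j → β < (q (t + j)).1.1) ∧
      r ≤ (rangeFrom q t n).card ∧ freshCount q t n ≤ k))
    (Q₂ := fun q => ((∃ j ≤ n, (q (t + j)).1 ∉ boxAt (p t).1 B) ∧ freshCount q t n ≤ k) ∨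
      (((q (t + n)).1.1 : ℝ) ≤ (p t).1.1 + u ^ 20 ∧ k ≤ freshCount q t n)) ?_
  · have h1 := pathProb_or_le n t p
      (fun q => (rangeFrom q t n).card ≤ r ∧ freshCount q t n ≤ k)
      (fun q => (∀ j ≤ n, (q (t + j)).1 ∈ boxAt (p t).1 B) ∧
        (∀ j ≤ n, 0 < j → β < (q (t + j)).1.1) ∧
        r ≤ (rangeFrom q t n).card ∧ freshCount q t n ≤ k)
    have h2 := pathProb_or_le n t p
      (fun q => (∃ j ≤ n, (q (t + j)).1 ∉ boxAt (p t).1 B) ∧ freshCount q t n ≤ k)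
      (fun q => ((q (t + n)).1.1 : ℝ) ≤ (p t).1.1 + u ^ 20 ∧ k ≤ freshCount q t n)
    have h3 : 3 * Real.exp (-u) ≤ 3 * u ^ 40 * Real.exp (-u) := by
      gcongr; linarith [hp1 40]
    have h4 : 0 ≤ u ^ 40 * Real.exp (-u) := by positivity
    linarith
  · rintro q hq ⟨h1, h2⟩
    by_cases hK : freshCount q t n ≤ k
    · by_cases hr : (rangeFrom q t n).card ≤ r
      · exact Or.inl (Or.inl ⟨hr, hK⟩)
      · by_cases hb : ∀ j ≤ n, (q (t + j)).1 ∈ boxAt (p t).1 B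
        · exact Or.inl (Or.inr ⟨hb, h1, by omega, hK⟩)
        · push Not at hb
          exact Or.inr (Or.inl ⟨hb, hK⟩)
    · exact Or.inr (Or.inr ⟨h2, by omega⟩)

/-- A walk in new columns is unlikely to stay within distance `√n` of its starting column. -/
lemma exists_pathProb_slow_le : ∃ C : ℝ, 1 ≤ C ∧ ∀ n : ℕ, 1 ≤ n → ∀ (t : ℕ) (p : JPath) (β : ℤ),
    (∀ s < t, (p s).1.1 ≤ β) →
    pathProb n t p (fun q => (∀ j ≤ n, 0 < j → β < (q (t + j)).1.1) ∧
      ((q (t + n)).1.1 : ℝ) ≤ (p t).1.1 + Real.sqrt n) ≤ C / (n : ℝ) ^ 11 := by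
  obtain ⟨u₀, hu₀⟩ := eventually_log_sq_le
  obtain ⟨K, hK, hKu⟩ := exists_pow_le_mul_exp 480
  set v := max u₀ 10000 with hv
  have hv1 : (1 : ℝ) ≤ v := le_trans (by norm_num) (le_max_right u₀ 10000)
  refine ⟨v ^ 440 + 12 * K, by have := one_le_pow₀ hv1 (n := 440); linarith, ?_⟩
  intro n hn t p β hβ
  have hn0 : (0 : ℝ) < n := by exact_mod_cast hn
  obtain ⟨u, hu0, hun⟩ : ∃ u : ℝ, 0 < u ∧ (n : ℝ) = u ^ 40 :=
    ⟨(n : ℝ) ^ ((1 : ℝ) / 40), by positivity, by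
      rw [← Real.rpow_natCast, ← Real.rpow_mul hn0.le]; norm_num⟩
  rw [le_div_iff₀ (by positivity), show (n : ℝ) ^ 11 = u ^ 440 by rw [hun, ← pow_mul]]
  rcases le_total v u with h | h
  · have hs : Real.sqrt n = u ^ 20 := by
      rw [hun, show u ^ 40 = (u ^ 20) ^ 2 by ring, Real.sqrt_sq (by positivity)]
    rw [hs]
    have h1 := pathProb_slow_le_of_large ((le_max_right _ _).trans h)
      (hu₀ u ((le_max_left _ _).trans h)) hun hβ
    calc _ ≤ 12 * u ^ 40 * Real.exp (-u) * u ^ 440 := by gcongr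
      _ = 12 * u ^ 480 * Real.exp (-u) := by ring
      _ ≤ 12 * (K * Real.exp u) * Real.exp (-u) := by gcongr; exact hKu u hu0.le
      _ = 12 * K * (Real.exp u * Real.exp (-u)) := by ring
      _ = 12 * K := by rw [← Real.exp_add]; simp
      _ ≤ v ^ 440 + 12 * K := by linarith [one_le_pow₀ hv1 (n := 440)]
  · have h1 := pathProb_le_one n t p (fun q => (∀ j ≤ n, 0 < j → β < (q (t + j)).1.1) ∧
      ((q (t + n)).1.1 : ℝ) ≤ (p t).1.1 + Real.sqrt n)
    have h2 : u ^ 440 ≤ v ^ 440 := pow_le_pow_left₀ hu0.le h 440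
    have h3 : 0 ≤ u ^ 440 := by positivity
    nlinarith

/-- Time `t` is the first time the first walk is in its current column or further right. -/
def StrictRecord (q : JPath) (t : ℕ) : Prop := ∀ s < t, (q s).1.1 < (q t).1.1

/-- The first walk moves right and up after time `t` and stays strictly right of its column at
time `t` for `n` steps. -/
def Survives (q : JPath) (t n : ℕ) : Prop :=
  (q (t + 1)).1 = (q t).1 + (1, 0) ∧ (q (t + 2)).1 = (q t).1 + (1, 1) ∧
    ∀ j ≤ n, 0 < j → (q t).1.1 < (q (t + j)).1.1

/-- Time `t` separates past and future of the first walk up to time `t + n`. -/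
def RegenAt (q : JPath) (t n : ℕ) : Prop := StrictRecord q t ∧ Survives q t n

lemma Survives.mono {q : JPath} {t n m : ℕ} (h : Survives q t n) (hm : m ≤ n) : Survives q t m :=
  ⟨h.1, h.2.1, fun j hj => h.2.2 j (hj.trans hm)⟩

lemma Survives.survives_or_return {q : JPath} {t L : ℕ} (hs : Survives q t L) (n : ℕ) :
    Survives q t n ∨ ∃ s, L ≤ s ∧ s < n ∧
      (∀ j ≤ s, 0 < j → (q t).1.1 < (q (t + j)).1.1) ∧ (q (t + (s + 1))).1.1 ≤ (q t).1.1 := by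
  by_contra! hcon
  refine hcon.1 ⟨hs.1, hs.2.1, fun j hj hj0 => ?_⟩
  induction j using Nat.strong_induction_on with
  | _ j ih =>
    rcases le_or_gt j L with hjL | hjL
    · exact hs.2.2 j hjL hj0
    · have := hcon.2 (j - 1) (by omega) (by omega) fun i hi hi0 =>
        ih i (by omega) (by omega) hi0
      rwa [show j - 1 + 1 = j by omega] at this

lemma strictRecord_congr {q q' : JPath} {t : ℕ} (h : ∀ s ≤ t, q' s = q s) :
    StrictRecord q' t ↔ StrictRecord q t := by
  unfold StrictRecord
  rw [h t le_rfl]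
  exact forall₂_congr fun s hs => by rw [h s hs.le]

lemma survives_congr {q q' : JPath} {t n : ℕ} (hn : 2 ≤ n) (h : ∀ s ≤ t + n, q' s = q s) :
    Survives q' t n ↔ Survives q t n := by
  unfold Survives
  rw [h t (by omega), h (t + 1) (by omega), h (t + 2) (by omega)]
  refine and_congr_right fun _ => and_congr_right fun _ => forall₂_congr fun j hj => ?_
  rw [h (t + j) (by omega)]

lemma RegenAt.freshLeft {q : JPath} {t n : ℕ} (h : RegenAt q t n) : FreshLeft (t + 2) q := by
  obtain ⟨h0, h1, h2, -⟩ := h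
  intro s hs hc
  rw [h2] at hc
  have hc1 : (q s).1.1 = (q t).1.1 := by rw [hc]; simp
  have hc2 : (q s).1.2 = (q t).1.2 + 1 := by rw [hc]; simp
  rcases Nat.lt_or_ge s t with hlt | hge
  · have := h0 s hlt; omega
  · obtain rfl | rfl | rfl : s = t ∨ s = t + 1 ∨ s = t + 2 := by omega
    · omega
    · rw [h1] at hc1; simp at hc1
    · rw [h2] at hc1; simp at hc1

lemma sum_inv_pow_le (C : ℝ) (hC : 0 ≤ C) {l : ℕ} (hl : 1 ≤ l) (n : ℕ) :
    ∑ s ∈ Finset.Ico l n, C / (s : ℝ) ^ 11 ≤ 2 * C / (l : ℝ) ^ 9 := by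
  have hl0 : (0 : ℝ) < l := by exact_mod_cast hl
  have h1 : ∑ s ∈ Finset.Ico l n, C / (s : ℝ) ^ 11 ≤
      ∑ s ∈ Finset.Ioo (l - 1) n, C / (l : ℝ) ^ 9 * ((s : ℝ) ^ 2)⁻¹ := by
    rw [show Finset.Ico l n = Finset.Ioo (l - 1) n by ext; simp; omega]
    refine Finset.sum_le_sum fun s hs => ?_
    have hs' : (l : ℝ) ≤ s := by
      have := (Finset.mem_Ioo.1 hs).1
      exact_mod_cast (show l ≤ s by omega)
    rw [← div_eq_mul_inv, div_div]
    have hs0 : (0 : ℝ) < s := hl0.trans_le hs'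
    refine div_le_div_of_nonneg_left hC (by positivity) ?_
    calc (l : ℝ) ^ 9 * (s : ℝ) ^ 2 ≤ (s : ℝ) ^ 9 * (s : ℝ) ^ 2 := by gcongr
      _ = (s : ℝ) ^ 11 := by ring
  refine h1.trans ?_
  rw [← Finset.mul_sum]
  have h2 := sum_Ioo_inv_sq_le (α := ℝ) (l - 1) n
  have h3 : (2 : ℝ) / ((l - 1 : ℕ) + 1) ≤ 2 := by
    rw [div_le_iff₀ (by positivity)]
    linarith [Nat.cast_nonneg (α := ℝ) (l - 1)]
  calc _ ≤ C / (l : ℝ) ^ 9 * 2 := by gcongr; exact h2.trans h3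
    _ = _ := by ring

/-- Late returns to the starting column are unlikely. -/
lemma exists_pathProb_return_le : ∃ C : ℝ, 1 ≤ C ∧ ∀ l : ℕ, 1 ≤ l → ∀ (n t : ℕ) (p : JPath),
    StrictRecord p t →
    pathProb n t p (fun q => ∃ s, l ≤ s ∧ s < n ∧ (∀ j ≤ s, 0 < j → (q t).1.1 < (q (t + j)).1.1) ∧
      (q (t + (s + 1))).1.1 ≤ (q t).1.1) ≤ C / (l : ℝ) ^ 9 := by
  obtain ⟨C, hC, h⟩ := exists_pathProb_slow_le
  refine ⟨2 * C, by linarith, fun l hl n t p hp => ?_⟩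
  refine (pathProb_le_sum (Finset.Ico l n) (B := fun s q =>
    (∀ j ≤ s, 0 < j → (p t).1.1 < (q (t + j)).1.1) ∧
      ((q (t + s)).1.1 : ℝ) ≤ (p t).1.1 + Real.sqrt s) ?_).trans
    ((Finset.sum_le_sum fun s hs => ?_).trans (sum_inv_pow_le C (by linarith) hl n))
  · rintro q hq ⟨s, hls, hsn, h1, h2⟩
    rw [hq.1 t le_rfl] at h1 h2
    refine ⟨s, Finset.mem_Ico.2 ⟨hls, hsn⟩, h1, ?_⟩
    have h3 := (hq.abs_sub_le (show s ≤ s + 1 by omega) (by omega)).1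
    have h4 : (q (t + s)).1.1 ≤ (p t).1.1 + 1 := by
      rw [abs_le] at h3; push_cast at h3; omega
    have h5 : (1 : ℝ) ≤ Real.sqrt s := by
      rw [Real.one_le_sqrt]; exact_mod_cast hl.trans hls
    have h6 : ((q (t + s)).1.1 : ℝ) ≤ (p t).1.1 + 1 := by exact_mod_cast h4
    linarith
  · obtain ⟨hls, hsn⟩ := Finset.mem_Ico.1 hs
    obtain ⟨k, rfl⟩ := Nat.exists_eq_add_of_le hsn.le
    rw [pathProb_add_of_determined]
    · exact h s (by omega) t p _ fun r hr => (hp r hr).le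
    · intro q q' hq
      rw [hq _ le_rfl]
      refine and_congr_left fun _ => forall₂_congr fun j hj => ?_
      rw [hq (t + j) (by omega)]

lemma quarter_le_stepMean {c : Prop} {g : ℤ × ℤ → ℤ × ℤ → ℝ} (hg : ∀ a b, 0 ≤ g a b) :
    1 / 4 * g (1, 0) (1, 0) ≤ stepMean c g ∧ 1 / 4 * g (0, 1) (0, 1) ≤ stepMean c g := by
  have h1 := hg (-1, 0) (-1, 0)
  have h2 := hg (1, 0) (1, 0)
  have h3 := hg (0, 1) (0, 1)
  have h4 := hg (0, -1) (0, -1)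
  have h5 := hg (1, 0) (-1, 0)
  have h6 := hg (0, 1) (-1, 0)
  have h7 := hg (0, -1) (-1, 0)
  unfold stepMean
  split_ifs <;> constructor <;> linarith

lemma le_pathMean_survives (n t : ℕ) (p : JPath) :
    1 / 16 ≤ pathMean (n + 2) t p (fun q => if Survives q t (n + 2) then
      ((q (t + (n + 2))).1.1 - (q t).1.1 : ℝ) else 0) := by
  have hF : ∀ (n : ℕ) (q : JPath), 0 ≤ (if Survives q t (n + 2) then
      ((q (t + (n + 2))).1.1 - (q t).1.1 : ℝ) else 0) := by
    intro n q
    split_ifs with h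
    · have h1 : (q t).1.1 < (q (t + (n + 2))).1.1 := h.2.2 (n + 2) le_rfl (by omega)
      have h2 : ((q t).1.1 : ℝ) < (q (t + (n + 2))).1.1 := by exact_mod_cast h1
      linarith
    · exact le_rfl
  induction n with
  | zero =>
    simp only [pathMean]
    refine le_trans ?_ (quarter_le_stepMean fun a b => ?_).1
    · have := (quarter_le_stepMean (c := FreshLeft (t + 1) (addStep p t (1, 0) (1, 0)))
        (fun a b => hF 0 (addStep (addStep p t (1, 0) (1, 0)) (t + 1) a b))).2
      refine le_trans ?_ (mul_le_mul_of_nonneg_left this (by norm_num))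
      have e0 : addStep (addStep p t (1, 0) (1, 0)) (t + 1) (0, 1) (0, 1) t = p t := by
        rw [addStep_apply_of_le (by omega), addStep_apply_self]
      have e1 : (addStep (addStep p t (1, 0) (1, 0)) (t + 1) (0, 1) (0, 1) (t + 1)).1 =
          (p t).1 + (1, 0) := by
        rw [addStep_apply_self, addStep_apply_succ]
      have e2 : (addStep (addStep p t (1, 0) (1, 0)) (t + 1) (0, 1) (0, 1) (t + 2)).1 =
          (p t).1 + (1, 1) := by
        rw [show t + 2 = t + 1 + 1 by ring, addStep_apply_succ, addStep_apply_succ, add_assoc]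
        rfl
      rw [if_pos]
      · simp only [zero_add]
        rw [e0, e2]
        simp; norm_num
      · refine ⟨by rw [e1, e0], by rw [e2, e0], fun j hj hj' => ?_⟩
        rw [e0]
        obtain rfl | rfl : j = 1 ∨ j = 2 := by omega
        · rw [e1]; simp
        · rw [e2]; simp
    · refine le_trans ?_ (quarter_le_stepMean fun a b => hF 0 _).1
      exact mul_nonneg (by norm_num) (hF 0 _)
  | succ n ih =>
    rw [show n + 1 + 2 = n + 2 + 1 by ring, pathMean_succ_right]
    refine ih.trans (pathMean_mono fun q hq => ?_)
    set q' := fun a b => addStep q (t + (n + 2)) a b with hq'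
    by_cases hs : Survives q t (n + 2)
    · rw [if_pos hs]
      have h1 : stepMean (FreshLeft (t + (n + 2)) q) (fun a _ =>
          ((q (t + (n + 2))).1.1 - (q t).1.1 : ℝ) + a.1) ≤
          stepMean (FreshLeft (t + (n + 2)) q) (fun a b =>
            if Survives (q' a b) t (n + 2 + 1) then
            ((q' a b (t + (n + 2 + 1))).1.1 - (q' a b t).1.1 : ℝ) else 0) := by
        refine stepMean_mono fun a b _ => ?_
        have e0 : q' a b t = q t := addStep_apply_of_le (by omega) a b
        have e1 : (q' a b (t + (n + 2 + 1))).1.1 = (q (t + (n + 2))).1.1 + a.1 := by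
          rw [← add_assoc t, hq']; simp
        rw [e0, e1]
        split_ifs with h
        · push_cast; linarith
        · have h2 : ¬ (q t).1.1 < (q (t + (n + 2))).1.1 + a.1 := by
            intro h3
            refine h ⟨?_, ?_, fun j hj hj' => ?_⟩
            · rw [e0]; simp only [hq']; rw [addStep_apply_of_le (by omega)]; exact hs.1
            · rw [e0]; simp only [hq']; rw [addStep_apply_of_le (by omega)]; exact hs.2.1
            · rw [e0]
              rcases Nat.lt_or_ge (n + 2) j with hlt | hge
              · obtain rfl : j = n + 2 + 1 := by omega
                rw [e1]; exact h3
              · simp only [hq']; rw [addStep_apply_of_le (by omega)]; exact hs.2.2 j hge hj'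
          have h3 : ((q (t + (n + 2))).1.1 : ℝ) + a.1 ≤ (q t).1.1 := by
            exact_mod_cast not_lt.1 h2
          linarith
      refine le_trans ?_ h1
      unfold stepMean
      split_ifs <;> push_cast <;> linarith
    · rw [if_neg hs]
      exact (stepMean_const (FreshLeft (t + (n + 2)) q) 0).symm.le.trans
        (stepMean_mono fun a b _ => hF (n + 1) _)

lemma le_pathProb_survives {n : ℕ} (hn : 2 ≤ n) (t : ℕ) (p : JPath) :
    1 / (16 * n : ℝ) ≤ pathProb n t p (fun q => Survives q t n) := by
  obtain ⟨k, rfl⟩ := Nat.exists_eq_add_of_le' hn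
  have h := le_pathMean_survives k t p
  have h1 : pathMean (k + 2) t p (fun q => if Survives q t (k + 2) then
      ((q (t + (k + 2))).1.1 - (q t).1.1 : ℝ) else 0) ≤
      ((k + 2 : ℕ) : ℝ) * pathProb (k + 2) t p (fun q => Survives q t (k + 2)) := by
    unfold pathProb
    rw [← pathMean_const_mul]
    refine pathMean_mono fun q hq => ?_
    split_ifs
    · have h3 := (abs_le.1 (hq.abs_sub_le (Nat.zero_le (k + 2)) le_rfl).1).2
      rw [add_zero] at h3
      have : ((q (t + (k + 2))).1.1 - (q t).1.1 : ℝ) ≤ ((k + 2 : ℕ) : ℝ) - (0 : ℕ) := by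
        exact_mod_cast h3
      simpa using this
    · simp
  rw [div_le_iff₀ (by positivity)]
  linarith

/-- From a strict record, the walk survives any number of steps with probability bounded
below. -/
lemma exists_le_pathProb_survives : ∃ p₀ : ℝ, 0 < p₀ ∧ p₀ ≤ 1 ∧ ∀ n : ℕ, 2 ≤ n →
    ∀ (t : ℕ) (p : JPath), StrictRecord p t → p₀ ≤ pathProb n t p (fun q => Survives q t n) := by
  obtain ⟨C, hC, h⟩ := exists_pathProb_return_le
  set L := ⌈32 * C⌉₊ + 2
  have hLC : 32 * C ≤ (L : ℝ) := (Nat.le_ceil _).trans (by simp [L])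
  have hL2 : 2 ≤ L := by omega
  have hL0 : (1 : ℝ) ≤ L := by exact_mod_cast (show 1 ≤ L by omega)
  have hL : C / (L : ℝ) ^ 9 ≤ 1 / (32 * L) := by
    rw [div_le_div_iff₀ (by positivity) (by positivity)]
    calc C * (32 * L) = (32 * C) * L := by ring
      _ ≤ L * L := by gcongr
      _ = (L : ℝ) ^ 2 := by ring
      _ ≤ 1 * (L : ℝ) ^ 9 := by rw [one_mul]; exact pow_le_pow_right₀ hL0 (by norm_num)
  refine ⟨1 / (32 * L), by positivity, ?_, fun n hn t p hp => ?_⟩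
  · rw [div_le_one (by positivity)]; linarith
  have hdet : ∀ (m k : ℕ), 2 ≤ m → pathProb (m + k) t p (fun q => Survives q t m) =
      pathProb m t p (fun q => Survives q t m) := fun m k hm =>
    pathProb_add_of_determined fun q q' hq => survives_congr hm hq
  have h0 := le_pathProb_survives hL2 t p
  have h16 : 1 / (16 * L : ℝ) = 1 / (32 * L) + 1 / (32 * L) := by field_simp; norm_num
  have hpos : 0 < 1 / (32 * L : ℝ) := by positivity
  rcases le_total n L with hnL | hnL
  · obtain ⟨k, hk⟩ := Nat.exists_eq_add_of_le hnL
    rw [← hdet n k hn, ← hk]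
    have := pathProb_mono (n := L) (t := t) (p := p) (Q := fun q => Survives q t L)
      (Q' := fun q => Survives q t n) fun q _ hq => hq.mono hnL
    linarith
  · obtain ⟨k, rfl⟩ := Nat.exists_eq_add_of_le hnL
    rw [← hdet L k hL2] at h0
    have h1 := pathProb_le_add (n := L + k) (t := t) (p := p) (Q := fun q => Survives q t L)
      (Q₁ := fun q => Survives q t (L + k)) (Q₂ := fun q => ∃ s, L ≤ s ∧ s < L + k ∧
        (∀ j ≤ s, 0 < j → (q t).1.1 < (q (t + j)).1.1) ∧ (q (t + (s + 1))).1.1 ≤ (q t).1.1) ?_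
    · have := h L (by omega) (L + k) t p hp
      linarith
    · exact fun q hq hs => hs.survives_or_return _

/-- A walk that advances by `J * (l + 1)` columns has about `J` independent chances to
regenerate. -/
lemma pathProb_noRegen_le {p₀ r : ℝ} {l : ℕ} (hl : 1 ≤ l) (hp₁ : p₀ ≤ 1) (hp₂ : 0 ≤ p₀)
    (hp₀ : ∀ n : ℕ, 2 ≤ n → ∀ (t : ℕ) (p : JPath), StrictRecord p t →
      p₀ ≤ pathProb n t p (fun q => Survives q t n))
    (hr₀ : 0 ≤ r)
    (hr : ∀ (n t : ℕ) (p : JPath), StrictRecord p t →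
      pathProb n t p (fun q => ∃ s, l ≤ s ∧ s < n ∧
        (∀ j ≤ s, 0 < j → (q t).1.1 < (q (t + j)).1.1) ∧
        (q (t + (s + 1))).1.1 ≤ (q t).1.1) ≤ r)
    (J : ℕ) : ∀ (t m n : ℕ) (p : JPath), m + 2 ≤ n → StrictRecord p t →
      pathProb n t p (fun q => (∀ j ≤ m, ¬ RegenAt q (t + j) (n - j)) ∧
        ∃ i ≤ m, (q t).1.1 + J * (l + 1) ≤ (q (t + i)).1.1) ≤ (1 - p₀) ^ J + J * r := by
  induction J with
  | zero =>
    intro t m n p _ _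
    simpa using pathProb_le_one n t p _
  | succ J ih =>
    intro t m n p hmn hp
    set Ret : JPath → Prop := fun q => ∃ s, l ≤ s ∧ s < n ∧
        (∀ j ≤ s, 0 < j → (q t).1.1 < (q (t + j)).1.1) ∧
        (q (t + (s + 1))).1.1 ≤ (q t).1.1 with hRet
    set Q : JPath → Prop := fun q => (∀ j ≤ m, ¬ RegenAt q (t + j) (n - j)) ∧
        ∃ i ≤ m, (q t).1.1 + ((J + 1 : ℕ) : ℤ) * (l + 1) ≤ (q (t + i)).1.1 with hQdef
    have hβ : 0 ≤ (1 - p₀) ^ J + J * r := by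
      have : 0 ≤ 1 - p₀ := by linarith
      positivity
    have hmain : pathProb n t p (fun q => Q q ∧ ¬ Ret q) ≤
        ((1 - p₀) ^ J + J * r) * pathProb n t p (fun q => ¬ Survives q t n) := by
      refine pathProb_le_mul_of_time
        (A := fun i q => (q t).1.1 + (l + 1) ≤ (q (t + i)).1.1 ∧
          (∀ j < i, (q (t + j)).1.1 < (q t).1.1 + (l + 1)) ∧ ¬ Survives q t i ∧ i ≤ m ∧ l + 1 ≤ i)
        (B := fun i q => (∀ j ≤ m - i, ¬ RegenAt q (t + i + j) (n - i - j)) ∧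
          ∃ i' ≤ m - i, (q (t + i)).1.1 + J * (l + 1) ≤ (q (t + i + i')).1.1) hβ ?_ ?_ ?_ ?_ ?_
      · intro i hi q q' hq
        by_cases hli : l + 1 ≤ i
        · rw [hq t (by omega), hq _ le_rfl, survives_congr (by omega) hq]
          refine and_congr_right fun _ => and_congr_left fun _ => forall₂_congr fun j hj => ?_
          rw [hq _ (by omega)]
        · simp [hli]
      · rintro q i - j - ⟨h1, h2, -⟩ ⟨h3, h4, -⟩
        by_contra hij
        rcases Nat.lt_or_gt_of_ne hij with h | h
        · have := h4 i h; omega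
        · have := h2 j h; omega
      · rintro q hq ⟨⟨h1, i₀, hi₀, h2⟩, h3⟩
        have hJ : (0 : ℤ) ≤ (J : ℤ) * (l + 1) := by positivity
        have h2' : (q t).1.1 + (l + 1) + J * (l + 1) ≤ (q (t + i₀)).1.1 := by
          push_cast at h2; linarith
        have hex : ∃ i, (q t).1.1 + (l + 1) ≤ (q (t + i)).1.1 := ⟨i₀, by omega⟩
        set i := Nat.find hex with hi
        have hfi : (q t).1.1 + (l + 1) ≤ (q (t + i)).1.1 := Nat.find_spec hex
        have hlt : ∀ j < i, (q (t + j)).1.1 < (q t).1.1 + (l + 1) := fun j hj =>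
          not_le.1 (Nat.find_min hex hj)
        have hii : i ≤ i₀ := Nat.find_min' hex (by omega)
        have hli : l + 1 ≤ i := by
          have := (abs_le.1 (hq.abs_sub_le (Nat.zero_le i) (by omega)).1).2
          rw [add_zero] at this
          push_cast at this
          omega
        refine ⟨i, by omega, ⟨hfi, hlt, fun hs => ?_, by omega, hli⟩, fun j hj => ?_,
          i₀ - i, by omega, ?_⟩
        · rcases hs.survives_or_return n with hs' | ⟨s, hs1, hs2⟩
          · refine h1 0 (by omega) ⟨?_, by simpa using hs'⟩
            exact (strictRecord_congr hq.1).2 hp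
          · exact h3 ⟨s, by omega, hs2⟩
        · have := h1 (i + j) (by omega)
          rwa [← add_assoc, ← Nat.sub_sub] at this
        · have h5 := hlt (i - 1) (by omega)
          have h6 := (abs_le.1 (hq.abs_sub_le (show i - 1 ≤ i by omega) (by omega)).1).2
          rw [show t + i + (i₀ - i) = t + i₀ by omega]
          push_cast [show 1 ≤ i by omega] at h6
          linarith
      · rintro q - i hi ⟨-, -, h, -⟩ h'
        exact h (h'.mono hi)
      · rintro i hi q hq ⟨h1, h2, -, hm, hli⟩
        refine ih (t + i) (m - i) (n - i) q (by omega) fun s hs => ?_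
        rcases Nat.lt_or_ge s t with h | h
        · have h3 := hp s h
          rw [← hq.1 s h.le, ← hq.1 t le_rfl] at h3
          omega
        · have := h2 (s - t) (by omega)
          rw [Nat.add_sub_cancel' h] at this
          omega
    have hsplit := pathProb_le_add (n := n) (t := t) (p := p) (Q := Q)
      (Q₁ := fun q => Q q ∧ ¬ Ret q) (Q₂ := Ret) fun q _ h => by
        by_cases h' : Ret q
        · exact Or.inr h'
        · exact Or.inl ⟨h, h'⟩
    have h1 := hr n t p hp
    have h2 : pathProb n t p (fun q => ¬ Survives q t n) ≤ 1 - p₀ := by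
      rw [pathProb_not]
      linarith [hp₀ n (by omega) t p hp]
    have h3 := mul_le_mul_of_nonneg_left h2 hβ
    have h4 : 0 ≤ p₀ * (J * r) := by positivity
    rw [pow_succ]
    push_cast
    linarith

/-- A walk in new columns is unlikely not to regenerate. -/
lemma exists_pathProb_noRegen_le : ∃ C : ℝ, 1 ≤ C ∧ ∀ (m n t : ℕ) (p : JPath) (β : ℤ), 1 ≤ m →
    m + 2 ≤ n → (∀ s < t, (p s).1.1 ≤ β) → β ≤ (p t).1.1 →
    pathProb n t p (fun q => (∀ j ≤ m, 0 < j → β < (q (t + j)).1.1) ∧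
      ∀ j ≤ m, 0 < j → ¬ RegenAt q (t + j) (n - j)) ≤ C / (m : ℝ) ^ 2 := by
  obtain ⟨C₁, hC₁, hslow⟩ := exists_pathProb_slow_le
  obtain ⟨C₂, hC₂, hret⟩ := exists_pathProb_return_le
  obtain ⟨p₀, hp0, hp1, hsurv⟩ := exists_le_pathProb_survives
  obtain ⟨K, hK, hKu⟩ := exists_pow_le_mul_exp 8
  set K' := K / p₀ ^ 8 with hK'
  have hK'0 : 0 < K' := by positivity
  refine ⟨256 + C₁ + 6561 * (K' + C₂), by linarith, ?_⟩
  intro m n t p β hm hmn hβ hβt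
  have hm0 : (1 : ℝ) ≤ m := by exact_mod_cast hm
  set Q : JPath → Prop := fun q => (∀ j ≤ m, 0 < j → β < (q (t + j)).1.1) ∧
      ∀ j ≤ m, 0 < j → ¬ RegenAt q (t + j) (n - j)
  set a := Nat.sqrt m
  set w := Nat.sqrt a
  have ha1 : a ^ 2 ≤ m := Nat.sqrt_le' m
  have ha2 : m < (a + 1) ^ 2 := Nat.lt_succ_sqrt' m
  have hw1 : w ^ 2 ≤ a := Nat.sqrt_le' a
  have hw2 : a + 1 ≤ (w + 1) ^ 2 := Nat.lt_succ_sqrt' a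
  have hmw : m < (w + 1) ^ 4 := by
    calc m < (a + 1) ^ 2 := ha2
      _ ≤ ((w + 1) ^ 2) ^ 2 := Nat.pow_le_pow_left hw2 2
      _ = _ := by ring
  rw [le_div_iff₀ (by positivity)]
  rcases Nat.lt_or_ge w 2 with hw | hw
  · have h1 := pathProb_le_one n t p Q
    have h2 : m < 16 := hmw.trans_le ((Nat.pow_le_pow_left (show w + 1 ≤ 2 by omega) 4))
    have h3 : (m : ℝ) ≤ 16 := by exact_mod_cast h2.le
    have h4 : (m : ℝ) ^ 2 ≤ 256 := by nlinarith
    have h5 := mul_le_mul h1 h4 (by positivity) zero_le_one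
    linarith
  · obtain ⟨J, hwJ⟩ : ∃ J, w = J + 1 := ⟨w - 1, by omega⟩
    have hJ1 : 1 ≤ J := by omega
    have hJ0 : (1 : ℝ) ≤ J := by exact_mod_cast hJ1
    have hr₀ : 0 ≤ C₂ / (J : ℝ) ^ 9 := by positivity
    have hβ' : 0 ≤ (1 - p₀) ^ J + J * (C₂ / (J : ℝ) ^ 9) := by
      have : 0 ≤ 1 - p₀ := by linarith
      positivity
    have hmain : pathProb n t p (fun q => Q q ∧
        ((p t).1.1 : ℝ) + Real.sqrt m < (q (t + m)).1.1) ≤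
        ((1 - p₀) ^ J + J * (C₂ / (J : ℝ) ^ 9)) * pathProb n t p (fun _ => True) := by
      refine pathProb_le_mul_of_time
        (A := fun i q => (q t).1.1 + 1 ≤ (q (t + i)).1.1 ∧
          (∀ j < i, (q (t + j)).1.1 < (q t).1.1 + 1) ∧ i ≤ m)
        (B := fun i q => (∀ j ≤ m - i, ¬ RegenAt q (t + i + j) (n - i - j)) ∧
          ∃ i' ≤ m - i, (q (t + i)).1.1 + J * (J + 1) ≤ (q (t + i + i')).1.1) hβ' ?_ ?_ ?_ ?_ ?_
      · intro i hi q q' hq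
        rw [hq t (by omega), hq _ le_rfl]
        refine and_congr_right fun _ => and_congr_left fun _ => forall₂_congr fun j hj => ?_
        rw [hq _ (by omega)]
      · rintro q i - j - ⟨h1, h2, -⟩ ⟨h3, h4, -⟩
        by_contra hij
        rcases Nat.lt_or_gt_of_ne hij with h | h
        · have := h4 i h; omega
        · have := h2 j h; omega
      · rintro q hq ⟨⟨-, h1⟩, h3⟩
        have hs : ((w ^ 2 : ℕ) : ℝ) ≤ Real.sqrt m := by
          refine le_trans ?_ Real.nat_sqrt_le_real_sqrt
          exact_mod_cast hw1
        have h2 : (q t).1.1 + ((w ^ 2 : ℕ) : ℤ) < (q (t + m)).1.1 := by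
          have : ((q t).1.1 : ℝ) + ((w ^ 2 : ℕ) : ℝ) < (q (t + m)).1.1 := by
            rw [hq.1 t le_rfl]; linarith
          exact_mod_cast this
        rw [hwJ] at h2
        push_cast at h2
        have hex : ∃ i, (q t).1.1 + 1 ≤ (q (t + i)).1.1 := ⟨m, by nlinarith⟩
        set i := Nat.find hex with hi
        have hfi : (q t).1.1 + 1 ≤ (q (t + i)).1.1 := Nat.find_spec hex
        have hlt : ∀ j < i, (q (t + j)).1.1 < (q t).1.1 + 1 := fun j hj =>
          not_le.1 (Nat.find_min hex hj)
        have hii : i ≤ m := Nat.find_min' hex (by nlinarith)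
        have hi1 : 1 ≤ i := by
          by_contra! h
          rw [show i = 0 by omega, add_zero] at hfi
          omega
        refine ⟨i, by omega, ⟨hfi, hlt, hii⟩, fun j hj => ?_, m - i, le_rfl, ?_⟩
        · have := h1 (i + j) (by omega) (by omega)
          rwa [← add_assoc, ← Nat.sub_sub] at this
        · have h5 := hlt (i - 1) (by omega)
          have h6 := (abs_le.1 (hq.abs_sub_le (show i - 1 ≤ i by omega) (by omega)).1).2
          rw [show t + i + (m - i) = t + m by omega]
          push_cast [show 1 ≤ i by omega] at h6
          nlinarith
      · exact fun _ _ _ _ _ => trivial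
      · rintro i hi q hq ⟨h1, h2, him⟩
        refine pathProb_noRegen_le hJ1 hp1 hp0.le hsurv hr₀ (hret J hJ1) J (t + i) (m - i) (n - i) q
          (by omega) fun s hs => ?_
        rcases Nat.lt_or_ge s t with h | h
        · have h3 := hβ s h
          rw [← hq.1 s h.le] at h3
          rw [← hq.1 t le_rfl] at hβt
          omega
        · have := h2 (s - t) (by omega)
          rw [Nat.add_sub_cancel' h] at this
          omega
    have hslow' : pathProb n t p (fun q => (∀ j ≤ m, 0 < j → β < (q (t + j)).1.1) ∧
        ((q (t + m)).1.1 : ℝ) ≤ (p t).1.1 + Real.sqrt m) ≤ C₁ / (m : ℝ) ^ 11 := by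
      obtain ⟨k, rfl⟩ := Nat.exists_eq_add_of_le (show m ≤ n by omega)
      rw [pathProb_add_of_determined]
      · exact hslow m hm t p β hβ
      · intro q q' hq
        rw [hq _ le_rfl]
        refine and_congr_left fun _ => forall₂_congr fun j hj => ?_
        rw [hq (t + j) (by omega)]
    have hsplit := pathProb_le_add (n := n) (t := t) (p := p) (Q := Q)
      (Q₁ := fun q => (∀ j ≤ m, 0 < j → β < (q (t + j)).1.1) ∧
        ((q (t + m)).1.1 : ℝ) ≤ (p t).1.1 + Real.sqrt m)
      (Q₂ := fun q => Q q ∧ ((p t).1.1 : ℝ) + Real.sqrt m < (q (t + m)).1.1) fun q _ h => by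
        rcases le_or_gt ((q (t + m)).1.1 : ℝ) ((p t).1.1 + Real.sqrt m) with h' | h'
        · exact Or.inl ⟨h.1, h'⟩
        · exact Or.inr ⟨h, h'⟩
    have hone := mul_le_mul_of_nonneg_left (pathProb_le_one n t p fun _ => True) hβ'
    have hpow : (1 - p₀) ^ J ≤ K' / (J : ℝ) ^ 8 := by
      have e1 : (1 - p₀) ^ J ≤ Real.exp (-(p₀ * J)) := by
        rw [show -(p₀ * (J : ℝ)) = J * (-p₀) by ring, Real.exp_nat_mul]
        exact pow_le_pow_left₀ (by linarith) (Real.one_sub_le_exp_neg p₀) J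
      have e2 := hKu (p₀ * J) (by positivity)
      refine e1.trans ?_
      rw [Real.exp_neg, hK', div_div, inv_eq_one_div, div_le_div_iff₀ (by positivity) (by positivity),
        one_mul, ← mul_pow]
      exact e2
    have hJr : J * (C₂ / (J : ℝ) ^ 9) = C₂ / (J : ℝ) ^ 8 := by field_simp
    have hm2 : (m : ℝ) ^ 2 ≤ 6561 * (J : ℝ) ^ 8 := by
      have e1 : (m : ℝ) ≤ (3 * J : ℝ) ^ 4 := by
        have : m ≤ (3 * J) ^ 4 := hmw.le.trans (Nat.pow_le_pow_left (by omega) 4)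
        exact_mod_cast this
      calc (m : ℝ) ^ 2 ≤ ((3 * J : ℝ) ^ 4) ^ 2 := by gcongr
        _ = _ := by ring
    have hm11 : C₁ / (m : ℝ) ^ 11 * (m : ℝ) ^ 2 ≤ C₁ := by
      rw [div_mul_eq_mul_div, div_le_iff₀ (by positivity)]
      gcongr
      norm_num
    have hfin : (K' / (J : ℝ) ^ 8 + C₂ / (J : ℝ) ^ 8) * (m : ℝ) ^ 2 ≤ 6561 * (K' + C₂) := by
      rw [← add_div, div_mul_eq_mul_div, div_le_iff₀ (by positivity)]
      calc (K' + C₂) * (m : ℝ) ^ 2 ≤ (K' + C₂) * (6561 * (J : ℝ) ^ 8) := by gcongr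
        _ = _ := by ring
    rw [hJr] at hmain hone
    have htot : pathProb n t p Q ≤
        C₁ / (m : ℝ) ^ 11 + (K' / (J : ℝ) ^ 8 + C₂ / (J : ℝ) ^ 8) := by linarith
    have := mul_le_mul_of_nonneg_right htot (show (0 : ℝ) ≤ (m : ℝ) ^ 2 by positivity)
    rw [add_mul] at this
    linarith

/-- A time window of length `m` is unlikely to contain no regeneration. -/
lemma exists_pathProb_window_le : ∃ C : ℝ, 1 ≤ C ∧ ∀ (a m n : ℕ) (p : JPath), 1 ≤ m →
    a + m + 2 ≤ n →
    pathProb n 0 p (fun q => ∀ j ≤ a + m, a < j → ¬ RegenAt q j (n - j)) ≤ C / m := by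
  obtain ⟨C, hC, h⟩ := exists_pathProb_noRegen_le
  refine ⟨3 * C, by linarith, fun a m n p hm hn => ?_⟩
  have hm0 : (1 : ℝ) ≤ m := by exact_mod_cast hm
  have h1 := pathProb_le_add (n := n) (t := 0) (p := p)
    (Q := fun q => ∀ j ≤ a + m, a < j → ¬ RegenAt q j (n - j))
    (Q₁ := fun q => (∀ j ≤ a + m, 0 < j → (p 0).1.1 - (a + m) - 1 < (q (0 + j)).1.1) ∧
      ∀ j ≤ a + m, 0 < j → ¬ RegenAt q (0 + j) (n - j))
    (Q₂ := fun q => ∃ i ∈ Finset.range (a + 1), StrictRecord q i ∧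
      (∀ j ≤ a + m - i, 0 < j → (q i).1.1 < (q (i + j)).1.1) ∧
      ∀ j ≤ a + m - i, 0 < j → ¬ RegenAt q (i + j) (n - i - j)) ?_
  · have h2 := h (a + m) n 0 p ((p 0).1.1 - (a + m) - 1) (by omega) hn (by simp) (by omega)
    have h3 : C / ((a + m : ℕ) : ℝ) ^ 2 ≤ C / m := by
      refine div_le_div_of_nonneg_left (by linarith) (by linarith) ?_
      push_cast
      nlinarith [Nat.cast_nonneg (α := ℝ) a]
    have h4 : pathProb n 0 p (fun q => ∃ i ∈ Finset.range (a + 1), StrictRecord q i ∧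
        (∀ j ≤ a + m - i, 0 < j → (q i).1.1 < (q (i + j)).1.1) ∧
        ∀ j ≤ a + m - i, 0 < j → ¬ RegenAt q (i + j) (n - i - j)) ≤
        ∑ i ∈ Finset.range (a + 1), C / ((m + (a + 1 - 1 - i) : ℕ) : ℝ) ^ 2 := by
      refine (pathProb_le_sum (Finset.range (a + 1)) fun q _ h => h).trans
        (Finset.sum_le_sum fun i hi => ?_)
      have hi' : i ≤ a := by simpa [Nat.lt_succ_iff] using hi
      obtain ⟨k, rfl⟩ := Nat.exists_eq_add_of_le (show i ≤ n by omega)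
      refine (pathProb_le_mul (A := fun q => StrictRecord q i) (B := fun q =>
        (∀ j ≤ a + m - i, 0 < j → (q i).1.1 < (q (i + j)).1.1) ∧
        ∀ j ≤ a + m - i, 0 < j → ¬ RegenAt q (i + j) (i + k - i - j))
        (β := C / ((m + (a + 1 - 1 - i) : ℕ) : ℝ) ^ 2) ?_ (fun q _ h => h) ?_).trans ?_
      · intro q q' hq
        exact (strictRecord_congr fun s hs => hq s (by omega)).1
      · intro q hq hrec
        rw [zero_add, show m + (a + 1 - 1 - i) = a + m - i by omega]
        refine le_trans (pathProb_mono fun q' hq' hQ => ?_)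
          (h (a + m - i) k i q (q i).1.1 (by omega) (by omega) (fun s hs => (hrec s hs).le) le_rfl)
        rw [hq'.1 i le_rfl, Nat.add_sub_cancel_left] at hQ
        exact hQ
      · exact mul_le_of_le_one_right (by positivity) (pathProb_le_one _ _ _ _)
    have h5 : ∑ i ∈ Finset.range (a + 1), C / ((m + (a + 1 - 1 - i) : ℕ) : ℝ) ^ 2 ≤
        2 * C / m := by
      rw [Finset.sum_range_reflect (fun i => C / ((m + i : ℕ) : ℝ) ^ 2) (a + 1)]
      have e1 := Finset.sum_Ico_eq_sum_range (fun i => C / ((i : ℕ) : ℝ) ^ 2) m (m + (a + 1))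
      rw [Nat.add_sub_cancel_left] at e1
      rw [← e1, show Finset.Ico m (m + (a + 1)) = Finset.Ioo (m - 1) (m + (a + 1)) by
        ext; simp; omega]
      simp only [div_eq_mul_inv C, ← Finset.mul_sum]
      have e2 := sum_Ioo_inv_sq_le (α := ℝ) (m - 1) (m + (a + 1))
      rw [show ((m - 1 : ℕ) : ℝ) + 1 = m by push_cast [hm]; ring] at e2
      calc _ ≤ C * (2 / m) := by gcongr
        _ = _ := by ring
    have h6 : 3 * C / (m : ℝ) = C / m + 2 * C / m := by ring
    linarith
  · intro q hq hQ
    by_cases hex : ∃ i, i ≤ a ∧ RegenAt q i (n - i) ∧ 0 < i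
    · set i := Nat.findGreatest (fun i => RegenAt q i (n - i) ∧ 0 < i) a with hi
      obtain ⟨i₀, hi₀, h2⟩ := hex
      have h3 : RegenAt q i (n - i) ∧ 0 < i := Nat.findGreatest_spec (P := fun i =>
        RegenAt q i (n - i) ∧ 0 < i) hi₀ h2
      have hia : i ≤ a := Nat.findGreatest_le a
      refine Or.inr ⟨i, Finset.mem_range.2 (by omega), h3.1.1, fun j hj hj0 =>
        h3.1.2.2.2 j (by omega) hj0, fun j hj hj0 hreg => ?_⟩
      rw [Nat.sub_sub] at hreg
      rcases le_or_gt (i + j) a with h4 | h4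
      · have := Nat.le_findGreatest (P := fun i => RegenAt q i (n - i) ∧ 0 < i) h4
          ⟨hreg, by omega⟩
        omega
      · exact hQ (i + j) (by omega) h4 hreg
    · push Not at hex
      refine Or.inl ⟨fun j hj hj0 => ?_, fun j hj hj0 hreg => ?_⟩
      · have := (abs_le.1 (hq.abs_sub_le (Nat.zero_le j) (by omega)).1).1
        rw [zero_add, hq.1 0 le_rfl] at this
        rw [zero_add]
        push_cast at this
        omega
      · rw [zero_add] at hreg
        rcases le_or_gt j a with h4 | h4
        · have := hex j h4 hreg; omega
        · exact hQ j (by omega) h4 hreg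

/-- Fresh steps have positive density, up to small exceptional probability. -/
lemma exists_pathProb_freshCount_small_le : ∃ C : ℝ, 1 ≤ C ∧ ∀ (k N m : ℕ) (p : JPath), 1 ≤ m →
    pathProb (k + N) 0 p (fun q => 0 < freshCount q k N ∧ freshCount q k N * (8 * m) < N) ≤
      C / m := by
  obtain ⟨C, hC, h⟩ := exists_pathProb_window_le
  refine ⟨2 * C + 2, by linarith, fun k N m p hm => ?_⟩
  have hm0 : (1 : ℝ) ≤ m := by exact_mod_cast hm
  rcases Nat.lt_or_ge m 2 with hm2 | hm2
  · obtain rfl : m = 1 := by omega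
    refine (pathProb_le_one _ _ _ _).trans ?_
    rw [Nat.cast_one, div_one]; linarith
  rcases Nat.lt_or_ge N (8 * m) with hN | hN
  · rw [pathProb_eq_zero]
    · positivity
    · rintro q - ⟨h1, h2⟩
      nlinarith
  set w := (N - 3) / m with hw
  have hw1 : w * m + 3 ≤ N := by
    have : w * m ≤ N - 3 := Nat.div_mul_le_self (N - 3) m
    omega
  have hw2 : N < w * m + m + 3 := by
    have : N - 3 < w * m + m := Nat.lt_div_mul_add (show 0 < m by omega)
    omega
  have hw3 : 1 ≤ w := by
    rw [hw, Nat.le_div_iff_mul_le (by omega)]; omega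
  have hw4 : N ≤ 4 * m * w := by nlinarith
  have hw0 : (0 : ℝ) < w := by exact_mod_cast hw3
  set Bad : ℕ → JPath → Prop := fun i q =>
    ∀ j ≤ k + i * m + m, k + i * m < j → ¬ RegenAt q j (k + N - j)
  have hcount : ∀ q, freshCount q k N * (8 * m) < N →
      (w : ℝ) ≤ 2 * ∑ i ∈ Finset.range w, if Bad i q then 1 else 0 := by
    intro q hq
    have h1 : ((Finset.range w).filter fun i => ¬ Bad i q).card ≤ freshCount q k N := by
      have hex : ∀ i, ∃ j, ¬ Bad i q → j ≤ k + i * m + m ∧ k + i * m < j ∧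
          RegenAt q j (k + N - j) := by
        intro i
        by_cases hb : Bad i q
        · exact ⟨0, fun h => (h hb).elim⟩
        · simp only [Bad] at hb
          push Not at hb
          obtain ⟨j, h⟩ := hb
          exact ⟨j, fun _ => h⟩
      choose f hf using hex
      refine Finset.card_le_card_of_injOn (fun i => f i + 2 - k) ?_ ?_
      · intro i hi
        obtain ⟨hi1, hi2⟩ := Finset.mem_filter.1 (Finset.mem_coe.1 hi)
        obtain ⟨h2, h3, h4⟩ := hf i hi2
        have hi3 : (i + 1) * m ≤ w * m := Nat.mul_le_mul_right m (Finset.mem_range.1 hi1)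
        rw [add_mul, one_mul] at hi3
        refine Finset.mem_coe.2 (Finset.mem_filter.2 ⟨Finset.mem_range.2 ?_, ?_⟩)
        · show f i + 2 - k < N
          omega
        show FreshLeft (k + (f i + 2 - k)) q
        rw [show k + (f i + 2 - k) = f i + 2 by omega]
        exact h4.freshLeft
      · intro i hi i' hi' heq
        obtain ⟨-, hi2⟩ := Finset.mem_filter.1 (Finset.mem_coe.1 hi)
        obtain ⟨-, hi2'⟩ := Finset.mem_filter.1 (Finset.mem_coe.1 hi')
        obtain ⟨h2, h3, -⟩ := hf i hi2
        obtain ⟨h2', h3', -⟩ := hf i' hi2'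
        simp only at heq
        by_contra hne
        rcases Nat.lt_or_gt_of_ne hne with hlt | hlt
        · have := Nat.mul_le_mul_right m (Nat.succ_le_of_lt hlt)
          rw [Nat.succ_mul] at this
          omega
        · have := Nat.mul_le_mul_right m (Nat.succ_le_of_lt hlt)
          rw [Nat.succ_mul] at this
          omega
    have h2 := Finset.card_filter_add_card_filter_not (s := Finset.range w) (fun i => Bad i q)
    rw [Finset.card_range] at h2
    rw [Finset.sum_boole]
    have h3 : 2 * freshCount q k N < w := by
      by_contra! hcon
      have : 4 * m * w ≤ 4 * m * (2 * freshCount q k N) := Nat.mul_le_mul_left _ hcon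
      nlinarith
    exact_mod_cast (show w ≤ 2 * ((Finset.range w).filter fun i => Bad i q).card by omega)
  calc pathProb (k + N) 0 p (fun q => 0 < freshCount q k N ∧ freshCount q k N * (8 * m) < N)
      ≤ pathMean (k + N) 0 p
          (fun q => 2 / w * ∑ i ∈ Finset.range w, if Bad i q then 1 else 0) := by
        refine pathMean_mono fun q _ => ?_
        split_ifs with hq
        · have := hcount q hq.2
          rw [div_mul_eq_mul_div, le_div_iff₀ hw0]
          linarith
        · exact mul_nonneg (by positivity)
            (Finset.sum_nonneg fun i _ => by split_ifs <;> norm_num)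
    _ = 2 / w * ∑ i ∈ Finset.range w, pathProb (k + N) 0 p (Bad i) := by
        rw [pathMean_const_mul, pathMean_sum]
        refine congrArg _ (Finset.sum_congr rfl fun i _ => pathMean_congr fun q _ => ?_)
        congr
    _ ≤ 2 / w * ∑ i ∈ Finset.range w, C / m := by
        gcongr with i hi
        refine h (k + i * m) m (k + N) p hm ?_
        have hi3 : (i + 1) * m ≤ w * m := Nat.mul_le_mul_right m (Finset.mem_range.1 hi)
        rw [add_mul, one_mul] at hi3
        omega
    _ = 2 * C / m := by
        rw [Finset.sum_const, Finset.card_range, nsmul_eq_mul]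
        field_simp
    _ ≤ (2 * C + 2) / m := by gcongr; linarith

/-- The change over `[k, l]` of the difference of the two walks. -/
def pathDrift (q : JPath) (k l : ℕ) : ℤ × ℤ := ((q l).1 - (q l).2) - ((q k).1 - (q k).2)

lemma pathDrift_addStep (q : JPath) (t n : ℕ) (a b : ℤ × ℤ) :
    pathDrift (addStep q (t + n) a b) t (t + (n + 1)) = pathDrift q t (t + n) + (a - b) := by
  unfold pathDrift
  rw [← add_assoc, addStep_apply_succ, addStep_apply_of_le (by omega)]
  ext <;> simp <;> ring

lemma pathProb_le_of_forall {n m t : ℕ} {p : JPath} {Q : JPath → Prop} {y : ℝ}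
    (h : ∀ q, pathProb m (t + n) q Q ≤ y) : pathProb (n + m) t p Q ≤ y := by
  unfold pathProb
  rw [pathMean_tower, ← pathMean_const n t p y]
  exact pathMean_mono fun q _ => h q

lemma freshCount_le (q : JPath) (t n : ℕ) : freshCount q t n ≤ n :=
  (Finset.card_filter_le _ _).trans (Finset.card_range n).le

/-- Exponential supermartingale for the drift, compensated at the fresh steps only. -/
lemma pathMean_exp_drift_le {α β γ : ℝ}
    (h : stepMean True (fun a b => Real.exp (α * (a - b).1 + β * (a - b).2)) ≤ Real.exp γ)
    (n t : ℕ) (p : JPath) :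
    pathMean n t p (fun q => Real.exp (α * (pathDrift q t (t + n)).1 +
      β * (pathDrift q t (t + n)).2 - γ * freshCount q t n)) ≤ 1 := by
  refine (pathMean_le_of_supermartingale (W := fun n q => Real.exp (α * (pathDrift q t (t + n)).1 +
      β * (pathDrift q t (t + n)).2 - γ * freshCount q t n)) ?_).trans ?_
  · intro i _ q _
    set X := Real.exp (α * (pathDrift q t (t + i)).1 +
      β * (pathDrift q t (t + i)).2 - γ * freshCount q t i)
    by_cases hc : FreshLeft (t + i) q
    · have h1 : stepMean (FreshLeft (t + i) q) (fun a b =>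
          Real.exp (α * (pathDrift (addStep q (t + i) a b) t (t + (i + 1))).1 +
            β * (pathDrift (addStep q (t + i) a b) t (t + (i + 1))).2 -
            γ * freshCount (addStep q (t + i) a b) t (i + 1))) =
          stepMean True (fun a b => (X * Real.exp (-γ)) *
            Real.exp (α * (a - b).1 + β * (a - b).2)) := by
        rw [show FreshLeft (t + i) q = True from eq_true hc]
        refine stepMean_congr fun a b _ => ?_
        rw [pathDrift_addStep, freshCount_addStep, if_pos hc, ← Real.exp_add, ← Real.exp_add]
        congr 1
        push_cast [Prod.fst_add, Prod.snd_add]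
        ring
      rw [h1, stepMean_const_mul]
      have h2 := mul_le_mul_of_nonneg_left h (show 0 ≤ X * Real.exp (-γ) by positivity)
      rwa [mul_assoc X (Real.exp (-γ)) (Real.exp γ), ← Real.exp_add (-γ), neg_add_cancel,
        Real.exp_zero, mul_one] at h2
    · rw [← stepMean_const (FreshLeft (t + i) q) X]
      refine (stepMean_congr fun a b hab => ?_).le
      rcases hab with ⟨rfl, -⟩ | ⟨hc', -⟩
      · rw [pathDrift_addStep, freshCount_addStep, if_neg hc, sub_self, add_zero, add_zero]
      · exact absurd hc' hc
  · simp [pathDrift]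

lemma IsCont.pathDrift_fst_nonneg {p q : JPath} {t n : ℕ} (h : IsCont p t n q) :
    0 ≤ (pathDrift q t (t + n)).1 := by
  induction n with
  | zero => simp [pathDrift]
  | succ n ih =>
    have h1 := ih (h.mono (by omega))
    have h2 := h.2 (t + n) (by omega) (by omega)
    have h3 : (pathDrift q t (t + (n + 1))).1 = (pathDrift q t (t + n)).1 +
        (((q (t + n + 1)).1 - (q (t + n)).1).1 - ((q (t + n + 1)).2 - (q (t + n)).2).1) := by
      simp only [pathDrift, Prod.fst_sub, ← add_assoc]
      ring
    rw [h3]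
    rcases h2 with ⟨h4, -⟩ | ⟨-, h4, h5, -⟩
    · rw [h4]; omega
    · rw [h4]
      rcases dirs_cases h5 with h6 | h6 | h6 | h6 <;> rw [h6] <;> simp <;> omega

/-- The first coordinate of the drift is at least of the order of the number of fresh steps. -/
lemma pathProb_drift_fst_le (k N : ℕ) (p : JPath) {lam : ℝ} (hlam : 0 < lam) :
    pathProb (k + N) 0 p (fun q => ((pathDrift q k (k + N)).1 : ℝ) + 1 <
      (freshCount q k N : ℝ) / lam) ≤ 3 * Real.exp (-(1 / 32) * lam) := by
  rcases lt_or_ge lam 32 with h32 | h32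
  · refine (pathProb_le_one _ _ _ _).trans ?_
    have h1 : Real.exp (-1) ≤ Real.exp (-(1 / 32) * lam) := Real.exp_le_exp.2 (by linarith)
    have h2 : 1 / 3 ≤ Real.exp (-1) := by
      rw [Real.exp_neg, one_div]
      exact inv_anti₀ (Real.exp_pos _) (by linarith [Real.exp_one_lt_d9])
    linarith
  have hstep : stepMean True (fun a b => Real.exp ((-1) * (a - b).1 + 0 * (a - b).2)) ≤
      Real.exp (-(1 / 16)) := by
    have h1 : Real.exp (-1) ≤ 1 / 2 := by
      rw [Real.exp_neg, one_div]
      exact inv_anti₀ (by norm_num) (by linarith [Real.exp_one_gt_d9])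
    have h2 : Real.exp (-2) ≤ 1 / 4 := by
      rw [show (-2 : ℝ) = -1 + -1 by norm_num, Real.exp_add]
      nlinarith [Real.exp_pos (-1)]
    have h3 := Real.add_one_le_exp (-(1 / 16 : ℝ))
    simp [stepMean]
    norm_num at h1 h2 h3 ⊢
    linarith
  refine pathProb_le_of_forall fun q => ?_
  rw [zero_add]
  have h := pathProb_le_exp_of_pathMean (Q := fun q => ((pathDrift q k (k + N)).1 : ℝ) + 1 <
      (freshCount q k N : ℝ) / lam) (x := lam / 32) (fun _ => (Real.exp_pos _).le) ?_
      (pathMean_exp_drift_le hstep N k q)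
  · refine h.trans ?_
    rw [show -(lam / 32) = -(1 / 32) * lam by ring]
    linarith [Real.exp_pos (-(1 / 32) * lam)]
  · intro q' hq' hQ
    apply Real.exp_le_exp.2
    have h1 : (0 : ℝ) ≤ (pathDrift q' k (k + N)).1 := by exact_mod_cast hq'.pathDrift_fst_nonneg
    rw [lt_div_iff₀ hlam] at hQ
    nlinarith

lemma stepMean_exp_snd_le (θ : ℝ) :
    stepMean True (fun a b => Real.exp (0 * (a - b).1 + θ * (a - b).2)) ≤
      Real.exp (θ ^ 2 / 2) := by
  have h1 := Real.cosh_le_exp_half_sq θ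
  have h2 := Real.one_le_cosh θ
  rw [Real.cosh_eq] at h1 h2
  simp [stepMean]
  linarith

/-- Gaussian tails for the second coordinate at a fixed scale of the number of fresh steps. -/
lemma pathProb_drift_snd_scale_le (k N r : ℕ) (p : JPath) {lam : ℝ} (hlam : 0 < lam) :
    pathProb (k + N) 0 p (fun q => 2 ^ r ≤ freshCount q k N ∧ freshCount q k N < 2 ^ (r + 1) ∧
      lam * Real.sqrt (freshCount q k N) < |((pathDrift q k (k + N)).2 : ℝ)|) ≤
      2 * Real.exp (-(lam ^ 2 / 4)) := by
  set s := Real.sqrt (2 ^ r) with hs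
  have hs0 : 0 < s := Real.sqrt_pos.2 (by positivity)
  have hs2 : s ^ 2 = 2 ^ r := Real.sq_sqrt (by positivity)
  have key : ∀ σ : ℝ, σ ^ 2 = 1 → pathProb (k + N) 0 p (fun q => freshCount q k N < 2 ^ (r + 1) ∧
      lam * s < σ * (pathDrift q k (k + N)).2) ≤ Real.exp (-(lam ^ 2 / 4)) := by
    intro σ hσ
    refine pathProb_le_of_forall fun q => ?_
    rw [zero_add]
    set θ := σ * lam / (2 * s) with hθ
    have h := pathProb_le_exp_of_pathMean (Q := fun q => freshCount q k N < 2 ^ (r + 1) ∧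
      lam * s < σ * (pathDrift q k (k + N)).2) (x := lam ^ 2 / 4) (fun _ => (Real.exp_pos _).le) ?_
      (pathMean_exp_drift_le (stepMean_exp_snd_le θ) N k q)
    · rwa [one_mul] at h
    · rintro q' - ⟨h1, h2⟩
      apply Real.exp_le_exp.2
      have h3 : (freshCount q' k N : ℝ) ≤ 2 * s ^ 2 := by
        rw [hs2, ← pow_succ']
        exact_mod_cast h1.le
      have h4 : lam ^ 2 / 2 ≤ θ * (pathDrift q' k (k + N)).2 := by
        have h5 := mul_le_mul_of_nonneg_left h2.le (show 0 ≤ lam / (2 * s) by positivity)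
        calc lam ^ 2 / 2 = lam / (2 * s) * (lam * s) := by field_simp
          _ ≤ _ := h5
          _ = _ := by rw [hθ]; ring
      have h6 : θ ^ 2 / 2 * freshCount q' k N ≤ lam ^ 2 / 4 := by
        have h7 : θ ^ 2 = lam ^ 2 / (4 * s ^ 2) := by
          rw [hθ, div_pow, mul_pow, hσ]; ring
        calc θ ^ 2 / 2 * freshCount q' k N ≤ θ ^ 2 / 2 * (2 * s ^ 2) := by gcongr
          _ = lam ^ 2 / 4 := by rw [h7]; field_simp
      linarith
  refine (pathProb_le_add (Q₁ := fun q => freshCount q k N < 2 ^ (r + 1) ∧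
      lam * s < 1 * (pathDrift q k (k + N)).2) (Q₂ := fun q => freshCount q k N < 2 ^ (r + 1) ∧
      lam * s < (-1) * (pathDrift q k (k + N)).2) ?_).trans ?_
  · rintro q - ⟨h1, h2, h3⟩
    have h4 : lam * s ≤ lam * Real.sqrt (freshCount q k N) := by
      refine mul_le_mul_of_nonneg_left (Real.sqrt_le_sqrt ?_) hlam.le
      exact_mod_cast h1
    rcases lt_abs.1 (h4.trans_lt h3) with h5 | h5
    · exact Or.inl ⟨h2, by linarith⟩
    · exact Or.inr ⟨h2, by linarith⟩
  · linarith [key 1 (by norm_num), key (-1) (by norm_num)]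

lemma IsCont.pathDrift_eq_zero {p q : JPath} {t n : ℕ} (h : IsCont p t n q)
    (hK : freshCount q t n = 0) : pathDrift q t (t + n) = 0 := by
  have h0 : ∀ i < n, ¬ FreshLeft (t + i) q := fun i hi hf => by
    have := Finset.card_eq_zero.1 hK
    exact Finset.notMem_empty i (this ▸ Finset.mem_filter.2 ⟨Finset.mem_range.2 hi, hf⟩)
  clear hK
  induction n with
  | zero => simp [pathDrift]
  | succ n ih =>
    have h1 := ih (h.mono (by omega)) fun i hi => h0 i (by omega)
    have h2 := h.2 (t + n) (by omega) (by omega)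
    have h3 : pathDrift q t (t + (n + 1)) = pathDrift q t (t + n) +
        (((q (t + n + 1)).1 - (q (t + n)).1) - ((q (t + n + 1)).2 - (q (t + n)).2)) := by
      simp only [pathDrift, ← add_assoc]
      ext <;> simp <;> ring
    rcases h2 with ⟨h4, -⟩ | ⟨h4, -⟩
    · rw [h3, h1, h4, sub_self, add_zero]
    · exact absurd h4 (h0 n (by omega))

/-- Gaussian tails for the second coordinate of the drift. -/
lemma exists_pathProb_drift_snd_le : ∃ C : ℝ, 1 ≤ C ∧ ∀ (k N : ℕ) (p : JPath) (lam : ℝ),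
    0 < lam → pathProb (k + N) 0 p (fun q => lam * Real.sqrt (freshCount q k N) <
      |((pathDrift q k (k + N)).2 : ℝ)|) ≤ C * Real.exp (-(1 / 8) * lam ^ 2) := by
  obtain ⟨C, hC, h⟩ := exists_pathProb_freshCount_small_le
  refine ⟨C + 28, by linarith, fun k N p lam hlam => ?_⟩
  set L := ⌈lam ^ 2⌉₊ with hL
  have hL1 : lam ^ 2 ≤ L := Nat.le_ceil _
  have hL2 : (L : ℝ) < lam ^ 2 + 1 := Nat.ceil_lt_add_one (sq_nonneg _)
  set S := Finset.Icc (Nat.log 2 N - (L + 4)) (Nat.log 2 N)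
  have h1 : pathProb (k + N) 0 p (fun q => lam * Real.sqrt (freshCount q k N) <
      |((pathDrift q k (k + N)).2 : ℝ)|) ≤
      pathProb (k + N) 0 p (fun q => 0 < freshCount q k N ∧
        freshCount q k N * (8 * 2 ^ L) < N) +
      pathProb (k + N) 0 p (fun q => ∃ r ∈ S, 2 ^ r ≤ freshCount q k N ∧
        freshCount q k N < 2 ^ (r + 1) ∧
        lam * Real.sqrt (freshCount q k N) < |((pathDrift q k (k + N)).2 : ℝ)|) := by
    refine pathProb_le_add fun q hq hQ => ?_
    have hK : freshCount q k N ≠ 0 := fun hK => by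
      have h2 : IsCont q k N q := by simpa using hq.tail
      rw [h2.pathDrift_eq_zero hK, hK] at hQ
      simp at hQ
    by_cases hsm : freshCount q k N * (8 * 2 ^ L) < N
    · exact Or.inl ⟨Nat.pos_of_ne_zero hK, hsm⟩
    · refine Or.inr ⟨Nat.log 2 (freshCount q k N), Finset.mem_Icc.2 ⟨?_, ?_⟩,
        Nat.pow_log_le_self 2 hK, Nat.lt_pow_succ_log_self (by norm_num) _, hQ⟩
      · have h2 := Nat.lt_pow_succ_log_self (b := 2) (by norm_num) (freshCount q k N)
        have h3 : N < 2 ^ (Nat.log 2 (freshCount q k N) + 1 + (L + 3)) := by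
          rw [pow_add _ _ (L + 3), pow_add 2 L 3]
          calc N ≤ freshCount q k N * (8 * 2 ^ L) := not_lt.1 hsm
            _ < 2 ^ (Nat.log 2 (freshCount q k N) + 1) * (8 * 2 ^ L) :=
              Nat.mul_lt_mul_of_pos_right h2 (by positivity)
            _ = _ := by ring
        have h4 := Nat.log_lt_of_lt_pow' (by omega) h3
        omega
      · exact Nat.log_mono_right (freshCount_le q k N)
  have h2 := h k N (2 ^ L) p Nat.one_le_two_pow
  have h3 : pathProb (k + N) 0 p (fun q => ∃ r ∈ S, 2 ^ r ≤ freshCount q k N ∧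
        freshCount q k N < 2 ^ (r + 1) ∧
        lam * Real.sqrt (freshCount q k N) < |((pathDrift q k (k + N)).2 : ℝ)|) ≤
      (lam ^ 2 + 6) * (2 * Real.exp (-(lam ^ 2 / 4))) := by
    refine (pathProb_le_sum S fun q _ hq => hq).trans
      ((Finset.sum_le_sum fun r _ => pathProb_drift_snd_scale_le k N r p hlam).trans ?_)
    rw [Finset.sum_const, nsmul_eq_mul]
    refine mul_le_mul_of_nonneg_right ?_ (by positivity)
    have h4 : S.card ≤ L + 5 := by
      rw [Nat.card_Icc]; omega
    have h5 : (S.card : ℝ) ≤ L + 5 := by exact_mod_cast h4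
    linarith
  have h4 : C / ((2 ^ L : ℕ) : ℝ) ≤ C * Real.exp (-(1 / 8) * lam ^ 2) := by
    rw [div_eq_mul_inv]
    refine mul_le_mul_of_nonneg_left ?_ (by linarith)
    rw [show -(1 / 8) * lam ^ 2 = -(lam ^ 2 / 8) by ring, Real.exp_neg]
    refine inv_anti₀ (Real.exp_pos _) ?_
    have h5 : Real.exp (1 / 8) ≤ 2 := by
      have h6 : Real.exp (1 / 8) ≤ Real.exp (Real.log 2) :=
        Real.exp_le_exp.2 (by linarith [Real.log_two_gt_d9])
      rwa [Real.exp_log (by norm_num)] at h6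
    calc Real.exp (lam ^ 2 / 8) ≤ Real.exp (L * (1 / 8)) := Real.exp_le_exp.2 (by linarith)
      _ = Real.exp (1 / 8) ^ L := Real.exp_nat_mul _ _
      _ ≤ 2 ^ L := pow_le_pow_left₀ (Real.exp_pos _).le h5 L
      _ = _ := by push_cast; rfl
  have h5 : (lam ^ 2 + 6) * (2 * Real.exp (-(lam ^ 2 / 4))) ≤
      28 * Real.exp (-(1 / 8) * lam ^ 2) := by
    rw [show -(lam ^ 2 / 4) = -(lam ^ 2 / 8) + -(1 / 8) * lam ^ 2 by ring, Real.exp_add]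
    have h6 := Real.add_one_le_exp (lam ^ 2 / 8)
    have h7 : lam ^ 2 + 6 ≤ 14 * Real.exp (lam ^ 2 / 8) := by nlinarith [sq_nonneg lam]
    have h8 := mul_le_mul_of_nonneg_right h7
      (show 0 ≤ 2 * (Real.exp (-(lam ^ 2 / 8)) * Real.exp (-(1 / 8) * lam ^ 2)) by positivity)
    refine h8.trans (le_of_eq ?_)
    have h9 : Real.exp (lam ^ 2 / 8) * Real.exp (-(lam ^ 2 / 8)) = 1 := by
      rw [← Real.exp_add, add_neg_cancel, Real.exp_zero]
    linear_combination 28 * Real.exp (-(1 / 8) * lam ^ 2) * h9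
  rw [add_mul]
  linarith

/-- The joint history of two walks up to time `t`. -/
def jointHist {Ω : Type*} (E R : ℕ → Ω → ℤ × ℤ) (t : ℕ) (ω : Ω) : JPath :=
  fun s => if s ≤ t then (E s ω, R s ω) else 0

lemma jointHist_apply {Ω : Type*} {E R : ℕ → Ω → ℤ × ℤ} {s t : ℕ} (h : s ≤ t) (ω : Ω) :
    jointHist E R t ω s = (E s ω, R s ω) := if_pos h

lemma addStep_jointHist {Ω : Type*} (E R : ℕ → Ω → ℤ × ℤ) (t : ℕ) (ω : Ω) :
    addStep (jointHist E R t ω) t (E (t + 1) ω - E t ω) (R (t + 1) ω - R t ω) =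
      jointHist E R (t + 1) ω := by
  funext s
  rcases lt_trichotomy s (t + 1) with h | rfl | h
  · rw [addStep_apply_of_le (by omega), jointHist_apply (by omega), jointHist_apply (by omega)]
  · rw [addStep_apply_succ, jointHist_apply le_rfl, jointHist_apply le_rfl]
    simp
  · rw [addStep, Function.update_of_ne (by omega), jointHist, jointHist, if_neg (by omega),
      if_neg (by omega)]

lemma freshLeft_jointHist {Ω : Type*} (E R : ℕ → Ω → ℤ × ℤ) {s t : ℕ} (h : s ≤ t) (ω : Ω) :
    FreshLeft s (jointHist E R t ω) ↔ nonNV E s ω := by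
  unfold FreshLeft nonNV
  refine forall₂_congr fun r hr => ?_
  rw [jointHist_apply (hr.trans h), jointHist_apply h]

lemma driftD_eq_pathDrift {Ω : Type*} (E R : ℕ → Ω → ℤ × ℤ) {k l : ℕ} (h : k ≤ l) (ω : Ω) :
    driftD E R k l ω = pathDrift (jointHist E R l ω) k l := by
  rw [driftD, pathDrift, jointHist_apply h, jointHist_apply le_rfl]

lemma numNonNV_eq_freshCount {Ω : Type*} (E R : ℕ → Ω → ℤ × ℤ) (k n : ℕ) (ω : Ω) :
    numNonNV E k (k + n) ω = freshCount (jointHist E R (k + n) ω) k n := by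
  have h : {j | k ≤ j ∧ j < k + n ∧ nonNV E j ω} =
      ((((Finset.range n).filter fun i => FreshLeft (k + i) (jointHist E R (k + n) ω)).image
        (k + ·) : Finset ℕ) : Set ℕ) := by
    ext j
    simp only [Set.mem_ofPred_eq, Finset.coe_image, Set.mem_image, Finset.mem_coe,
      Finset.mem_filter, Finset.mem_range]
    constructor
    · rintro ⟨h1, h2, h3⟩
      refine ⟨j - k, ⟨by omega, ?_⟩, by omega⟩
      rw [show k + (j - k) = j by omega]
      exact (freshLeft_jointHist E R h2.le ω).2 h3
    · rintro ⟨i, ⟨h1, h2⟩, rfl⟩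
      exact ⟨by omega, by omega, (freshLeft_jointHist E R (by omega) ω).1 h2⟩
  rw [numNonNV, h, Set.ncard_coe_finset, Finset.card_image_of_injective _ (add_right_injective k)]
  rfl

/-- Functionals of the history are measurable. -/
lemma measurable_comp_jointHist {Ω : Type*} {m0 : MeasurableSpace Ω} {𝓕 : Filtration ℕ m0}
    {E R : ℕ → Ω → ℤ × ℤ} (hE : ∀ t, Measurable[𝓕 t] (E t)) (hR : ∀ t, Measurable[𝓕 t] (R t))
    (t : ℕ) (F : JPath → ℝ) : Measurable[𝓕 t] fun ω => F (jointHist E R t ω) := by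
  have h1 : Measurable[𝓕 t] fun ω (i : Fin (t + 1)) => (E i ω, R i ω) :=
    @measurable_pi_lambda _ _ _ (𝓕 t) _ _ fun i =>
      ((hE i).mono (𝓕.mono (by omega)) le_rfl).prodMk ((hR i).mono (𝓕.mono (by omega)) le_rfl)
  have h2 : Measurable fun v : Fin (t + 1) → (ℤ × ℤ) × (ℤ × ℤ) =>
      F fun s => if h : s ≤ t then v ⟨s, by omega⟩ else 0 := measurable_of_countable _
  have h3 := h2.comp h1
  exact h3

/-- The four unit steps as a finite set. -/
def dirsFinset : Finset (ℤ × ℤ) := {(1, 0), (-1, 0), (0, 1), (0, -1)}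

lemma mem_dirsFinset {a : ℤ × ℤ} : a ∈ dirsFinset ↔ a ∈ dirs := by
  simp [dirsFinset, dirs]

lemma stepMean_eq_sum (c : Prop) (g : ℤ × ℤ → ℤ × ℤ → ℝ) :
    stepMean c g = ∑ a ∈ dirsFinset, ∑ b ∈ dirsFinset,
      (if c then jointStepProb a b else if a = b then 1 / 4 else 0) * g a b := by
  unfold stepMean
  by_cases hc : c <;> simp [hc, dirsFinset, jointStepProb] <;> ring

lemma integral_jointHist_succ {Ω : Type*} {m0 : MeasurableSpace Ω} {μ : Measure Ω}
    [IsProbabilityMeasure μ] {𝓕 : Filtration ℕ m0} {E R : ℕ → Ω → ℤ × ℤ}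
    (hE : ∀ t, Measurable[𝓕 t] (E t)) (hR : ∀ t, Measurable[𝓕 t] (R t))
    (hsteps : ∀ t ω, E (t + 1) ω - E t ω ∈ dirs ∧ R (t + 1) ω - R t ω ∈ dirs)
    (hlaw : ∀ t, ∀ a ∈ dirs, ∀ b ∈ dirs,
      μ[(fun ω => if E (t + 1) ω - E t ω = a ∧ R (t + 1) ω - R t ω = b
          then (1 : ℝ) else 0) | 𝓕 t]
        =ᵐ[μ] fun ω => if nonNV E t ω then jointStepProb a b
          else if a = b then 1 / 4 else 0)
    (t : ℕ) (G : JPath → ℝ) (hG : ∀ q, |G q| ≤ 1) :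
    ∫ ω, G (jointHist E R (t + 1) ω) ∂μ = ∫ ω, stepMean (FreshLeft t (jointHist E R t ω))
      (fun a b => G (addStep (jointHist E R t ω) t a b)) ∂μ := by
  set I : ℤ × ℤ → ℤ × ℤ → Ω → ℝ := fun a b ω =>
    if E (t + 1) ω - E t ω = a ∧ R (t + 1) ω - R t ω = b then (1 : ℝ) else 0 with hI
  set H : ℤ × ℤ → ℤ × ℤ → Ω → ℝ := fun a b ω => G (addStep (jointHist E R t ω) t a b) with hH
  set P : ℤ × ℤ → ℤ × ℤ → Ω → ℝ := fun a b ω => if nonNV E t ω then jointStepProb a b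
          else if a = b then 1 / 4 else 0 with hP
  have hHm : ∀ a b, StronglyMeasurable[𝓕 t] (H a b) := fun a b =>
    (measurable_comp_jointHist hE hR t fun q => G (addStep q t a b)).stronglyMeasurable
  have hIm : ∀ a b, Measurable (I a b) := fun a b => by
    have := (measurable_comp_jointHist hE hR (t + 1) fun q =>
      if (q (t + 1)).1 - (q t).1 = a ∧ (q (t + 1)).2 - (q t).2 = b then (1 : ℝ) else 0).mono
      (𝓕.le (t + 1)) le_rfl
    simpa only [jointHist_apply le_rfl, jointHist_apply (Nat.le_succ t)] using this
  have hIi : ∀ a b, Integrable (I a b) μ := fun a b =>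
    Integrable.of_bound (hIm a b).aestronglyMeasurable 1 (ae_of_all _ fun ω => by
      simp only [hI]; split_ifs <;> simp)
  have hIH : ∀ a b, Integrable (fun ω => I a b ω * H a b ω) μ := fun a b =>
    Integrable.of_bound ((hIm a b).aestronglyMeasurable.mul
      ((hHm a b).mono (𝓕.le t)).aestronglyMeasurable) 1 (ae_of_all _ fun ω => by
      have h1 := hG (addStep (jointHist E R t ω) t a b)
      simp only [hI, hH]; split_ifs <;> simp [h1])
  have hPH : ∀ a ∈ dirs, ∀ b ∈ dirs, μ[(fun ω => I a b ω * H a b ω) | 𝓕 t] =ᵐ[μ]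
      fun ω => P a b ω * H a b ω := fun a ha b hb =>
    (condExp_mul_of_stronglyMeasurable_right (hHm a b) (hIH a b) (hIi a b)).trans
      ((hlaw t a ha b hb).mul EventuallyEq.rfl)
  have hPHi : ∀ a ∈ dirs, ∀ b ∈ dirs, Integrable (fun ω => P a b ω * H a b ω) μ :=
    fun a ha b hb => integrable_condExp.congr (hPH a ha b hb)
  have h1 : ∀ ω, G (jointHist E R (t + 1) ω) =
      ∑ a ∈ dirsFinset, ∑ b ∈ dirsFinset, I a b ω * H a b ω := fun ω => by
    obtain ⟨ha, hb⟩ := hsteps t ω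
    rw [Finset.sum_eq_single_of_mem _ (mem_dirsFinset.2 ha),
      Finset.sum_eq_single_of_mem _ (mem_dirsFinset.2 hb)]
    · simp only [hI, hH, and_self, if_true, one_mul, addStep_jointHist]
    · intro b _ hne
      simp only [hI]
      rw [if_neg (fun h => hne h.2.symm), zero_mul]
    · intro a _ hne
      refine Finset.sum_eq_zero fun b _ => ?_
      simp only [hI]
      rw [if_neg (fun h => hne h.1.symm), zero_mul]
  have h2 : ∀ ω, stepMean (FreshLeft t (jointHist E R t ω))
      (fun a b => G (addStep (jointHist E R t ω) t a b)) =
      ∑ a ∈ dirsFinset, ∑ b ∈ dirsFinset, P a b ω * H a b ω := fun ω => by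
    rw [stepMean_eq_sum]
    simp only [freshLeft_jointHist E R le_rfl, hP, hH]
  simp only [h1, h2]
  rw [integral_finsetSum _ fun a _ => integrable_finsetSum _ fun b _ => hIH a b,
    integral_finsetSum _ fun a ha => integrable_finsetSum _ fun b hb =>
      hPHi a (mem_dirsFinset.1 ha) b (mem_dirsFinset.1 hb)]
  refine Finset.sum_congr rfl fun a ha => ?_
  rw [integral_finsetSum _ fun b _ => hIH a b,
    integral_finsetSum _ fun b hb => hPHi a (mem_dirsFinset.1 ha) b (mem_dirsFinset.1 hb)]
  refine Finset.sum_congr rfl fun b hb => ?_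
  rw [← integral_condExp (𝓕.le t)]
  exact integral_congr_ae (hPH a (mem_dirsFinset.1 ha) b (mem_dirsFinset.1 hb))

lemma integral_jointHist_add {Ω : Type*} {m0 : MeasurableSpace Ω} {μ : Measure Ω}
    [IsProbabilityMeasure μ] {𝓕 : Filtration ℕ m0} {E R : ℕ → Ω → ℤ × ℤ}
    (hE : ∀ t, Measurable[𝓕 t] (E t)) (hR : ∀ t, Measurable[𝓕 t] (R t))
    (hsteps : ∀ t ω, E (t + 1) ω - E t ω ∈ dirs ∧ R (t + 1) ω - R t ω ∈ dirs)
    (hlaw : ∀ t, ∀ a ∈ dirs, ∀ b ∈ dirs,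
      μ[(fun ω => if E (t + 1) ω - E t ω = a ∧ R (t + 1) ω - R t ω = b
          then (1 : ℝ) else 0) | 𝓕 t]
        =ᵐ[μ] fun ω => if nonNV E t ω then jointStepProb a b
          else if a = b then 1 / 4 else 0)
    (n t : ℕ) (F : JPath → ℝ) (hF : ∀ q, |F q| ≤ 1) :
    ∫ ω, F (jointHist E R (t + n) ω) ∂μ = ∫ ω, pathMean n t (jointHist E R t ω) F ∂μ := by
  induction n generalizing t with
  | zero => rfl
  | succ n ih =>
    rw [show t + (n + 1) = t + 1 + n by ring, ih (t + 1)]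
    refine integral_jointHist_succ hE hR hsteps hlaw t (fun q => pathMean n (t + 1) q F)
      fun q => abs_le.2 ⟨?_, ?_⟩
    · rw [← pathMean_const n (t + 1) q (-1)]
      exact pathMean_mono fun q' _ => (abs_le.1 (hF q')).1
    · rw [← pathMean_const n (t + 1) q 1]
      exact pathMean_mono fun q' _ => (abs_le.1 (hF q')).2

/-- Events decided by the history have the same probability for the coupled walks as for the
explicit chain of joint trajectories. -/
lemma measure_jointHist_eq {Ω : Type*} {m0 : MeasurableSpace Ω} {μ : Measure Ω}
    [IsProbabilityMeasure μ] {𝓕 : Filtration ℕ m0} {E R : ℕ → Ω → ℤ × ℤ}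
    (hE : ∀ t, Measurable[𝓕 t] (E t)) (hR : ∀ t, Measurable[𝓕 t] (R t))
    (hE0 : ∀ ω, E 0 ω = 0) (hR0 : ∀ ω, R 0 ω = 0)
    (hsteps : ∀ t ω, E (t + 1) ω - E t ω ∈ dirs ∧ R (t + 1) ω - R t ω ∈ dirs)
    (hlaw : ∀ t, ∀ a ∈ dirs, ∀ b ∈ dirs,
      μ[(fun ω => if E (t + 1) ω - E t ω = a ∧ R (t + 1) ω - R t ω = b
          then (1 : ℝ) else 0) | 𝓕 t]
        =ᵐ[μ] fun ω => if nonNV E t ω then jointStepProb a b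
          else if a = b then 1 / 4 else 0)
    (n : ℕ) (Q : JPath → Prop) :
    μ {ω | Q (jointHist E R n ω)} = ENNReal.ofReal (pathProb n 0 (fun _ => 0) Q) := by
  have h1 := integral_jointHist_add hE hR hsteps hlaw n 0 (fun q => if Q q then 1 else 0)
    fun q => by split_ifs <;> simp
  have h0 : ∀ ω, jointHist E R 0 ω = fun _ => 0 := fun ω => by
    funext s
    rcases Nat.eq_zero_or_pos s with rfl | hs
    · rw [jointHist_apply le_rfl, hE0, hR0]; rfl
    · rw [jointHist, if_neg (by omega)]
  simp only [h0, integral_const, probReal_univ, one_smul, zero_add] at h1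
  have hm : MeasurableSet {ω | Q (jointHist E R n ω)} := by
    have h2 := (measurable_comp_jointHist hE hR n fun q => if Q q then 1 else 0).mono
      (𝓕.le n) le_rfl (measurableSet_singleton 1)
    convert h2 using 1
    ext ω
    by_cases h : Q (jointHist E R n ω) <;> simp [h]
  have h3 : (fun ω => if Q (jointHist E R n ω) then (1 : ℝ) else 0) =
      Set.indicator {ω | Q (jointHist E R n ω)} 1 := by
    funext ω
    by_cases h : Q (jointHist E R n ω) <;> simp [h]
  rw [h3, integral_indicator_one hm] at h1
  rw [pathProb, ← h1, Measure.real, ENNReal.ofReal_toReal (measure_ne_top μ _)]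

/-- The second coordinate of the drift is unlikely to exceed `B` times the square root of the
first one. -/
lemma exists_pathProb_drift_ratio_le : ∃ C : ℝ, 1 ≤ C ∧ ∀ (k N : ℕ) (p : JPath) (lam B : ℝ),
    0 < lam → lam < B → pathProb (k + N) 0 p (fun q =>
      B * Real.sqrt (((pathDrift q k (k + N)).1 : ℝ) + 1) ≤ |((pathDrift q k (k + N)).2 : ℝ)|) ≤
      C * Real.exp (-(1 / 32) * lam) := by
  obtain ⟨C, hC, h⟩ := exists_pathProb_drift_snd_le
  refine ⟨C + 3, by linarith, fun k N p lam B hlam hB => ?_⟩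
  refine (pathProb_le_add (Q₁ := fun q => ((pathDrift q k (k + N)).1 : ℝ) + 1 <
      (freshCount q k N : ℝ) / lam) (Q₂ := fun q => Real.sqrt lam *
      Real.sqrt (freshCount q k N) < |((pathDrift q k (k + N)).2 : ℝ)|) ?_).trans ?_
  · intro q hq hQ
    by_contra! hcon
    obtain ⟨h1, h2⟩ := hcon
    have hc : IsCont q k N q := by simpa using hq.tail
    have h3 : (0 : ℝ) ≤ (pathDrift q k (k + N)).1 := by exact_mod_cast hc.pathDrift_fst_nonneg
    rw [div_le_iff₀ hlam] at h1
    have h4 : Real.sqrt lam * Real.sqrt (freshCount q k N) ≤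
        lam * Real.sqrt (((pathDrift q k (k + N)).1 : ℝ) + 1) := by
      calc Real.sqrt lam * Real.sqrt (freshCount q k N)
          ≤ Real.sqrt lam * Real.sqrt ((((pathDrift q k (k + N)).1 : ℝ) + 1) * lam) := by gcongr
        _ = (Real.sqrt lam * Real.sqrt lam) *
            Real.sqrt (((pathDrift q k (k + N)).1 : ℝ) + 1) := by
          rw [Real.sqrt_mul (by linarith)]; ring
        _ = _ := by rw [Real.mul_self_sqrt hlam.le]
    have h5 : 0 < Real.sqrt (((pathDrift q k (k + N)).1 : ℝ) + 1) :=
      Real.sqrt_pos.2 (by linarith)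
    have h6 := mul_lt_mul_of_pos_right hB h5
    linarith
  · have h1 := pathProb_drift_fst_le k N p hlam
    have h2 := h k N p (Real.sqrt lam) (Real.sqrt_pos.2 hlam)
    rw [Real.sq_sqrt hlam.le] at h2
    have h3 : C * Real.exp (-(1 / 8) * lam) ≤ C * Real.exp (-(1 / 32) * lam) :=
      mul_le_mul_of_nonneg_left (Real.exp_le_exp.2 (by linarith)) (by linarith)
    linarith

/-- **Lemma 5.7 (coupling drift comparison):** for the MAW `E` and SRW `R` coupled so
that they move identically at NV times and use the joint distribution `jointStepProb`
at non-NV times, there are constants `C, c > 0` such that, with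
`D(k,l) = (E(l)-R(l)) - (E(k)-R(k))` and `K` the number of non-NV times in `[k,l)`:
`P(D(k,l)₁ + 1 < K/λ) ≤ C e^{-cλ}`, `P(|D(k,l)₂| > λ√K) ≤ C e^{-cλ²}`, and
consequently `P(∃ k < l < n : |D(k,l)₂| ≥ C log n · √(D(k,l)₁ + 1)) ≤ 1/n`. -/
theorem maw_srw_coupling_drift
    {Ω : Type*} {m0 : MeasurableSpace Ω} (μ : Measure Ω) [IsProbabilityMeasure μ]
    (𝓕 : Filtration ℕ m0)
    (E R : ℕ → Ω → ℤ × ℤ)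
    (hEadp : ∀ t, Measurable[𝓕 t] (E t))
    (hRadp : ∀ t, Measurable[𝓕 t] (R t))
    (hE0 : ∀ ω, E 0 ω = 0) (hR0 : ∀ ω, R 0 ω = 0)
    (hsteps : ∀ t ω, E (t + 1) ω - E t ω ∈ dirs ∧ R (t + 1) ω - R t ω ∈ dirs)
    (hcouple : ∀ t ω, ¬ nonNV E t ω → E (t + 1) ω - E t ω = R (t + 1) ω - R t ω)
    (hlaw : ∀ t, ∀ a ∈ dirs, ∀ b ∈ dirs,
      μ[(fun ω => if E (t + 1) ω - E t ω = a ∧ R (t + 1) ω - R t ω = b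
          then (1 : ℝ) else 0) | 𝓕 t]
        =ᵐ[μ] fun ω => if nonNV E t ω then jointStepProb a b
          else if a = b then 1 / 4 else 0) :
    ∃ C c : ℝ, 0 < C ∧ 0 < c ∧
      (∀ k l : ℕ, k < l → ∀ lam : ℝ, 0 < lam →
        μ {ω | ((driftD E R k l ω).1 : ℝ) + 1 < (numNonNV E k l ω : ℝ) / lam}
            ≤ ENNReal.ofReal (C * Real.exp (-c * lam)) ∧
        μ {ω | lam * Real.sqrt (numNonNV E k l ω) < |((driftD E R k l ω).2 : ℝ)|}
            ≤ ENNReal.ofReal (C * Real.exp (-c * lam ^ 2))) ∧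
      (∀ n : ℕ, 2 ≤ n →
        μ {ω | ∃ k l : ℕ, k < l ∧ l < n ∧
            C * Real.log n * Real.sqrt (((driftD E R k l ω).1 : ℝ) + 1)
              ≤ |((driftD E R k l ω).2 : ℝ)|}
          ≤ ((n : ENNReal))⁻¹) := by
  obtain ⟨C₁, hC₁, h₁⟩ := exists_pathProb_drift_snd_le
  obtain ⟨C₂, hC₂, h₂⟩ := exists_pathProb_drift_ratio_le
  obtain ⟨M, hM⟩ := pow_unbounded_of_one_lt C₂ (one_lt_two : (1 : ℝ) < 2)
  set A : ℝ := 32 * (M + 3) with hA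
  have hM0 : (0 : ℝ) ≤ M := Nat.cast_nonneg M
  have hlaw' := fun (n : ℕ) (Q : JPath → Prop) =>
    measure_jointHist_eq (μ := μ) hEadp hRadp hE0 hR0 hsteps hlaw n Q
  refine ⟨C₁ + 3 + A, 1 / 32, by positivity, by norm_num, ?_, ?_⟩
  · intro k l hkl lam hlam
    obtain ⟨N, rfl⟩ := Nat.exists_eq_add_of_le hkl.le
    simp only [driftD_eq_pathDrift E R hkl.le, numNonNV_eq_freshCount E R]
    have hA0 : 0 ≤ A := by positivity
    refine ⟨?_, ?_⟩
    · rw [hlaw' (k + N) fun q => ((pathDrift q k (k + N)).1 : ℝ) + 1 <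
        (freshCount q k N : ℝ) / lam]
      refine ENNReal.ofReal_le_ofReal ((pathProb_drift_fst_le k N _ hlam).trans ?_)
      exact mul_le_mul_of_nonneg_right (by linarith) (Real.exp_pos _).le
    · rw [hlaw' (k + N) fun q => lam * Real.sqrt (freshCount q k N) <
        |((pathDrift q k (k + N)).2 : ℝ)|]
      refine ENNReal.ofReal_le_ofReal ((h₁ k N _ lam hlam).trans ?_)
      exact mul_le_mul (by linarith) (Real.exp_le_exp.2 (by nlinarith [sq_nonneg lam]))
        (Real.exp_pos _).le (by linarith)
  · intro n hn
    have hn2 : (2 : ℝ) ≤ n := by exact_mod_cast hn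
    have hlog : 0 < Real.log n := Real.log_pos (by linarith)
    set y : ℝ := C₂ * Real.exp (-(1 / 32) * (A * Real.log n)) with hy
    have hy1 : n * n * y ≤ (n : ℝ)⁻¹ := by
      have h3 : Real.exp (-(1 / 32) * (A * Real.log n)) = ((n : ℝ) ^ (M + 3))⁻¹ := by
        rw [show -(1 / 32) * (A * Real.log n) = -(((M + 3 : ℕ) : ℝ) * Real.log n) by
          rw [hA]; push_cast; ring, Real.exp_neg, Real.exp_nat_mul, Real.exp_log (by linarith)]
      have h4 : C₂ ≤ (n : ℝ) ^ M := hM.le.trans (pow_le_pow_left₀ (by norm_num) hn2 M)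
      have h5 : 0 < (n : ℝ) := by linarith
      calc n * n * y ≤ n * n * ((n : ℝ) ^ M * ((n : ℝ) ^ (M + 3))⁻¹) := by
            rw [hy, h3]; gcongr
        _ = (n : ℝ)⁻¹ := by rw [pow_add]; field_simp
    have hpair : ∀ k l : ℕ, μ {ω | k < l ∧ (C₁ + 3 + A) * Real.log n *
        Real.sqrt (((driftD E R k l ω).1 : ℝ) + 1) ≤ |((driftD E R k l ω).2 : ℝ)|} ≤
        ENNReal.ofReal y := by
      intro k l
      by_cases hkl : k < l
      · obtain ⟨N, rfl⟩ := Nat.exists_eq_add_of_le hkl.le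
        simp only [driftD_eq_pathDrift E R hkl.le, hkl, true_and]
        rw [hlaw' (k + N) fun q => (C₁ + 3 + A) * Real.log n *
          Real.sqrt (((pathDrift q k (k + N)).1 : ℝ) + 1) ≤ |((pathDrift q k (k + N)).2 : ℝ)|]
        exact ENNReal.ofReal_le_ofReal (h₂ k N _ (A * Real.log n) _ (by positivity)
          (mul_lt_mul_of_pos_right (by linarith) hlog))
      · simp [hkl]
    have hsub : {ω | ∃ k l : ℕ, k < l ∧ l < n ∧ (C₁ + 3 + A) * Real.log n *
        Real.sqrt (((driftD E R k l ω).1 : ℝ) + 1) ≤ |((driftD E R k l ω).2 : ℝ)|} ⊆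
        ⋃ i ∈ Finset.range n ×ˢ Finset.range n, {ω | i.1 < i.2 ∧ (C₁ + 3 + A) * Real.log n *
        Real.sqrt (((driftD E R i.1 i.2 ω).1 : ℝ) + 1) ≤ |((driftD E R i.1 i.2 ω).2 : ℝ)|} := by
      rintro ω ⟨k, l, hkl, hl, h⟩
      refine Set.mem_biUnion (x := (k, l)) ?_ ⟨hkl, h⟩
      exact Finset.mem_coe.2 (Finset.mem_product.2
        ⟨Finset.mem_range.2 (hkl.trans hl), Finset.mem_range.2 hl⟩)
    refine (measure_mono hsub).trans ((measure_biUnion_finset_le _ _).trans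
      ((Finset.sum_le_sum fun i _ => hpair i.1 i.2).trans ?_))
    rw [Finset.sum_const, Finset.card_product, Finset.card_range, nsmul_eq_mul,
      ← ENNReal.ofReal_natCast, ← ENNReal.ofReal_mul (by positivity), Nat.cast_mul]
    refine (ENNReal.ofReal_le_ofReal hy1).trans (le_of_eq ?_)
    rw [ENNReal.ofReal_inv_of_pos (by linarith), ENNReal.ofReal_natCast]
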